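/- arXiv:1006.2416 — 2 statements merged into one kernel-verified Lean document; each statement's English description precedes it below -/
import Mathlib

section
/- (Larman) Let d ≥ 3 and n ≥ 1, let a : Fin n → (Fin d → ℝ) and b : Fin n → ℝ, and let P = { x : Fin d → ℝ | ∀ i, ⟪a i, x⟫ ≤ b i } be the polyhedron defined by these n inequalities. Then for any two extreme points u and v of P there is a path from u to v in the graph G(P) of length at most n · 2^(d−3). -/
open scoped BigOperators

noncomputable section

/-- Adjacency in the graph of a convex set `P`: two distinct extreme points whose closed
segment is a face of `P`. -/
def PolyAdj {E : Type*} [AddCommGroup E] [Module ℝ E] (P : Set E) (a b : E) : Prop :=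
  a ≠ b ∧ a ∈ Set.extremePoints ℝ P ∧ b ∈ Set.extremePoints ℝ P ∧
    IsExtreme ℝ P (segment ℝ a b)

/-- A path of length `L` in the graph of `P` from `a` to `b`. -/
def HasPathOfLength {E : Type*} [AddCommGroup E] [Module ℝ E] (P : Set E) (a b : E)
    (L : ℕ) : Prop :=
  ∃ f : ℕ → E, f 0 = a ∧ f L = b ∧ ∀ i < L, PolyAdj P (f i) (f (i + 1))

set_option linter.unusedSectionVars false

/-- A system of linear inequalities `a i x ≤ b i` such that the constraints that are tight at any
feasible point are linearly independent. -/
structure SimpleSystem (V ι : Type*) [AddCommGroup V] [Module ℝ V] where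
  /-- The normals. -/
  a : ι → Module.Dual ℝ V
  /-- The right-hand sides. -/
  b : ι → ℝ
  nondeg : ∀ x, (∀ i, a i x ≤ b i) → LinearIndependent ℝ (fun i : {i // a i x = b i} => a i)

namespace SimpleSystem

open Module

variable {V ι : Type*} [AddCommGroup V] [Module ℝ V] [FiniteDimensional ℝ V]
  [Fintype ι] [DecidableEq ι] (P : SimpleSystem V ι)

/-- The feasible region. -/
def Feasible (x : V) : Prop := ∀ i, P.a i x ≤ P.b i

/-- The constraints that are tight at `x`. -/
def tight (x : V) : Finset ι := Finset.univ.filter fun i => P.a i x = P.b i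

/-- Vertices: feasible points with as many tight constraints as the dimension. -/
def IsVertex (x : V) : Prop := P.Feasible x ∧ (P.tight x).card = finrank ℝ V

/-- The face on which the constraints of `T` are tight. -/
def Face (T : Finset ι) (x : V) : Prop := P.Feasible x ∧ T ⊆ P.tight x

/-- The vertices of the face given by `T`. -/
def FaceVertex (T : Finset ι) (x : V) : Prop := P.IsVertex x ∧ T ⊆ P.tight x

/-- Two vertices are adjacent if they have all but one of their tight constraints in common. -/
def Adj (x y : V) : Prop :=
  P.IsVertex x ∧ P.IsVertex y ∧ (P.tight x ∩ P.tight y).card + 1 = finrank ℝ V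

variable {P} {x y z : V} {i j k : ι} {T S : Finset ι}

@[simp] lemma mem_tight : i ∈ P.tight x ↔ P.a i x = P.b i := by simp [tight]

lemma FaceVertex.face (h : P.FaceVertex T x) : P.Face T x := ⟨h.1.1, h.2⟩

lemma FaceVertex.mono (h : P.FaceVertex T x) (hS : S ⊆ T) : P.FaceVertex S x :=
  ⟨h.1, hS.trans h.2⟩

lemma Face.eq (h : P.Face T x) (hi : i ∈ T) : P.a i x = P.b i := mem_tight.1 (h.2 hi)

lemma Adj.symm (h : P.Adj x y) : P.Adj y x := ⟨h.2.1, h.1, by rw [Finset.inter_comm]; exact h.2.2⟩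

lemma card_tight_le (hx : P.Feasible x) : (P.tight x).card ≤ finrank ℝ V := by
  have h := (P.nondeg x hx).fintype_card_le_finrank
  rw [Subspace.dual_finrank_eq, Fintype.card_subtype] at h
  exact h

lemma IsVertex.exists_dir (hx : P.IsVertex x) :
    ∃ e : ι → V, (∀ i ∈ P.tight x, ∀ j ∈ P.tight x, P.a j (e i) = if j = i then 1 else 0) ∧
      ∀ z, z = ∑ i ∈ P.tight x, P.a i z • e i := by
  classical
  let Φ : V →ₗ[ℝ] (P.tight x → ℝ) := LinearMap.pi fun i => P.a i
  have hli : LinearIndependent ℝ (fun i : P.tight x => P.a i) :=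
    (P.nondeg x hx.1).comp (fun i : P.tight x => ⟨i.1, mem_tight.1 i.2⟩) fun i j h => by
      injection h with h; exact Subtype.ext h
  have hcard : Fintype.card (P.tight x) = finrank ℝ (Dual ℝ V) := by
    rw [Subspace.dual_finrank_eq, Fintype.card_coe, hx.2]
  have hspan := hli.span_eq_top_of_card_eq_finrank' hcard
  have hinj : Function.Injective Φ := by
    rw [injective_iff_map_eq_zero]
    intro z hz
    rw [← forall_dual_apply_eq_zero_iff ℝ]
    intro c
    have hc : c ∈ Submodule.span ℝ (Set.range fun i : P.tight x => P.a i) := by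
      rw [hspan]; trivial
    induction hc using Submodule.span_induction with
    | mem c hc => obtain ⟨i, rfl⟩ := hc; exact congrFun hz i
    | zero => rfl
    | add c d _ _ h1 h2 => simp [h1, h2]
    | smul r c _ h => simp [h]
  have hsurj : Function.Surjective Φ := by
    rwa [← LinearMap.injective_iff_surjective_of_finrank_eq_finrank]
    rw [Module.finrank_fintype_fun_eq_card, Fintype.card_coe, hx.2]
  choose g hg using hsurj
  let e : ι → V := fun i => if h : i ∈ P.tight x then g (Pi.single ⟨i, h⟩ 1) else 0
  have he : ∀ i ∈ P.tight x, ∀ j ∈ P.tight x, P.a j (e i) = if j = i then 1 else 0 := by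
    intro i hi j hj
    have := congrFun (hg (Pi.single ⟨i, hi⟩ 1)) ⟨j, hj⟩
    simp only [e, hi, dif_pos]
    refine Eq.trans this ?_
    simp [Pi.single_apply]
  refine ⟨e, he, fun z => hinj ?_⟩
  ext j
  simp only [Φ, LinearMap.pi_apply, map_sum, map_smul, smul_eq_mul]
  rw [Finset.sum_eq_single_of_mem j.1 j.2]
  · simp [he j.1 j.2 j.1 j.2]
  · intro i hi hij
    rw [he i hi j.1 j.2, if_neg (Ne.symm hij), mul_zero]

variable (P) in
/-- The basis dual to the normals of the constraints tight at the vertex `x`. -/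
def dir (x : V) : ι → V :=
  open Classical in if h : P.IsVertex x then h.exists_dir.choose else 0

lemma IsVertex.a_dir (hx : P.IsVertex x) (hi : i ∈ P.tight x) (hj : j ∈ P.tight x) :
    P.a j (P.dir x i) = if j = i then 1 else 0 := by
  rw [dir, dif_pos hx]
  exact hx.exists_dir.choose_spec.1 i hi j hj

lemma IsVertex.sum_dir (hx : P.IsVertex x) (z : V) :
    ∑ i ∈ P.tight x, P.a i z • P.dir x i = z := by
  rw [dir, dif_pos hx]
  exact (hx.exists_dir.choose_spec.2 z).symm

lemma IsVertex.apply_eq_sum (hx : P.IsVertex x) (c : Dual ℝ V) (z : V) :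
    c z = ∑ i ∈ P.tight x, P.a i z * c (P.dir x i) := by
  conv_lhs => rw [← hx.sum_dir z]
  simp

lemma IsVertex.sum_a_dir (hx : P.IsVertex x) (hi : i ∈ P.tight x) :
    (∑ j ∈ P.tight x, P.a j) (P.dir x i) = 1 := by
  rw [LinearMap.coe_sum, Finset.sum_apply, Finset.sum_congr rfl fun j hj => hx.a_dir hi hj,
    Finset.sum_ite_eq', if_pos hi]

lemma IsVertex.eq_zero (hx : P.IsVertex x) (hz : ∀ i ∈ P.tight x, P.a i z = 0) : z = 0 := by
  rw [← hx.sum_dir z]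
  exact Finset.sum_eq_zero fun i hi => by rw [hz i hi, zero_smul]

lemma IsVertex.eq_smul_dir (hx : P.IsVertex x) (hk : k ∈ P.tight x)
    (hz : ∀ i ∈ P.tight x, i ≠ k → P.a i z = 0) : z = P.a k z • P.dir x k := by
  conv_lhs => rw [← hx.sum_dir z]
  exact Finset.sum_eq_single_of_mem k hk fun i hi hik => by rw [hz i hi hik, zero_smul]

lemma IsVertex.eq_of_tight (hx : P.IsVertex x) (hy : P.tight x ⊆ P.tight y) : y = x := by
  refine sub_eq_zero.1 (hx.eq_zero fun i hi => ?_)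
  rw [map_sub, mem_tight.1 hi, mem_tight.1 (hy hi), sub_self]

lemma IsVertex.tight_injOn : Set.InjOn P.tight {x | P.IsVertex x} :=
  fun _ _ _ hy h => hy.eq_of_tight h.ge

lemma finite_vertices : {x | P.IsVertex x}.Finite :=
  Set.Finite.of_finite_image (Set.toFinite _) IsVertex.tight_injOn

lemma IsVertex.tight_eq_of_subset (hx : P.IsVertex x) (hy : P.Feasible y)
    (hS : S ⊆ P.tight y) (hcard : S.card = (P.tight x).card) : P.tight y = S ∧ P.IsVertex y := by
  have h1 := card_tight_le hy
  have h2 : P.tight y = S :=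
    (Finset.eq_of_subset_of_card_le hS (by rw [hcard, hx.2]; exact h1)).symm
  exact ⟨h2, hy, by rw [h2, hcard, hx.2]⟩

/-- The edge of a vertex `x` on which the constraint `i` is released is a ray or leads to another
vertex. -/
lemma IsVertex.ray_or_step (hx : P.IsVertex x) (hi : i ∈ P.tight x) :
    (∀ s : ℝ, 0 ≤ s → P.Feasible (x - s • P.dir x i)) ∨
      ∃ s : ℝ, 0 < s ∧ ∃ j, j ∉ P.tight x ∧ P.IsVertex (x - s • P.dir x i) ∧
        P.tight (x - s • P.dir x i) = insert j ((P.tight x).erase i) := by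
  classical
  set e := P.dir x i with he
  have hval : ∀ (s : ℝ) (k : ι), P.a k (x - s • e) = P.a k x - s * P.a k e := by
    intro s k; simp
  have htight : ∀ (s : ℝ), 0 ≤ s → ∀ k ∈ P.tight x, P.a k (x - s • e) ≤ P.b k := by
    intro s hs k hk
    rw [hval, hx.a_dir hi hk, mem_tight.1 hk]
    split_ifs <;> simp [hs]
  by_cases hB : ∃ k, P.a k e < 0
  · right
    let B := Finset.univ.filter fun k => P.a k e < 0
    have hBne : B.Nonempty := by obtain ⟨k, hk⟩ := hB; exact ⟨k, by simp [B, hk]⟩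
    obtain ⟨j, hj, hmin⟩ := B.exists_min_image (fun k => (P.b k - P.a k x) / (- P.a k e)) hBne
    have hj0 : P.a j e < 0 := by simpa [B] using hj
    have hjx : j ∉ P.tight x := fun h => by
      have := hx.a_dir hi h
      rw [← he] at this
      split_ifs at this <;> linarith
    set s := (P.b j - P.a j x) / (- P.a j e) with hs
    have hs0 : 0 < s := by
      apply div_pos _ (by linarith)
      exact sub_pos.2 (lt_of_le_of_ne (hx.1 j) fun h => hjx (mem_tight.2 h))
    have hfeas : P.Feasible (x - s • e) := by
      intro k
      by_cases hk : P.a k e < 0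
      · have := hmin k (by simp [B, hk])
        rw [hval]
        rw [le_div_iff₀ (by linarith)] at this
        linarith
      · rw [hval]
        have := mul_nonneg hs0.le (not_lt.1 hk)
        linarith [hx.1 k]
    have hsub : insert j ((P.tight x).erase i) ⊆ P.tight (x - s • e) := by
      intro k hk
      rw [Finset.mem_insert, Finset.mem_erase] at hk
      rw [mem_tight, hval]
      rcases hk with rfl | ⟨hki, hk⟩
      · have := hj0.ne; rw [hs]; field_simp; ring
      · rw [hx.a_dir hi hk, if_neg hki, mem_tight.1 hk]; ring
    have hcard : (insert j ((P.tight x).erase i)).card = (P.tight x).card := by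
      rw [Finset.card_insert_of_notMem (fun h => hjx (Finset.mem_of_mem_erase h)),
        Finset.card_erase_add_one hi]
    obtain ⟨h1, h2⟩ := hx.tight_eq_of_subset hfeas hsub hcard
    exact ⟨s, hs0, j, hjx, h2, h1⟩
  · left
    push Not at hB
    intro s hs k
    rw [hval]
    have := mul_nonneg hs (hB k)
    linarith [hx.1 k]

lemma IsVertex.adj_of_tight_eq (hx : P.IsVertex x) (hy : P.IsVertex y) (hi : i ∈ P.tight x)
    (hj : j ∉ P.tight x) (h : P.tight y = insert j ((P.tight x).erase i)) : P.Adj x y := by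
  refine ⟨hx, hy, ?_⟩
  have : P.tight x ∩ P.tight y = (P.tight x).erase i := by
    rw [h]; ext k; simp only [Finset.mem_inter, Finset.mem_insert, Finset.mem_erase]
    constructor
    · rintro ⟨h1, rfl | h2⟩
      · exact absurd h1 hj
      · exact h2
    · rintro ⟨h1, h2⟩; exact ⟨h2, Or.inr ⟨h1, h2⟩⟩
  rw [this, Finset.card_erase_add_one hi, hx.2]

lemma IsVertex.sub_apply (hx : P.IsVertex x) (hT : T ⊆ P.tight x) (hz : P.Face T z)
    (c : Dual ℝ V) :
    c z - c x = ∑ i ∈ P.tight x \ T, (P.a i z - P.b i) * c (P.dir x i) := by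
  rw [← map_sub, hx.apply_eq_sum c (z - x), ← Finset.sum_sdiff hT, add_eq_left.2]
  · refine Finset.sum_congr rfl fun i hi => ?_
    rw [map_sub, mem_tight.1 (Finset.mem_sdiff.1 hi).1]
  · refine Finset.sum_eq_zero fun i hi => ?_
    rw [map_sub, mem_tight.1 (hT hi), hz.eq hi, sub_self, zero_mul]

/-- Nonnegative coefficients certify optimality over a face. -/
lemma FaceVertex.le_of_nonneg (hx : P.FaceVertex T x) {c : Dual ℝ V}
    (hc : ∀ i ∈ P.tight x \ T, 0 ≤ c (P.dir x i)) (hz : P.Face T z) : c z ≤ c x := by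
  have := hx.1.sub_apply hx.2 hz c
  have h2 : ∑ i ∈ P.tight x \ T, (P.a i z - P.b i) * c (P.dir x i) ≤ 0 :=
    Finset.sum_nonpos fun i hi => mul_nonpos_of_nonpos_of_nonneg (sub_nonpos.2 (hz.1 i)) (hc i hi)
  linarith

lemma FaceVertex.tight_of_eq (hx : P.FaceVertex T x) {c : Dual ℝ V}
    (hc : ∀ i ∈ P.tight x \ T, 0 ≤ c (P.dir x i)) (hz : P.Face T z) (h : c z = c x)
    (hi : i ∈ P.tight x \ T) (hi0 : 0 < c (P.dir x i)) : i ∈ P.tight z := by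
  have h1 := hx.1.sub_apply hx.2 hz c
  rw [h, sub_self] at h1
  have h2 := (Finset.sum_eq_zero_iff_of_nonpos fun i hi =>
    mul_nonpos_of_nonpos_of_nonneg (sub_nonpos.2 (hz.1 i)) (hc i hi)).1 h1.symm i hi
  rw [mul_eq_zero] at h2
  rcases h2 with h2 | h2
  · exact mem_tight.2 (sub_eq_zero.1 h2)
  · exact absurd h2 hi0.ne'

lemma FaceVertex.lt_of_pos (hx : P.FaceVertex T x) {c : Dual ℝ V}
    (hc : ∀ i ∈ P.tight x \ T, 0 < c (P.dir x i)) (hz : P.Face T z) (hzx : z ≠ x) : c z < c x := by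
  refine lt_of_le_of_ne (hx.le_of_nonneg (fun i hi => (hc i hi).le) hz) fun h => hzx ?_
  refine hx.1.eq_of_tight fun i hi => ?_
  by_cases hiT : i ∈ T
  · exact hz.2 hiT
  · have hi' := Finset.mem_sdiff.2 ⟨hi, hiT⟩
    exact hx.tight_of_eq (fun i hi => (hc i hi).le) hz h hi' (hc i hi')

/-- If `c` increases along the edge of `x` that releases `i` and is bounded on the feasible region,
this edge leads to a vertex with a larger value. -/
lemma FaceVertex.improve (hx : P.FaceVertex T x) {c : Dual ℝ V} {M : ℝ}
    (hM : ∀ z, P.Face T z → c z ≤ M) (hi : i ∈ P.tight x \ T) (hci : c (P.dir x i) < 0) :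
    ∃ s : ℝ, 0 < s ∧ ∃ j, j ∉ P.tight x ∧ P.FaceVertex T (x - s • P.dir x i) ∧
        P.tight (x - s • P.dir x i) = insert j ((P.tight x).erase i) ∧
        c x < c (x - s • P.dir x i) := by
  rw [Finset.mem_sdiff] at hi
  rcases hx.1.ray_or_step hi.1 with h | ⟨s, hs, j, hj, hv, ht⟩
  · exfalso
    set s := (|M - c x| + 1) / (- c (P.dir x i))
    have hs : 0 ≤ s := div_nonneg (by positivity) (by linarith)
    have hf : P.Face T (x - s • P.dir x i) := by
      refine ⟨h s hs, fun k hk => ?_⟩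
      rw [mem_tight, map_sub, map_smul, hx.1.a_dir hi.1 (hx.2 hk),
        if_neg (show ¬ k = i from fun h => hi.2 (h ▸ hk)), mem_tight.1 (hx.2 hk)]
      simp
    have h1 := hM _ hf
    rw [map_sub, map_smul, smul_eq_mul] at h1
    have h2 : s * c (P.dir x i) = -(|M - c x| + 1) := by
      have := hci.ne; simp only [s]; field_simp
    have := le_abs_self (M - c x)
    linarith
  · refine ⟨s, hs, j, hj, ⟨hv, fun k hk => ?_⟩, ht, ?_⟩
    · rw [ht, Finset.mem_insert, Finset.mem_erase]
      exact Or.inr ⟨fun h => hi.2 (h ▸ hk), hx.2 hk⟩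
    · rw [map_sub, map_smul, smul_eq_mul]
      have := mul_pos_of_neg_of_neg (neg_lt_zero.2 hs) hci
      linarith

/-- Induction along vertices of a face with increasing value of a linear functional. -/
lemma vertex_induction {C : V → Prop} (c : Dual ℝ V)
    (h : ∀ x, P.FaceVertex T x → (∀ y, P.FaceVertex T y → c x < c y → C y) → C x)
    (hx : P.FaceVertex T x) : C x := by
  have hfin : {y | P.IsVertex y}.Finite := finite_vertices
  induction hn : (hfin.toFinset.filter fun y => c x < c y).card using Nat.strong_induction_on
    generalizing x with
  | _ n ih =>
    refine h x hx fun y hy hxy => ih _ ?_ hy rfl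
    rw [← hn]
    refine Finset.card_lt_card ?_
    rw [Finset.ssubset_iff_of_subset]
    · exact ⟨y, by simp [hy.1, hxy], by simp⟩
    · intro w hw
      simp only [Finset.mem_filter, Set.Finite.mem_toFinset, Set.mem_ofPred_eq] at hw ⊢
      exact ⟨hw.1, hxy.trans hw.2⟩

/-- The graph of every face is connected. -/
lemma face_connected (hx : P.FaceVertex T x) (hy : P.FaceVertex T y) :
    Relation.ReflTransGen (fun v w => P.FaceVertex T v ∧ P.FaceVertex T w ∧ P.Adj v w) x y := by
  let c : Dual ℝ V := ∑ i ∈ P.tight y, P.a i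
  have hpos : ∀ i ∈ P.tight y \ T, 0 < c (P.dir y i) := fun i hi => by
    rw [hy.1.sum_a_dir (Finset.mem_sdiff.1 hi).1]; exact one_pos
  refine vertex_induction (C := fun x => Relation.ReflTransGen _ x y) c (fun x hx ih => ?_) hx
  by_cases hxy : x = y
  · rw [hxy]
  have hlt := hy.lt_of_pos hpos hx.face hxy
  obtain ⟨i, hi, hci⟩ : ∃ i ∈ P.tight x \ T, c (P.dir x i) < 0 := by
    by_contra! hcon
    exact absurd (hx.le_of_nonneg hcon hy.face) (not_le.2 hlt)
  obtain ⟨s, -, j, hj, hv, ht, hc⟩ := hx.improve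
    (fun z hz => hy.le_of_nonneg (fun i hi => (hpos i hi).le) hz) hi hci
  exact (Relation.ReflTransGen.single
    ⟨hx, hv, hx.1.adj_of_tight_eq hv.1 (Finset.mem_sdiff.1 hi).1 hj ht⟩).trans (ih _ hv hc)

/-- The functionals `c + t • d`, a line in the dual space. -/
def pencil (c d : Dual ℝ V) (t : ℝ) : Dual ℝ V := c + t • d

@[simp] lemma pencil_apply (c d : Dual ℝ V) (t : ℝ) (x : V) :
    pencil c d t x = c x + t * d x := by
  simp [pencil]

variable (P) in
/-- The path of vertices of a face which successively maximize `pencil c d t` as `t` increases. -/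
structure ParamPath (T : Finset ι) (c d : Dual ℝ V) (m : ℕ) (w : ℕ → V) (θ : ℕ → ℝ) :
    Prop where
  vertex : ∀ p ≤ m, P.FaceVertex T (w p)
  lt_succ : ∀ p < m, θ p < θ (p + 1)
  pos : ∀ p ≤ m, ∀ i ∈ P.tight (w p) \ T, 0 < pencil c d (θ p) (P.dir (w p) i)
  step : ∀ p < m, ∃ τ, θ p < τ ∧ τ < θ (p + 1) ∧ ∃ i ∈ P.tight (w p) \ T, ∃ j ∉ P.tight (w p),
    P.tight (w (p + 1)) = insert j ((P.tight (w p)).erase i) ∧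
    pencil c d τ (P.dir (w p) i) = 0 ∧ pencil c d τ (P.dir (w (p + 1)) j) = 0 ∧
    ∀ k ∈ (P.tight (w p) \ T).erase i,
      0 < pencil c d τ (P.dir (w p) k) ∧ 0 < pencil c d τ (P.dir (w (p + 1)) k)

variable (P) in
/-- No functional of the pencil is constant on two edges of the face at one vertex. -/
def Gen (T : Finset ι) (c d : Dual ℝ V) : Prop :=
  ∀ x, P.FaceVertex T x → ∀ t, ∀ i ∈ P.tight x \ T, ∀ j ∈ P.tight x \ T,
    pencil c d t (P.dir x i) = 0 → pencil c d t (P.dir x j) = 0 → i = j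

lemma Gen.mono {c d : Dual ℝ V} (h : P.Gen T c d) (hS : T ⊆ S) : P.Gen S c d :=
  fun x hx t i hi j hj => h x (hx.mono hS) t i (Finset.sdiff_subset_sdiff le_rfl hS hi) j
    (Finset.sdiff_subset_sdiff le_rfl hS hj)

open Topology in
lemma exists_pos_after {κ : Type*} (s : Finset κ) (f g : κ → ℝ) {τ β : ℝ} (hβ : τ < β)
    (h : ∀ k ∈ s, 0 < f k + τ * g k ∨ f k + τ * g k = 0 ∧ 0 < g k) :
    ∃ t, τ < t ∧ t < β ∧ ∀ k ∈ s, 0 < f k + t * g k := by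
  have h1 : ∀ᶠ t in 𝓝[>] τ, ∀ k ∈ s, 0 < f k + t * g k := by
    rw [Filter.eventually_all_finset]
    intro k hk
    rcases h k hk with h | ⟨h, hg⟩
    · have : ContinuousAt (fun t : ℝ => f k + t * g k) τ := by fun_prop
      exact (this.eventually (lt_mem_nhds h)).filter_mono nhdsWithin_le_nhds
    · filter_upwards [self_mem_nhdsWithin] with t ht
      have := mul_pos (sub_pos.2 (Set.mem_Ioi.1 ht)) hg
      linarith
  obtain ⟨t, ht, h2, h3⟩ := ((h1.and (Ioo_mem_nhdsGT hβ))).exists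
  exact ⟨t, h2, h3, ht⟩

lemma exists_first_zero {κ : Type*} (s : Finset κ) (f g : κ → ℝ) {α β : ℝ} (hαβ : α ≤ β)
    (hα : ∀ k ∈ s, 0 < f k + α * g k) (hβ : ∃ k ∈ s, f k + β * g k < 0) :
    ∃ τ, α < τ ∧ τ < β ∧ ∃ i ∈ s, f i + β * g i < 0 ∧ f i + τ * g i = 0 ∧ g i < 0 ∧
      ∀ k ∈ s, 0 ≤ f k + τ * g k := by
  obtain ⟨k, hk, hk0⟩ := hβ
  have hB : (s.filter fun k => f k + β * g k < 0).Nonempty := ⟨k, by simp [hk, hk0]⟩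
  obtain ⟨i, hi, hmin⟩ := Finset.exists_min_image _ (fun k => f k / (- g k)) hB
  rw [Finset.mem_filter] at hi
  have hneg : ∀ k ∈ s, f k + β * g k < 0 → g k < 0 := fun k hk h => by
    have := hα k hk
    by_contra! hg
    have := mul_nonneg (sub_nonneg.2 hαβ) hg
    linarith
  have hg := hneg i hi.1 hi.2
  have hτ : f i / (- g i) * g i = - f i := by have := hg.ne; field_simp
  have hαi := hα i hi.1
  refine ⟨f i / (- g i), ?_, ?_, i, hi.1, hi.2, by rw [hτ]; ring, hg, fun k hk => ?_⟩
  · rw [lt_div_iff₀ (by linarith)]; linarith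
  · rw [div_lt_iff₀ (by linarith)]; linarith
  · set τ := f i / (- g i) with hτd
    have h1 : α < τ := by rw [hτd, lt_div_iff₀ (by linarith)]; linarith
    have h2 : τ < β := by rw [hτd, div_lt_iff₀ (by linarith)]; linarith
    by_cases hkβ : f k + β * g k < 0
    · have := hmin k (by simp [hk, hkβ])
      rw [le_div_iff₀ (by linarith [hneg k hk hkβ])] at this
      linarith
    · have h3 := hα k hk
      rcases le_total 0 (g k) with hg | hg
      · have := mul_nonneg (sub_nonneg.2 h1.le) hg; linarith
      · have := mul_nonpos_of_nonneg_of_nonpos (sub_nonneg.2 h2.le) hg; linarith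

/-- The dual bases at the two ends of an edge. -/
lemma IsVertex.dir_step (hx : P.IsVertex x) (hi : i ∈ P.tight x) (hj : j ∉ P.tight x)
    {s : ℝ} (hs : 0 < s) (hy : P.IsVertex (x - s • P.dir x i))
    (ht : P.tight (x - s • P.dir x i) = insert j ((P.tight x).erase i)) :
    (∃ r : ℝ, r < 0 ∧ P.dir (x - s • P.dir x i) j = r • P.dir x i) ∧
      ∀ k ∈ (P.tight x).erase i, ∃ r : ℝ,
        P.dir (x - s • P.dir x i) k = P.dir x k + r • P.dir x i := by
  set y := x - s • P.dir x i with hyd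
  have hjy : j ∈ P.tight y := by rw [ht]; exact Finset.mem_insert_self _ _
  have hmem : ∀ k ∈ (P.tight x).erase i, k ∈ P.tight y := fun k hk => by
    rw [ht]; exact Finset.mem_insert_of_mem hk
  constructor
  · have h1 := hx.eq_smul_dir (z := P.dir y j) hi fun k hk hki => by
      rw [hy.a_dir hjy (hmem k (Finset.mem_erase.2 ⟨hki, hk⟩)), if_neg]
      rintro rfl; exact hj hk
    refine ⟨_, ?_, h1⟩
    have h2 := hy.a_dir hjy hjy
    rw [if_pos rfl, h1, map_smul, smul_eq_mul] at h2
    have h3 : P.a j y = P.a j x - s * P.a j (P.dir x i) := by simp [hyd]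
    rw [mem_tight.1 hjy] at h3
    have h4 : P.a j x < P.b j := lt_of_le_of_ne (hx.1 j) fun h => hj (mem_tight.2 h)
    have h5 : P.a j (P.dir x i) < 0 := by
      by_contra! h
      have := mul_nonneg hs.le h
      linarith
    by_contra! h
    have := mul_nonpos_of_nonneg_of_nonpos h h5.le
    linarith
  · intro k hk
    have hk' := Finset.mem_erase.1 hk
    refine ⟨_, sub_eq_iff_eq_add'.1
      (hx.eq_smul_dir (z := P.dir y k - P.dir x k) hi fun l hl hli => ?_)⟩
    rw [map_sub, hy.a_dir (hmem k hk) (hmem l (Finset.mem_erase.2 ⟨hli, hl⟩)), hx.a_dir hk'.2 hl,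
      sub_self]

theorem exists_paramPath {c d : Dual ℝ V} {β : ℝ} {u v : V} (hgen : P.Gen T c d)
    (hv : P.FaceVertex T v)
    (hvβ : ∀ i ∈ P.tight v \ T, 0 < pencil c d β (P.dir v i)) (hu : P.FaceVertex T u) :
    ∀ α ≤ β, (∀ i ∈ P.tight u \ T, 0 < pencil c d α (P.dir u i)) →
      ∃ m w θ, P.ParamPath T c d m w θ ∧ w 0 = u ∧ θ 0 = α ∧ w m = v ∧ θ m ≤ β := by
  refine vertex_induction (C := fun u => ∀ α ≤ β,
    (∀ i ∈ P.tight u \ T, 0 < pencil c d α (P.dir u i)) →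
      ∃ m w θ, P.ParamPath T c d m w θ ∧ w 0 = u ∧ θ 0 = α ∧ w m = v ∧ θ m ≤ β)
    (pencil c d β) (fun x hx ih α hαβ hα => ?_) hu
  by_cases hxv : x = v
  · refine ⟨0, fun _ => x, fun _ => α, ⟨fun _ _ => hx, ?_, fun _ _ => hα, ?_⟩, rfl, rfl, hxv, hαβ⟩
    · intro p hp; omega
    · intro p hp; omega
  have hbd : ∀ z, P.Face T z → pencil c d β z ≤ pencil c d β v :=
    fun z hz => hv.le_of_nonneg (fun i hi => (hvβ i hi).le) hz
  have hex : ∃ i ∈ P.tight x \ T, c (P.dir x i) + β * d (P.dir x i) < 0 := by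
    by_contra! hcon
    exact absurd (hx.le_of_nonneg (c := pencil c d β) (by simpa using hcon) hv.face)
      (not_le.2 (hv.lt_of_pos hvβ hx.face hxv))
  obtain ⟨τ, hατ, hτβ, i, hi, hiβ, hiτ, hdi, hτ⟩ := exists_first_zero (P.tight x \ T)
    (fun i => c (P.dir x i)) (fun i => d (P.dir x i)) hαβ (by simpa using hα) hex
  have hτ' : ∀ k ∈ (P.tight x \ T).erase i, 0 < pencil c d τ (P.dir x k) := by
    intro k hk
    rw [Finset.mem_erase] at hk
    refine lt_of_le_of_ne (by simpa using hτ k hk.2) fun h => hk.1 ?_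
    exact hgen x hx τ k hk.2 i hi h.symm (by simpa using hiτ)
  obtain ⟨s, hs, j, hj, hy, ht, hlt⟩ := hx.improve hbd hi (by simpa using hiβ)
  have hi' := Finset.mem_sdiff.1 hi
  obtain ⟨⟨r, hr, hrj⟩, hk⟩ := hx.1.dir_step hi'.1 hj hs hy.1 ht
  set y := x - s • P.dir x i with hyd
  have hjτ : pencil c d τ (P.dir y j) = 0 := by
    rw [hrj, map_smul, pencil_apply, hiτ, smul_zero]
  have hkτ : ∀ k ∈ (P.tight x \ T).erase i,
      pencil c d τ (P.dir y k) = pencil c d τ (P.dir x k) := by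
    intro k hk'
    rw [Finset.mem_erase, Finset.mem_sdiff] at hk'
    obtain ⟨r, hr⟩ := hk k (Finset.mem_erase.2 ⟨hk'.1, hk'.2.1⟩)
    rw [hr, map_add, map_smul, pencil_apply c d τ (P.dir x i), hiτ, smul_zero, add_zero]
  obtain ⟨t, hτt, htβ, htp⟩ := exists_pos_after (P.tight y \ T)
    (fun i => c (P.dir y i)) (fun i => d (P.dir y i)) hτβ (by
      intro k hk
      rw [Finset.mem_sdiff, ht, Finset.mem_insert, Finset.mem_erase] at hk
      rcases hk with ⟨rfl | ⟨hki, hkx⟩, hkT⟩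
      · right
        refine ⟨by simpa using hjτ, ?_⟩
        simp only [hrj, map_smul, smul_eq_mul]
        exact mul_pos_of_neg_of_neg hr hdi
      · left
        have hk : k ∈ (P.tight x \ T).erase i :=
          Finset.mem_erase.2 ⟨hki, Finset.mem_sdiff.2 ⟨hkx, hkT⟩⟩
        have := hτ' k hk
        rw [← hkτ k hk] at this
        simpa using this)
  obtain ⟨m, w, θ, hpath, hw0, hθ0, hwm, hθm⟩ := ih y hy hlt t htβ.le (by simpa using htp)
  refine ⟨m + 1, fun p => Nat.casesOn p x w, fun p => Nat.casesOn p α θ,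
    ⟨?_, ?_, ?_, ?_⟩, rfl, rfl, hwm, hθm⟩
  · rintro (_ | p) hp
    · exact hx
    · exact hpath.vertex p (by omega)
  · rintro (_ | p) hp
    · change α < θ 0
      linarith
    · exact hpath.lt_succ p (by omega)
  · rintro (_ | p) hp
    · exact hα
    · exact hpath.pos p (by omega)
  · rintro (_ | p) hp
    · refine ⟨τ, hατ, ?_, i, hi, j, hj, ?_⟩
      · change τ < θ 0
        linarith
      · change P.tight (w 0) = _ ∧ _ ∧ pencil c d τ (P.dir (w 0) j) = 0 ∧ ∀ k ∈ _, _ ∧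
          0 < pencil c d τ (P.dir (w 0) k)
        rw [hw0]
        refine ⟨ht, by simpa using hiτ, hjτ, fun k hk => ⟨hτ' k hk, ?_⟩⟩
        rw [hkτ k hk]
        exact hτ' k hk
    · exact hpath.step p (by omega)

/-- Three vertices on a line: two of them coincide. -/
lemma IsVertex.eq_or_eq (hx : P.IsVertex x) (hy : P.IsVertex y) (hz : P.IsVertex z)
    (hT : T.card + 1 = finrank ℝ V) (hTx : T ⊆ P.tight x) (hTy : T ⊆ P.tight y)
    (hTz : T ⊆ P.tight z) (hxy : x ≠ y) : z = x ∨ z = y := by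
  by_contra! hne
  have key : ∀ {x : V}, P.IsVertex x → T ⊆ P.tight x → ∃ i, i ∉ T ∧ P.tight x = insert i T := by
    intro x hx hTx
    have : (P.tight x \ T).card = 1 := by
      rw [Finset.card_sdiff_of_subset hTx, hx.2]; omega
    obtain ⟨i, hi⟩ := Finset.card_eq_one.1 this
    have hi' : i ∈ P.tight x \ T := by rw [hi]; simp
    refine ⟨i, (Finset.mem_sdiff.1 hi').2, ?_⟩
    rw [Finset.insert_eq, ← hi, Finset.sdiff_union_of_subset hTx]
  obtain ⟨i, hiT, hi⟩ := key hx hTx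
  obtain ⟨j, hjT, hj⟩ := key hy hTy
  obtain ⟨k, hkT, hk⟩ := key hz hTz
  have hinj : ∀ {x y : V}, P.IsVertex x → P.tight x = P.tight y → y = x :=
    fun hx h => hx.eq_of_tight h.le
  have hij : i ≠ j := by rintro rfl; exact hxy (hinj hx (hi.trans hj.symm)).symm
  have hik : i ≠ k := by rintro rfl; exact hne.1 (hinj hx (hi.trans hk.symm))
  have hjk : j ≠ k := by rintro rfl; exact hne.2 (hinj hy (hj.trans hk.symm))
  have hix : i ∈ P.tight x := by rw [hi]; simp
  have hdir : ∀ {w : V}, T ⊆ P.tight w → w - x = P.a i (w - x) • P.dir x i := fun hw =>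
    hx.eq_smul_dir hix fun l hl hli => by
      rw [hi, Finset.mem_insert] at hl
      have hl := hl.resolve_left hli
      rw [map_sub, mem_tight.1 (hw hl), mem_tight.1 (hTx hl), sub_self]
  have hlt : ∀ {w l}, P.IsVertex w → l ∉ T → P.tight w = insert l T → ∀ r, r ∉ T → r ≠ l →
      P.a r w < P.b r := fun hw _ h r hr hrl => lt_of_le_of_ne (hw.1 r) fun hrw => by
    have := mem_tight.2 hrw
    rw [h, Finset.mem_insert] at this
    tauto
  have hy' := hdir hTy
  have hz' := hdir hTz
  rw [map_sub, mem_tight.1 hix] at hy' hz'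
  have hjy : P.a j y = P.b j := mem_tight.1 (by rw [hj]; simp)
  have hkz : P.a k z = P.b k := mem_tight.1 (by rw [hk]; simp)
  have h1 := congrArg (P.a j) hy'
  have h2 := congrArg (P.a j) hz'
  have h3 := congrArg (P.a k) hy'
  have h4 := congrArg (P.a k) hz'
  simp only [map_sub, map_smul, smul_eq_mul] at h1 h2 h3 h4
  have e1 := hlt hx hiT hi j hjT hij.symm
  have e2 := hlt hx hiT hi k hkT hik.symm
  have e3 := hlt hy hjT hj i hiT hij
  have e4 := hlt hy hjT hj k hkT hjk.symm
  have e5 := hlt hz hkT hk i hiT hik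
  have e6 := hlt hz hkT hk j hjT hjk
  have a1 : P.a j (P.dir x i) < 0 := by
    by_contra! h
    have := mul_nonneg (sub_nonneg.2 e3.le) h
    linarith
  have a2 : P.a k (P.dir x i) < 0 := by
    by_contra! h
    have := mul_nonneg (sub_nonneg.2 e5.le) h
    linarith
  have b1 : P.a i y < P.a i z := by
    by_contra! h
    have := mul_nonneg_of_nonpos_of_nonpos (sub_nonpos.2 h) a1.le
    linarith
  have := mul_neg_of_pos_of_neg (sub_pos.2 b1) a2
  linarith

lemma IsVertex.adj_of_subset (hx : P.IsVertex x) (hy : P.IsVertex y) (hxy : x ≠ y)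
    (hT : T.card + 1 = finrank ℝ V) (hTx : T ⊆ P.tight x) (hTy : T ⊆ P.tight y) : P.Adj x y := by
  refine ⟨hx, hy, le_antisymm ?_ ?_⟩
  · rw [← hx.2, Nat.succ_le_iff]
    refine Finset.card_lt_card ⟨Finset.inter_subset_left, fun h => hxy ?_⟩
    exact (hx.eq_of_tight fun i hi => Finset.mem_of_mem_inter_right (h hi)).symm
  · rw [← hT]
    exact Nat.succ_le_succ (Finset.card_le_card (Finset.subset_inter hTx hTy))

namespace ParamPath

variable {c d : Dual ℝ V} {m : ℕ} {w : ℕ → V} {θ : ℕ → ℝ} {p q r : ℕ} {t : ℝ}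
  (h : P.ParamPath T c d m w θ)
include h

lemma θ_lt (hpq : p < q) (hq : q ≤ m) : θ p < θ q := by
  induction q, hpq using Nat.le_induction with
  | base => exact h.lt_succ p hq
  | succ q _ ih => exact (ih (by omega)).trans (h.lt_succ q hq)

lemma θ_le (hpq : p ≤ q) (hq : q ≤ m) : θ p ≤ θ q := by
  rcases hpq.eq_or_lt with rfl | hpq
  · rfl
  · exact (h.θ_lt hpq hq).le

lemma apply_lt (hp : p ≤ m) (hz : P.Face T z) (hne : z ≠ w p) :
    pencil c d (θ p) z < pencil c d (θ p) (w p) :=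
  (h.vertex p hp).lt_of_pos (h.pos p hp) hz hne

lemma apply_le (hp : p ≤ m) (hz : P.Face T z) :
    pencil c d (θ p) z ≤ pencil c d (θ p) (w p) :=
  (h.vertex p hp).le_of_nonneg (fun i hi => (h.pos p hp i hi).le) hz

lemma d_lt_succ (hp : p < m) : d (w p) < d (w (p + 1)) := by
  have hne : w (p + 1) ≠ w p := by
    intro heq
    obtain ⟨τ, -, -, i, -, j, hj, ht, -⟩ := h.step p hp
    rw [heq] at ht
    exact hj (by rw [ht]; exact Finset.mem_insert_self _ _)
  have h1 := h.apply_lt hp.le (h.vertex (p + 1) hp).face hne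
  have h2 := h.apply_lt hp (h.vertex p hp.le).face hne.symm
  simp only [pencil_apply] at h1 h2
  by_contra! hcon
  have := mul_nonpos_of_nonneg_of_nonpos (sub_nonneg.2 (h.lt_succ p hp).le) (sub_nonpos.2 hcon)
  linarith

lemma d_lt (hpq : p < q) (hq : q ≤ m) : d (w p) < d (w q) := by
  induction q, hpq using Nat.le_induction with
  | base => exact h.d_lt_succ hq
  | succ q _ ih => exact (ih (by omega)).trans (h.d_lt_succ hq)

lemma ne (hpq : p < q) (hq : q ≤ m) : w p ≠ w q :=
  fun heq => (h.d_lt hpq hq).ne (by rw [heq])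

lemma lt_of_le_θ (hpq : p < q) (hq : q ≤ m) (ht : t ≤ θ p) :
    pencil c d t (w q) < pencil c d t (w p) := by
  have h1 := h.apply_lt (by omega) (h.vertex q hq).face (h.ne hpq hq).symm
  have h2 := mul_nonneg (sub_nonneg.2 ht) (sub_nonneg.2 (h.d_lt hpq hq).le)
  simp only [pencil_apply] at h1 ⊢
  linarith

lemma lt_of_θ_le (hpq : p < q) (hq : q ≤ m) (ht : θ q ≤ t) :
    pencil c d t (w p) < pencil c d t (w q) := by
  have h1 := h.apply_lt hq (h.vertex p (by omega)).face (h.ne hpq hq)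
  have h2 := mul_nonneg (sub_nonneg.2 ht) (sub_nonneg.2 (h.d_lt hpq hq).le)
  simp only [pencil_apply] at h1 ⊢
  linarith

/-- The parameter at which two vertices of the path have the same value. -/
lemma exists_eq (hpq : p < q) (hq : q ≤ m) :
    ∃ σ, θ p < σ ∧ σ < θ q ∧ pencil c d σ (w p) = pencil c d σ (w q) := by
  have h1 := h.lt_of_le_θ hpq hq le_rfl
  have h2 := h.lt_of_θ_le hpq hq le_rfl
  have h3 := h.d_lt hpq hq
  simp only [pencil_apply] at h1 h2 ⊢
  have h4 := sub_pos.2 h3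
  have e : ((c (w p) - c (w q)) / (d (w q) - d (w p))) * (d (w q) - d (w p)) =
    c (w p) - c (w q) := by field_simp
  refine ⟨(c (w p) - c (w q)) / (d (w q) - d (w p)), ?_, ?_, by linarith⟩
  · rw [lt_div_iff₀ h4]; linarith
  · rw [div_lt_iff₀ h4]; linarith

lemma lt_of_between (hpr : p < r) (hrq : r < q) (hq : q ≤ m) {σ : ℝ}
    (hσ : pencil c d σ (w p) = pencil c d σ (w q)) :
    pencil c d σ (w p) < pencil c d σ (w r) := by
  rcases le_total (θ r) σ with h1 | h1
  · exact h.lt_of_θ_le hpr (by omega) h1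
  · rw [hσ]; exact h.lt_of_le_θ hrq hq h1

lemma eq_of_max {a b : ℕ} (hab : a ≤ b) (hb : b ≤ m) (hat : θ a ≤ t) (htb : t ≤ θ b)
    (hx : P.FaceVertex T x)
    (hmax : ∀ z, P.FaceVertex T z → pencil c d t z ≤ pencil c d t x) :
    ∃ r, a ≤ r ∧ r ≤ b ∧ x = w r := by
  have hpos : ∀ q ≤ m, (∀ i ∈ P.tight (w q) \ T, 0 < pencil c d t (P.dir (w q) i)) → x = w q := by
    intro q hq hi
    by_contra hne
    exact ((h.vertex q hq).lt_of_pos hi hx.face hne).not_ge (hmax _ (h.vertex q hq))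
  induction b, hab using Nat.le_induction with
  | base =>
    refine ⟨a, le_rfl, le_rfl, hpos a hb ?_⟩
    rw [le_antisymm htb hat]
    exact h.pos a hb
  | succ b hab ih =>
    rcases le_or_gt t (θ b) with htb' | htb'
    · obtain ⟨r, h1, h2, h3⟩ := ih (by omega) htb'
      exact ⟨r, h1, by omega, h3⟩
    obtain ⟨τ, hτ1, hτ2, i, hi, j, hj, ht, hi0, hj0, hk⟩ := h.step b hb
    have hb' : b ≤ m := by omega
    have hwb : ∀ k ∈ P.tight (w b) \ T, 0 ≤ pencil c d τ (P.dir (w b) k) := by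
      intro k hk'
      by_cases hki : k = i
      · rw [hki, hi0]
      · exact (hk k (Finset.mem_erase.2 ⟨hki, hk'⟩)).1.le
    have hwb1 : ∀ k ∈ P.tight (w (b + 1)) \ T, 0 ≤ pencil c d τ (P.dir (w (b + 1)) k) := by
      intro k hk'
      rw [Finset.mem_sdiff, ht, Finset.mem_insert, Finset.mem_erase] at hk'
      rcases hk' with ⟨rfl | ⟨hki, hkw⟩, hkT⟩
      · rw [hj0]
      · exact (hk k (Finset.mem_erase.2 ⟨hki, Finset.mem_sdiff.2 ⟨hkw, hkT⟩⟩)).2.le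
    rcases lt_trichotomy t τ with htτ | htτ | htτ
    · refine ⟨b, hab, by omega, hpos b hb' fun k hk' => ?_⟩
      have h1 := h.pos b hb' k hk'
      have h2 := hwb k hk'
      simp only [pencil_apply] at h1 h2 ⊢
      by_contra! hcon
      nlinarith
    · obtain ⟨hiw, hiT⟩ := Finset.mem_sdiff.1 hi
      have heq : pencil c d t x = pencil c d t (w b) := by
        refine le_antisymm ?_ (hmax _ (h.vertex b hb'))
        rw [htτ]
        exact (h.vertex b hb').le_of_nonneg hwb hx.face
      have hE : (P.tight (w b)).erase i ⊆ P.tight x := by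
        intro k hk'
        rw [Finset.mem_erase] at hk'
        by_cases hkT : k ∈ T
        · exact hx.2 hkT
        · have hk2 := Finset.mem_sdiff.2 ⟨hk'.2, hkT⟩
          rw [htτ] at heq
          exact (h.vertex b hb').tight_of_eq hwb hx.face heq hk2
            (hk k (Finset.mem_erase.2 ⟨hk'.1, hk2⟩)).1
      have hE1 : (P.tight (w b)).erase i ⊆ P.tight (w (b + 1)) := by
        rw [ht]; exact Finset.subset_insert _ _
      have hcard : ((P.tight (w b)).erase i).card + 1 = finrank ℝ V := by
        rw [Finset.card_erase_add_one hiw, (h.vertex b hb').1.2]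
      rcases (h.vertex b hb').1.eq_or_eq (h.vertex (b + 1) hb).1 hx.1 hcard
        (Finset.erase_subset _ _) hE1 hE (h.ne (Nat.lt_succ_self b) hb) with hr | hr
      · exact ⟨b, hab, by omega, hr⟩
      · exact ⟨b + 1, by omega, le_rfl, hr⟩
    · refine ⟨b + 1, by omega, le_rfl, hpos (b + 1) hb fun k hk' => ?_⟩
      have h1 := h.pos (b + 1) hb k hk'
      have h2 := hwb1 k hk'
      simp only [pencil_apply] at h1 h2 ⊢
      by_contra! hcon
      nlinarith

end ParamPath

lemma iff_of_not_iff {p q r : Prop} (h : ¬(p ↔ q)) (h' : ¬(r ↔ p)) : q ↔ r := by tauto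

/-- `q₁` and `q₂` are consecutive elements of `A`. -/
def Consecutive (A : Finset ℕ) (q₁ q₂ : ℕ) : Prop :=
  q₁ ∈ A ∧ q₂ ∈ A ∧ q₁ < q₂ ∧ ∀ r ∈ A, ¬ (q₁ < r ∧ r < q₂)

lemma exists_consecutive_left {A : Finset ℕ} {q₁ q₂ : ℕ} (h1 : q₁ ∈ A) (h2 : q₂ ∈ A)
    (h : q₁ < q₂) : ∃ q, q₁ ≤ q ∧ Consecutive A q q₂ := by
  obtain ⟨q, hq, hmax⟩ := (A.filter (· < q₂)).exists_max_image id ⟨q₁, by simp [h1, h]⟩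
  rw [Finset.mem_filter] at hq
  refine ⟨q, hmax q₁ (by simp [h1, h]), hq.1, h2, hq.2, fun r hr hlt => ?_⟩
  have := hmax r (by simp [hr, hlt.2])
  simp only [id] at this
  omega

lemma exists_consecutive_around {A : Finset ℕ} {q₁ c q₂ : ℕ} (h1 : q₁ ∈ A) (h2 : q₂ ∈ A)
    (h : q₁ < c) (h' : c < q₂) (hc : c ∉ A) :
    ∃ r₁ r₂, q₁ ≤ r₁ ∧ r₁ < c ∧ c < r₂ ∧ r₂ ≤ q₂ ∧ Consecutive A r₁ r₂ := by
  obtain ⟨r₂, hr₂, hmin⟩ := (A.filter (c < ·)).exists_min_image id ⟨q₂, by simp [h2, h']⟩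
  rw [Finset.mem_filter] at hr₂
  obtain ⟨r₁, hr₁, hcons⟩ := exists_consecutive_left h1 hr₂.1 (h.trans hr₂.2)
  refine ⟨r₁, r₂, hr₁, ?_, hr₂.2, hmin q₂ (by simp [h2, h']), hcons⟩
  by_contra! hcon
  rcases hcon.eq_or_lt with rfl | hlt
  · exact hc hcons.1
  · have := hmin r₁ (by simp [hcons.1, hlt])
    have := hcons.2.2.1
    simp only [id] at *
    omega

/-- A set `A` of positions such that every label that occurs at two of them occurs at all positions
of `A` between, and such that consecutive positions share two labels, or one label that does not
occur strictly between them. -/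
structure GoodPositions {κ : Type*} (J : ℕ → Finset κ) (A : Finset ℕ) : Prop where
  nonrevisiting : ∀ a ∈ A, ∀ b ∈ A, ∀ c ∈ A, a < b → b < c → ∀ Z ∈ J a, Z ∈ J c → Z ∈ J b
  jump : ∀ q₁ q₂, Consecutive A q₁ q₂ →
    (∃ F G, F ≠ G ∧ F ∈ J q₁ ∧ F ∈ J q₂ ∧ G ∈ J q₁ ∧ G ∈ J q₂) ∨
      ∃ G, G ∈ J q₁ ∧ G ∈ J q₂ ∧ ∀ r, q₁ < r → r < q₂ → G ∉ J r

set_option maxHeartbeats 400000 in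
/-- A sequence of sets of two-sided labels in which labels of the same side do not cross has a
nonrevisiting subsequence with well-behaved jumps. -/
theorem exists_goodPositions {κ : Type*} [DecidableEq κ] (J : ℕ → Finset κ) (side : κ → Prop)
    (m : ℕ)
    (hcross : ∀ F G a b c e, F ≠ G → (side F ↔ side G) → a < b → b < c → c < e → e ≤ m →
      F ∈ J a → F ∈ J c → G ∈ J b → G ∈ J e → False)
    (hopp : ∀ F G a b c, ¬(side F ↔ side G) → a < b → b < c → c ≤ m → 0 < a ∨ c < m →
      F ∈ J a → F ∈ J c → G ∈ J a → G ∈ J c → False)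
    (hnew : ∀ p < m, ∃ N ∈ J (p + 1), N ∉ J p ∧ ∀ Z ∈ J (p + 1), Z ≠ N → Z ∈ J p)
    (hold : ∀ p < m, ∃ G ∈ J p, G ∈ J (p + 1)) (p : ℕ) (hp : p ≤ m) :
    ∃ A : Finset ℕ, 0 ∈ A ∧ p ∈ A ∧ (∀ q ∈ A, q ≤ p) ∧ GoodPositions J A := by
  induction p with
  | zero =>
    refine ⟨{0}, by simp, by simp, by simp, ⟨?_, ?_⟩⟩
    · intro a ha b hb
      simp_all
    · rintro q₁ q₂ ⟨h1, h2, h3, -⟩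
      simp_all
  | succ p ih =>
    obtain ⟨A, h0A, hpA, hAp, hA⟩ := ih (by omega)
    obtain ⟨N, hN, hNp, hNZ⟩ := hnew p hp
    by_cases hex : ∃ s ∈ A, N ∈ J s
    · obtain ⟨s, hs, hmax⟩ := (A.filter (N ∈ J ·)).exists_max_image id (by
        obtain ⟨s, hs⟩ := hex; exact ⟨s, by simpa using hs⟩)
      rw [Finset.mem_filter] at hs
      obtain ⟨hsA, hNs⟩ := hs
      have hmax : ∀ r ∈ A, N ∈ J r → r ≤ s := fun r hr hrN => hmax r (by simp [hr, hrN])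
      have hsp : s < p := lt_of_le_of_ne (hAp s hsA) (by rintro rfl; exact hNp hNs)
      by_cases hZ : ∃ Z, Z ≠ N ∧ Z ∈ J s ∧ Z ∈ J (p + 1)
      · obtain ⟨Z, hZN, hZs, hZp⟩ := hZ
        refine ⟨insert (p + 1) (A.filter (· ≤ s)), by simp [h0A], by simp, ?_, ⟨?_, ?_⟩⟩
        · intro q hq
          simp only [Finset.mem_insert, Finset.mem_filter] at hq
          omega
        · intro a ha b hb c hc hab hbc Y hYa hYc
          simp only [Finset.mem_insert, Finset.mem_filter] at ha hb hc
          obtain ⟨hcp, -⟩ | hc := hc.imp_left (fun h => And.intro h trivial)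
          · have ha := ha.resolve_left (by omega)
            have hb := hb.resolve_left (by omega)
            subst hcp
            by_cases hYN : Y = N
            · subst hYN
              rcases hb.2.eq_or_lt with rfl | hbs
              · exact hNs
              · exact hA.1 a ha.1 b hb.1 s hsA hab hbs Y hYa hNs
            · exact hA.1 a ha.1 b hb.1 p hpA hab (by omega) Y hYa (hNZ Y hYc hYN)
          · have ha := ha.resolve_left (by omega)
            have hb := hb.resolve_left (by omega)
            exact hA.1 a ha.1 b hb.1 c hc.1 hab hbc Y hYa hYc
        · rintro q₁ q₂ ⟨h1, h2, h3, h4⟩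
          simp only [Finset.mem_insert, Finset.mem_filter] at h1 h2 h4
          have h1 := h1.resolve_left (by omega)
          rcases h2 with rfl | h2
          · have : q₁ = s := by
              by_contra hne
              exact h4 s (Or.inr ⟨hsA, le_rfl⟩) (by omega)
            subst this
            exact Or.inl ⟨Z, N, hZN, hZs, hZp, hNs, hN⟩
          · exact hA.2 q₁ q₂ ⟨h1.1, h2.1, h3, fun r hr hlt => h4 r (Or.inr ⟨hr, by omega⟩) hlt⟩
      · push Not at hZ
        set R := (Finset.range (p + 2)).filter fun r => s ≤ r ∧ N ∈ J r with hR
        have hmR : ∀ r, r ∈ R ↔ r ≤ p + 1 ∧ s ≤ r ∧ N ∈ J r := by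
          intro r; simp [hR, Nat.lt_succ_iff]
        refine ⟨A.filter (· ≤ s) ∪ R, by simp [h0A], ?_, ?_, ⟨?_, ?_⟩⟩
        · rw [Finset.mem_union, hmR]; exact Or.inr ⟨le_rfl, by omega, hN⟩
        · intro q hq
          simp only [Finset.mem_union, Finset.mem_filter, hmR] at hq
          omega
        · intro a ha b hb c hc hab hbc Z hZa hZc
          simp only [Finset.mem_union, Finset.mem_filter, hmR] at ha hb hc
          by_cases hcs : c ≤ s
          · have hA' : ∀ r, r ≤ s → (r ∈ A ∧ r ≤ s ∨ r ≤ p + 1 ∧ s ≤ r ∧ N ∈ J r) → r ∈ A := by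
              rintro r hr (h | h)
              · exact h.1
              · rwa [show r = s by omega]
            exact hA.1 a (hA' a (by omega) ha) b (hA' b (by omega) hb) c (hA' c hcs hc) hab hbc Z
              hZa hZc
          push Not at hcs
          have hc := hc.resolve_left (by omega)
          by_contra hZb
          by_cases hZN : Z = N
          · subst hZN
            rcases hb with hb | hb
            · rcases hb.2.eq_or_lt with rfl | hbs
              · exact hZb hNs
              have ha : a ∈ A := by
                rcases ha with ha | ha
                · exact ha.1
                · omega
              exact hZb (hA.1 a ha b hb.1 s hsA hab hbs Z hZa hNs)
            · exact hZb hb.2.2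
          have hbs : s < b → N ∈ J b := by
            intro hsb
            rcases hb with hb | hb
            · omega
            · exact hb.2.2
          have haA : a ≤ s → a ∈ A := by
            intro has
            rcases ha with ha | ha
            · exact ha.1
            · rwa [show a = s by omega]
          have hbA : b ≤ s → b ∈ A := by
            intro has
            rcases hb with ha | ha
            · exact ha.1
            · rwa [show b = s by omega]
          have haN : s ≤ a → N ∈ J a := by
            intro hsb
            rcases ha with hb | hb
            · rwa [show a = s by omega]
            · exact hb.2.2
          rcases hc.1.eq_or_lt with rfl | hcp
          · have hZp := hNZ Z hZc hZN
            have hZs : Z ∉ J s := fun h => hZ Z hZN h hZc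
            rcases le_or_gt b s with hbs' | hbs'
            · exact hZb (hA.1 a (haA (by omega)) b (hbA hbs') p hpA hab (by omega) Z hZa hZp)
            have hNb := hbs hbs'
            rcases lt_trichotomy a s with has | has | has
            · exact hZs (hA.1 a (haA has.le) s hsA p hpA has hsp Z hZa hZp)
            · exact hZs (has ▸ hZa)
            · by_cases hside : side N ↔ side Z
              · exact hcross N Z s a b (p + 1) (Ne.symm hZN) hside has hab (by omega) hp hNs hNb
                  hZa hZc
              · exact hopp N Z a b (p + 1) hside hab hbc hp (Or.inl (by omega)) (haN has.le) hN
                  hZa hZc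
          · by_cases hside : side N ↔ side Z
            · rcases lt_or_ge a s with has | has
              · exact hcross Z N a s c (p + 1) hZN hside.symm has hcs (by omega) hp hZa hZc hNs hN
              · exact hcross Z N a b c (p + 1) hZN hside.symm hab hbc (by omega) hp hZa hZc
                  (hbs (by omega)) hN
            · rcases lt_or_ge a s with has | has
              · by_cases hZs : Z ∈ J s
                · rcases lt_trichotomy b s with hbs' | hbs' | hbs'
                  · exact hZb (hA.1 a (haA has.le) b (hbA hbs'.le) s hsA hab hbs' Z hZa hZs)
                  · exact hZb (hbs' ▸ hZs)
                  · exact hopp N Z s b c hside hbs' hbc (by omega) (Or.inr (by omega)) hNs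
                      hc.2.2 hZs hZc
                · have hcA : c ∉ A := fun h => by
                    have := hmax c h hc.2.2
                    omega
                  have hcp' : c < p :=
                    lt_of_le_of_ne (by omega) (by rintro rfl; exact hNp hc.2.2)
                  obtain ⟨q₁, q₂, h1, h2, h3, h4, hcons⟩ :=
                    exists_consecutive_around hsA hpA hcs hcp' hcA
                  have hNq₂ : N ∉ J q₂ := fun h => by
                    have := hmax q₂ hcons.2.1 h
                    omega
                  have key : ∀ G, G ∈ J q₁ → G ∈ J q₂ → G = Z := by
                    intro G hG1 hG2
                    have hGN : G ≠ N := by rintro rfl; exact hNq₂ hG2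
                    by_cases hGs : side G ↔ side N
                    · exact (hcross G N q₁ c q₂ (p + 1) hGN hGs h2 h3 (by omega) hp hG1 hG2
                        hc.2.2 hN).elim
                    · by_contra hGZ
                      exact hcross Z G a q₁ c q₂ (Ne.symm hGZ) (iff_of_not_iff hside hGs) (by omega) h2
                        h3 (by omega) hZa hZc hG1 hG2
                  rcases hA.2 q₁ q₂ hcons with ⟨F, G, hFG, hF1, hF2, hG1, hG2⟩ | ⟨G, hG1, hG2, hG⟩
                  · exact hFG ((key F hF1 hF2).trans (key G hG1 hG2).symm)
                  · exact hG c h2 h3 (key G hG1 hG2 ▸ hZc)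
              · exact hopp N Z a b c hside hab hbc (by omega) (Or.inr (by omega)) (haN has)
                  hc.2.2 hZa hZc
        · rintro q₁ q₂ ⟨h1, h2, h3, h4⟩
          simp only [Finset.mem_union, Finset.mem_filter, hmR] at h1 h2 h4
          rcases le_or_gt q₂ s with hq | hq
          · have hA' : ∀ r, r ≤ s → (r ∈ A ∧ r ≤ s ∨ r ≤ p + 1 ∧ s ≤ r ∧ N ∈ J r) → r ∈ A := by
              rintro r hr (h | h)
              · exact h.1
              · rwa [show r = s by omega]
            exact hA.2 q₁ q₂ ⟨hA' _ (by omega) h1, hA' _ hq h2, h3,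
              fun r hr hlt => h4 r (Or.inl ⟨hr, by omega⟩) hlt⟩
          · have h2 := h2.resolve_left (by omega)
            have hs1 : s ≤ q₁ := by
              by_contra! hcon
              exact h4 s (Or.inl ⟨hsA, le_rfl⟩) ⟨hcon, hq⟩
            have h1 : N ∈ J q₁ := by
              rcases h1 with h1 | h1
              · rwa [show q₁ = s by omega]
              · exact h1.2.2
            exact Or.inr ⟨N, h1, h2.2.2, fun r hr1 hr2 hNr =>
              h4 r (Or.inr ⟨by omega, by omega, hNr⟩) ⟨hr1, hr2⟩⟩
    · push Not at hex
      refine ⟨insert (p + 1) A, by simp [h0A], by simp, ?_, ⟨?_, ?_⟩⟩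
      · intro q hq
        rcases Finset.mem_insert.1 hq with rfl | hq
        · rfl
        · exact (hAp q hq).trans (by omega)
      · intro a ha b hb c hc hab hbc Z hZa hZc
        rw [Finset.mem_insert] at ha hb hc
        have hcp : c ≤ p + 1 := by
          rcases hc with rfl | hc
          · rfl
          · exact (hAp c hc).trans (by omega)
        have ha := ha.resolve_left (by omega)
        have hb := hb.resolve_left (by omega)
        rcases hc with rfl | hc
        · have hZp := hNZ Z hZc (by rintro rfl; exact hex a ha hZa)
          rcases (hAp b hb).eq_or_lt with rfl | hbp
          · exact hZp
          · exact hA.1 a ha b hb p hpA hab hbp Z hZa hZp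
        · exact hA.1 a ha b hb c hc hab hbc Z hZa hZc
      · rintro q₁ q₂ ⟨h1, h2, h3, h4⟩
        rw [Finset.mem_insert] at h1 h2
        have hq2 : q₂ ≤ p + 1 := by
          rcases h2 with rfl | h2
          · rfl
          · exact (hAp _ h2).trans (by omega)
        have h1 := h1.resolve_left (by omega)
        rcases h2 with rfl | h2
        · have : q₁ = p := by
            by_contra hne
            have := hAp _ h1
            exact h4 p (Finset.mem_insert_of_mem hpA) (by omega)
          subst this
          obtain ⟨G, hG1, hG2⟩ := hold q₁ hp
          exact Or.inr ⟨G, hG1, hG2, fun r h1 h2 => by omega⟩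
        · exact hA.2 q₁ q₂ ⟨h1, h2, h3, fun r hr hlt => h4 r (Finset.mem_insert_of_mem hr) hlt⟩

open Topology in
/-- There are functionals with a strict maximum at a given vertex which do not vanish on finitely
many given nonzero vectors. -/
lemma IsVertex.exists_pos_avoiding (hx : P.IsVertex x) {s : Set V} (hs : s.Finite) :
    ∃ c : Dual ℝ V, (∀ i ∈ P.tight x, 0 < c (P.dir x i)) ∧ ∀ v ∈ s, v ≠ 0 → c v ≠ 0 := by
  have : Finite {v : V // v ∈ s ∧ v ≠ 0} :=
    (hs.subset fun v hv => hv.1 : {v | v ∈ s ∧ v ≠ 0}.Finite)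
  obtain ⟨p, hp⟩ := Module.exists_dual_forall_apply_ne_zero (K := ℝ)
    (fun v : {v : V // v ∈ s ∧ v ≠ 0} => v.1) fun v => v.2.2
  set c := ∑ i ∈ P.tight x, P.a i with hc
  have hcont : ∀ v, ContinuousAt (fun ε : ℝ => c v + ε * p v) 0 := fun v => by fun_prop
  have h1 : ∀ᶠ ε : ℝ in 𝓝[>] 0, ∀ i ∈ P.tight x, 0 < c (P.dir x i) + ε * p (P.dir x i) := by
    rw [Filter.eventually_all_finset]
    intro i hi
    refine ((hcont _).eventually (lt_mem_nhds ?_)).filter_mono nhdsWithin_le_nhds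
    rw [hc, hx.sum_a_dir hi]
    norm_num
  have h2 : ∀ᶠ ε : ℝ in 𝓝[>] 0, ∀ v : {v : V // v ∈ s ∧ v ≠ 0}, c v.1 + ε * p v.1 ≠ 0 := by
    rw [Filter.eventually_all]
    intro v
    by_cases hv : c v = 0
    · filter_upwards [self_mem_nhdsWithin] with ε hε
      rw [hv, zero_add]
      exact mul_ne_zero (Set.mem_Ioi.1 hε).ne' (hp v)
    · exact ((hcont _).eventually_ne (by simpa using hv)).filter_mono nhdsWithin_le_nhds
  obtain ⟨ε, h1, h2⟩ := (h1.and h2).exists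
  exact ⟨c + ε • p, by simpa using h1, fun v hv hv0 => by simpa using h2 ⟨v, hv, hv0⟩⟩

variable (P) in
/-- A pencil `c + t • d` that is generic for a three-dimensional face: the common kernel of `c` and
`d` in this face is spanned by a vector `π` which is not parallel to any facet of the face. -/
structure GenericPencil (T : Finset ι) (c d : Dual ℝ V) (π : V) : Prop where
  card : T.card + 3 = finrank ℝ V
  a_eq_zero : ∀ i ∈ T, P.a i π = 0
  c_eq_zero : c π = 0
  d_eq_zero : d π = 0
  a_ne_zero : ∀ x, P.FaceVertex T x → ∀ i ∈ P.tight x \ T, P.a i π ≠ 0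
  eq_smul : ∀ z, (∀ i ∈ T, P.a i z = 0) → c z = 0 → d z = 0 → ∃ s : ℝ, z = s • π

lemma exists_mem_of_card {κ : Type*} [DecidableEq κ] {s : Finset κ} {i : κ} (hi : i ∈ s)
    (h : s.card = 3) : ∃ j k, j ≠ k ∧ i ≠ j ∧ i ≠ k ∧ s = {i, j, k} := by
  have : (s.erase i).card = 2 := by rw [Finset.card_erase_of_mem hi, h]
  obtain ⟨j, k, hjk, he⟩ := Finset.card_eq_two.1 this
  have hj : j ∈ s.erase i := by rw [he]; simp
  have hk : k ∈ s.erase i := by rw [he]; simp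
  refine ⟨j, k, hjk, (Finset.ne_of_mem_erase hj).symm, (Finset.ne_of_mem_erase hk).symm, ?_⟩
  rw [← Finset.insert_erase hi, he]

lemma FaceVertex.card_sdiff (hx : P.FaceVertex T x) :
    (P.tight x \ T).card + T.card = finrank ℝ V := by
  rw [Finset.card_sdiff_add_card_eq_card hx.2, hx.1.2]

/-- A vector in the direction of a three-dimensional face in terms of the dual basis. -/
lemma FaceVertex.eq_add (hx : P.FaceVertex T x) (h : P.tight x \ T = {i, j, k}) (hij : i ≠ j)
    (hik : i ≠ k) (hjk : j ≠ k) (hz : ∀ i ∈ T, P.a i z = 0) :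
    z = P.a i z • P.dir x i + P.a j z • P.dir x j + P.a k z • P.dir x k := by
  conv_lhs => rw [← hx.1.sum_dir z]
  rw [← Finset.sum_sdiff hx.2, h, Finset.sum_insert (by simp [hij, hik]), Finset.sum_pair hjk,
    Finset.sum_eq_zero (s := T) fun i hi => by rw [hz i hi, zero_smul], add_zero, add_assoc]

lemma FaceVertex.a_dir_eq_zero (hx : P.FaceVertex T x) (hi : i ∈ P.tight x \ T) :
    ∀ j ∈ T, P.a j (P.dir x i) = 0 := fun j hj => by
  rw [Finset.mem_sdiff] at hi
  rw [hx.1.a_dir hi.1 (hx.2 hj), if_neg]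
  rintro rfl
  exact hi.2 hj

theorem exists_genericPencil (hT : T.card + 3 = finrank ℝ V) {u v : V} (hu : P.FaceVertex T u)
    (hv : P.FaceVertex T v) : ∃ c d π, P.GenericPencil T c d π ∧
      (∀ i ∈ P.tight u \ T, 0 < pencil c d 0 (P.dir u i)) ∧
      ∀ i ∈ P.tight v \ T, 0 < pencil c d 1 (P.dir v i) := by
  obtain ⟨c₀, h0, h0'⟩ := hu.1.exists_pos_avoiding
    ((finite_vertices (P := P)).image2 P.dir Set.finite_univ)
  obtain ⟨c₁, h1, h1'⟩ := hv.1.exists_pos_avoiding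
    (((finite_vertices (P := P)).prod (Set.finite_univ (α := ι × ι))).image fun w =>
      c₀ (P.dir w.1 w.2.2) • P.dir w.1 w.2.1 - c₀ (P.dir w.1 w.2.1) • P.dir w.1 w.2.2)
  have key : ∀ x, P.FaceVertex T x → ∀ i ∈ P.tight x \ T, ∀ z, (∀ i ∈ T, P.a i z = 0) →
      c₀ z = 0 → c₁ z = 0 → P.a i z = 0 → z = 0 := by
    intro x hx i hi z hzT hz0 hz1 hzi
    obtain ⟨j, k, hjk, hij, hik, hs⟩ := exists_mem_of_card hi (by have := hx.card_sdiff; omega)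
    have hj : j ∈ P.tight x := (Finset.mem_sdiff.1 (show j ∈ P.tight x \ T by simp [hs])).1
    have hk : k ∈ P.tight x := (Finset.mem_sdiff.1 (show k ∈ P.tight x \ T by simp [hs])).1
    have hne : P.dir x j ≠ 0 := fun h => by
      have := hx.1.a_dir hj hj
      simp [h] at this
    have hcj : c₀ (P.dir x j) ≠ 0 := h0' _ ⟨x, hx.1, j, trivial, rfl⟩ hne
    have hz := hx.eq_add hs hij hik hjk hzT
    rw [hzi, zero_smul, zero_add] at hz
    set α := P.a j z
    set β := P.a k z
    rw [hz] at hz0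
    simp only [map_add, map_smul, smul_eq_mul] at hz0
    have hz' : c₀ (P.dir x j) • z = (-β) •
        (c₀ (P.dir x k) • P.dir x j - c₀ (P.dir x j) • P.dir x k) := by
      have : c₀ (P.dir x j) * α = -β * c₀ (P.dir x k) := by linarith
      rw [hz, smul_add, smul_sub, smul_smul, smul_smul, smul_smul, smul_smul, this]
      module
    have hℓ : c₁ (c₀ (P.dir x k) • P.dir x j - c₀ (P.dir x j) • P.dir x k) ≠ 0 := by
      refine h1' _ ⟨(x, j, k), ⟨hx.1, trivial⟩, rfl⟩ fun h => ?_
      have := congrArg (P.a k) h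
      simp [hx.1.a_dir hj hk, hx.1.a_dir hk hk, hjk.symm, hcj] at this
    have h2 := congrArg c₁ hz'
    rw [map_smul, map_smul, hz1, smul_zero, smul_eq_mul] at h2
    have hβ : -β = 0 := (mul_eq_zero.1 h2.symm).resolve_right hℓ
    rw [hβ, zero_smul] at hz'
    exact (smul_eq_zero.1 hz').resolve_left hcj
  let Φ : V →ₗ[ℝ] ((T ⊕ Fin 2) → ℝ) :=
    LinearMap.pi (Sum.elim (fun i => P.a i) ![c₀, c₁])
  have hker : LinearMap.ker Φ ≠ ⊥ := LinearMap.ker_ne_bot_of_finrank_lt (by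
    rw [Module.finrank_fintype_fun_eq_card]
    simp
    omega)
  obtain ⟨π, hπ, hπ0⟩ := (Submodule.ne_bot_iff _).1 hker
  rw [LinearMap.mem_ker] at hπ
  have hπT : ∀ i ∈ T, P.a i π = 0 := fun i hi => congrFun hπ (Sum.inl ⟨i, hi⟩)
  have hπ1 : c₀ π = 0 := congrFun hπ (Sum.inr 0)
  have hπ2 : c₁ π = 0 := congrFun hπ (Sum.inr 1)
  refine ⟨c₀, c₁ - c₀, π, ⟨hT, hπT, hπ1, by simp [hπ1, hπ2], ?_, ?_⟩, ?_, ?_⟩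
  · intro x hx i hi h
    exact hπ0 (key x hx i hi π hπT hπ1 hπ2 h)
  · intro z hzT hz1 hz2
    rw [LinearMap.sub_apply, hz1, sub_zero] at hz2
    obtain ⟨i, hi⟩ : (P.tight u \ T).Nonempty := by
      rw [← Finset.card_pos]; have := hu.card_sdiff; omega
    have hπi : P.a i π ≠ 0 := fun h => hπ0 (key u hu i hi π hπT hπ1 hπ2 h)
    refine ⟨P.a i z / P.a i π, sub_eq_zero.1 (key u hu i hi _ (fun j hj => ?_) ?_ ?_ ?_)⟩
    · simp [hzT j hj, hπT j hj]
    · simp [hz1, hπ1]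
    · simp [hz2, hπ2]
    · simp [hπi]
  · intro i hi
    simpa using h0 i (Finset.mem_sdiff.1 hi).1
  · intro i hi
    simpa using h1 i (Finset.mem_sdiff.1 hi).1

namespace GenericPencil

variable {c d : Dual ℝ V} {π : V} {m : ℕ} {w : ℕ → V} {θ : ℕ → ℝ}
  (hg : P.GenericPencil T c d π)
include hg

lemma eq_zero (hx : P.FaceVertex T x) (hi : i ∈ P.tight x \ T) (hz : ∀ i ∈ T, P.a i z = 0)
    (hc : c z = 0) (hd : d z = 0) (hiz : P.a i z = 0) : z = 0 := by
  obtain ⟨s, rfl⟩ := hg.eq_smul z hz hc hd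
  rw [map_smul, smul_eq_mul] at hiz
  rw [(mul_eq_zero.1 hiz).resolve_right (hg.a_ne_zero x hx i hi), zero_smul]

lemma gen : P.Gen T c d := by
  intro x hx t i hi j hj hi0 hj0
  by_contra hij
  have hcard := hx.card_sdiff
  have hg3 := hg.card
  obtain ⟨k, hk⟩ : (((P.tight x \ T).erase i).erase j).Nonempty := by
    rw [← Finset.card_pos, Finset.card_erase_of_mem (Finset.mem_erase.2 ⟨Ne.symm hij, hj⟩),
      Finset.card_erase_of_mem hi]
    omega
  simp only [Finset.mem_erase] at hk
  have hix := (Finset.mem_sdiff.1 hi).1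
  have hjx := (Finset.mem_sdiff.1 hj).1
  have hkx := (Finset.mem_sdiff.1 hk.2.2).1
  rw [pencil_apply] at hi0 hj0
  have hz : d (P.dir x j) • P.dir x i - d (P.dir x i) • P.dir x j = 0 := by
    refine hg.eq_zero hx hk.2.2 (fun l hl => ?_) ?_ ?_ ?_
    · simp [hx.a_dir_eq_zero hi l hl, hx.a_dir_eq_zero hj l hl]
    · simp only [map_sub, map_smul, smul_eq_mul]
      linear_combination d (P.dir x j) * hi0 - d (P.dir x i) * hj0
    · simp only [map_sub, map_smul, smul_eq_mul]
      ring
    · simp [hx.1.a_dir hix hkx, hx.1.a_dir hjx hkx, hk.1, hk.2.1]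
  have hdi : d (P.dir x i) = 0 := by
    have := congrArg (P.a j) hz
    simpa [hx.1.a_dir hix hjx, hx.1.a_dir hjx hjx, Ne.symm hij] using this
  have hi0 : P.dir x i = 0 := by
    refine hg.eq_zero hx hj (hx.a_dir_eq_zero hi) ?_ hdi ?_
    · simpa [hdi] using hi0
    · rw [hx.1.a_dir hix hjx, if_neg (Ne.symm hij)]
  have := hx.1.a_dir hix hix
  simp [hi0] at this

/-- Functionals that vanish on `π` and on one more vector are proportional. -/
lemma proportional {f : Dual ℝ V} {σ : ℝ} {δ η : V} (hf : f π = 0) (hδT : ∀ i ∈ T, P.a i δ = 0)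
    (hηT : ∀ i ∈ T, P.a i η = 0) (hxT : ∀ i ∈ T, P.a i x = 0) (hδ : pencil c d σ δ = 0)
    (hfδ : f δ = 0) (hdδ : d δ ≠ 0) : f x * pencil c d σ η = pencil c d σ x * f η := by
  set z := pencil c d σ η • x - pencil c d σ x • η with hz
  set r := d z / d δ
  have hr : r * d δ = d z := div_mul_cancel₀ _ hdδ
  have hσz : pencil c d σ z = 0 := by
    rw [hz, map_sub, map_smul, map_smul, smul_eq_mul, smul_eq_mul, mul_comm, sub_self]
  obtain ⟨s, hs⟩ := hg.eq_smul (z - r • δ) (fun i hi => by simp [z, hδT i hi, hηT i hi, hxT i hi])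
    (by
      rw [pencil_apply] at hδ hσz
      simp only [map_sub, map_smul, smul_eq_mul]
      linear_combination hσz - r * hδ + σ * hr)
    (by simp only [map_sub, map_smul, smul_eq_mul]; rw [hr, sub_self])
  have h := congrArg f hs
  rw [map_sub, map_smul, map_smul, hf, hfδ, hz, map_sub, map_smul, map_smul] at h
  simp only [smul_eq_mul, mul_zero, sub_zero] at h
  linarith

/-- Three vertices cannot share two facets of a three-dimensional face. -/
lemma eq_or_eq {F G : ι} (hFT : F ∉ T) (hGT : G ∉ T) (hFG : F ≠ G) (hx : P.FaceVertex T x)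
    (hy : P.FaceVertex T y) (hz : P.FaceVertex T z) (hFx : F ∈ P.tight x) (hFy : F ∈ P.tight y)
    (hFz : F ∈ P.tight z) (hGx : G ∈ P.tight x) (hGy : G ∈ P.tight y) (hGz : G ∈ P.tight z)
    (hxy : x ≠ y) : z = x ∨ z = y := by
  have hg3 := hg.card
  refine hx.1.eq_or_eq (T := insert F (insert G T)) hy.1 hz.1 ?_ ?_ ?_ ?_ hxy
  · rw [Finset.card_insert_of_notMem (by simp [hFG, hFT]), Finset.card_insert_of_notMem hGT]
    omega
  all_goals simp only [Finset.insert_subset_iff]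
  exacts [⟨hFx, hGx, hx.2⟩, ⟨hFy, hGy, hy.2⟩, ⟨hFz, hGz, hz.2⟩]

omit hg in
lemma eq_zero_of_same_sign {s f g : ℝ} (hf : f ≠ 0) (hg : g ≠ 0) (h : 0 < f ↔ 0 < g)
    (h1 : 0 ≤ s * f) (h2 : s * g ≤ 0) : s = 0 := by
  rcases lt_or_gt_of_ne hf with hf | hf
  · have hg := lt_of_le_of_ne (not_lt.1 (mt h.2 hf.not_gt)) hg
    exact le_antisymm (nonpos_of_mul_nonneg_left h1 hf) (nonneg_of_mul_nonpos_left h2 hg)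
  · have hg := h.1 hf
    exact le_antisymm (nonpos_of_mul_nonpos_left h2 hg) (nonneg_of_mul_nonneg_left h1 hf)

omit hg in
/-- If a proper convex combination of two numbers `≤ b` equals `b`, both are `b`. -/
lemma eq_of_combo_eq {l s t b : ℝ} (hl0 : 0 < l) (hl1 : l < 1) (hs : s ≤ b) (ht : t ≤ b)
    (h : s + l * (t - s) = b) : s = b ∧ t = b := by
  constructor
  · nlinarith [mul_nonneg hl0.le (sub_nonneg.2 ht), mul_nonneg (sub_pos.2 hl1).le (sub_nonneg.2 hs)]
  · nlinarith [mul_nonneg hl0.le (sub_nonneg.2 ht), mul_nonneg (sub_pos.2 hl1).le (sub_nonneg.2 hs)]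

/-- Two facets on the same side of the pencil do not cross. -/
lemma no_crossing (h : P.ParamPath T c d m w θ) {p q : ℕ} (hpq : p < q) (hq : q ≤ m) {σ : ℝ}
    (hσ : pencil c d σ (w p) = pencil c d σ (w q)) {F G : ι} {B D : V} (hB : P.FaceVertex T B)
    (hD : P.FaceVertex T D) (hFT : F ∉ T) (hGT : G ∉ T) (hFG : F ≠ G)
    (hFp : F ∈ P.tight (w p)) (hFq : F ∈ P.tight (w q)) (hGB : G ∈ P.tight B)
    (hGD : G ∈ P.tight D) (hside : 0 < P.a F π ↔ 0 < P.a G π)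
    (hκB : pencil c d σ (w p) < pencil c d σ B) (hκD : pencil c d σ D < pencil c d σ (w p)) :
    False := by
  have hp : p ≤ m := by omega
  have hA := h.vertex p hp
  have hC := h.vertex q hq
  have hσp : θ p < σ := by
    by_contra! hcon
    exact (h.lt_of_le_θ hpq hq hcon).ne hσ.symm
  have hσq : σ < θ q := by
    by_contra! hcon
    exact (h.lt_of_θ_le hpq hq hcon).ne hσ
  have hdd := sub_pos.2 (h.d_lt hpq hq)
  have hBD := sub_pos.2 (hκD.trans hκB)
  set κ := pencil c d σ (w p) with hκ
  set l := (κ - pencil c d σ D) / (pencil c d σ B - pencil c d σ D)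
  have hl : l * (pencil c d σ B - pencil c d σ D) = κ - pencil c d σ D :=
    div_mul_cancel₀ _ hBD.ne'
  have hl0 : 0 < l := div_pos (sub_pos.2 hκD) hBD
  have hl1 : l < 1 := by rw [div_lt_one hBD]; linarith
  clear_value κ l
  set Q := D + l • (B - D) with hQ
  have hQa : ∀ f : Dual ℝ V, f Q = f D + l * (f B - f D) := fun f => by simp [hQ]
  have hQf : P.Face T Q := by
    refine ⟨fun i => ?_, fun i hi => ?_⟩
    · rw [hQa]
      have := hB.1.1 i
      have := hD.1.1 i
      nlinarith
    · rw [mem_tight, hQa, hB.face.eq hi, hD.face.eq hi]; ring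
  have hQσ : pencil c d σ Q = κ := by rw [hQa, hl]; ring
  have hQp := h.apply_le hp hQf
  have hQq := h.apply_le hq hQf
  simp only [pencil_apply] at hQp hQq hQσ hκ hσ
  have hdQ1 : d (w p) ≤ d Q := by
    by_contra! hcon
    nlinarith
  have hdQ2 : d Q ≤ d (w q) := by
    by_contra! hcon
    nlinarith
  set μ := (d Q - d (w p)) / (d (w q) - d (w p))
  have hμ : μ * (d (w q) - d (w p)) = d Q - d (w p) := div_mul_cancel₀ _ hdd.ne'
  have hμ0 : 0 ≤ μ := div_nonneg (sub_nonneg.2 hdQ1) hdd.le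
  have hμ1 : μ ≤ 1 := by rw [div_le_one hdd]; linarith
  clear_value μ
  set Y := w p + μ • (w q - w p) with hY
  have hYa : ∀ f : Dual ℝ V, f Y = f (w p) + μ * (f (w q) - f (w p)) := fun f => by simp [hY]
  clear_value Q Y
  have hdY : d Y = d Q := by rw [hYa, hμ]; ring
  have hcY : c Y = c Q := by
    have h1 := hYa c
    linear_combination h1 - hQσ - hκ - μ * (hσ - hκ) - σ * hμ
  obtain ⟨s, hs⟩ := hg.eq_smul (Y - Q) (fun i hi => by
    rw [map_sub, hYa, hQa, hA.face.eq hi, hB.face.eq hi, hC.face.eq hi, hD.face.eq hi]; ring)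
    (by rw [map_sub, hcY, sub_self]) (by rw [map_sub, hdY, sub_self])
  have hYf : ∀ i, P.a i Y ≤ P.b i := by
    intro i
    rw [hYa]
    have := hA.1.1 i
    have := hC.1.1 i
    nlinarith
  rw [mem_tight] at hFp hFq hGB hGD
  have hFY : P.a F Y = P.b F := by rw [hYa, hFp, hFq]; ring
  have hGQ : P.a G Q = P.b G := by rw [hQa, hGB, hGD]; ring
  have hFs := congrArg (P.a F) hs
  have hGs := congrArg (P.a G) hs
  simp only [map_sub, map_smul, smul_eq_mul, hFY, hGQ] at hFs hGs
  have hF0 : P.a F π ≠ 0 := hg.a_ne_zero _ hA F (Finset.mem_sdiff.2 ⟨mem_tight.2 hFp, hFT⟩)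
  have hG0 : P.a G π ≠ 0 := hg.a_ne_zero _ hB G (Finset.mem_sdiff.2 ⟨mem_tight.2 hGB, hGT⟩)
  have hFQ := hQf.1 F
  have hGY := hYf G
  have hs0 : s = 0 := eq_zero_of_same_sign hF0 hG0 hside
    (hFs ▸ sub_nonneg.2 hFQ) (hGs ▸ sub_nonpos.2 hGY)
  rw [hs0, zero_mul] at hFs hGs
  have hFB := hB.1.1 F
  have hFD := hD.1.1 F
  have hFQ' := hQa (P.a F)
  obtain ⟨hFD', hFB'⟩ := eq_of_combo_eq hl0 hl1 hFD hFB (by linarith)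
  have hGp := hA.1.1 G
  have hGq := hC.1.1 G
  have hGY' := hYa (P.a G)
  have hne : B ≠ D := by rintro rfl; linarith
  have hx : P.a G (w p) = P.b G ∨ P.a G (w q) = P.b G := by
    by_contra! hcon
    have h1 := lt_of_le_of_ne hGp hcon.1
    have h2 := lt_of_le_of_ne hGq hcon.2
    have h3 : P.a G Y = P.b G := by linarith
    rcases hμ1.eq_or_lt with rfl | hμ1
    · linarith
    · nlinarith [mul_nonneg hμ0 (sub_pos.2 h2).le, mul_pos (sub_pos.2 hμ1) (sub_pos.2 h1)]
  rcases hx with hx | hx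
  · rcases hg.eq_or_eq hFT hGT hFG hB hD hA (mem_tight.2 hFB') (mem_tight.2 hFD')
      (mem_tight.2 hFp) (mem_tight.2 hGB) (mem_tight.2 hGD) (mem_tight.2 hx) hne with rfl | rfl
    · exact hκB.ne (by rw [pencil_apply, hκ])
    · exact hκD.ne (by rw [pencil_apply, hκ])
  · have hκ' : pencil c d σ (w q) = κ := by simp only [pencil_apply]; linarith
    rcases hg.eq_or_eq hFT hGT hFG hB hD hC (mem_tight.2 hFB') (mem_tight.2 hFD')
      (mem_tight.2 hFq) (mem_tight.2 hGB) (mem_tight.2 hGD) (mem_tight.2 hx) hne with rfl | rfl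
    · exact hκB.ne hκ'.symm
    · exact hκD.ne hκ'

lemma no_opposite (h : P.ParamPath T c d m w θ) {p q r e : ℕ} (hpr : p < r) (hrq : r < q)
    (hq : q ≤ m) (he : e < p ∨ q < e ∧ e ≤ m) {F G : ι} (hFT : F ∉ T) (hGT : G ∉ T)
    (hF0 : 0 < P.a F π) (hG0 : P.a G π < 0) (hFp : F ∈ P.tight (w p)) (hFq : F ∈ P.tight (w q))
    (hGp : G ∈ P.tight (w p)) (hGq : G ∈ P.tight (w q)) : False := by
  obtain ⟨σ, hσp, hσq, hσ⟩ := h.exists_eq (hpr.trans hrq) hq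
  have hκr := h.lt_of_between hpr hrq hq hσ
  have hκe : pencil c d σ (w e) < pencil c d σ (w p) := by
    rcases he with he | ⟨he, hem⟩
    · exact h.lt_of_θ_le he (by omega) hσp.le
    · rw [hσ]; exact h.lt_of_le_θ he hem hσq.le
  have hv : ∀ l ≤ m, ∀ i ∈ T, P.a i (w l - w p) = 0 := fun l hl i hi => by
    rw [map_sub, (h.vertex l hl).face.eq hi, (h.vertex p (by omega)).face.eq hi, sub_self]
  rw [mem_tight] at hFp hFq hGp hGq
  have hem : e ≤ m := by omega
  have key := hg.proportional (f := P.a F π • P.a G - P.a G π • P.a F) (σ := σ)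
    (δ := w q - w p) (η := w r - w p) (x := w e - w p) (by simp [mul_comm]) (hv q hq)
    (hv r (by omega)) (hv e hem) (by rw [map_sub, hσ, sub_self]) (by simp [hFp, hFq, hGp, hGq])
    (by rw [map_sub]; exact (sub_pos.2 (h.d_lt (hpr.trans hrq) hq)).ne')
  simp only [LinearMap.sub_apply, LinearMap.smul_apply, smul_eq_mul] at key
  rw [map_sub (pencil c d σ), map_sub (pencil c d σ)] at key
  simp only [map_sub, hFp, hGp] at key
  have hFr := sub_nonpos.2 ((h.vertex r (by omega)).1.1 F)
  have hGr := sub_nonpos.2 ((h.vertex r (by omega)).1.1 G)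
  have hFe := sub_nonpos.2 ((h.vertex e hem).1.1 F)
  have hGe := sub_nonpos.2 ((h.vertex e hem).1.1 G)
  have h1 := mul_nonpos_of_nonneg_of_nonpos hF0.le hGr
  have h2 := mul_nonneg_of_nonpos_of_nonpos hG0.le hFr
  have h3 := mul_nonpos_of_nonneg_of_nonpos hF0.le hGe
  have h4 := mul_nonneg_of_nonpos_of_nonpos hG0.le hFe
  have h5 := mul_nonpos_of_nonpos_of_nonneg (sub_nonpos.2 (h3.trans h4)) (sub_pos.2 hκr).le
  have h6 : P.a F π * (P.a G (w r) - P.b G) - P.a G π * (P.a F (w r) - P.b F) = 0 := by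
    by_contra hne
    have := lt_of_le_of_ne (sub_nonpos.2 (h1.trans h2)) hne
    have := mul_pos_of_neg_of_neg (sub_neg.2 hκe) this
    linarith
  have hGr' : P.a F π * (P.a G (w r) - P.b G) = 0 := by linarith
  have hFr' : P.a G π * (P.a F (w r) - P.b F) = 0 := by linarith
  have hGr := sub_eq_zero.1 ((mul_eq_zero.1 hGr').resolve_left hF0.ne')
  have hFr := sub_eq_zero.1 ((mul_eq_zero.1 hFr').resolve_left hG0.ne)
  rcases hg.eq_or_eq hFT hGT (by rintro rfl; linarith) (h.vertex p (by omega)) (h.vertex q hq)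
    (h.vertex r (by omega)) (mem_tight.2 hFp) (mem_tight.2 hFq) (mem_tight.2 hFr)
    (mem_tight.2 hGp) (mem_tight.2 hGq) (mem_tight.2 hGr) (h.ne (hpr.trans hrq) hq) with h7 | h7
  · exact h.ne hpr (by omega) h7.symm
  · exact h.ne hrq hq h7

theorem exists_goodPositions (h : P.ParamPath T c d m w θ) :
    ∃ A : Finset ℕ, 0 ∈ A ∧ m ∈ A ∧ (∀ q ∈ A, q ≤ m) ∧
      GoodPositions (fun p => P.tight (w p) \ T) A := by
  have hne : ∀ p ≤ m, ∀ i ∈ P.tight (w p) \ T, P.a i π ≠ 0 :=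
    fun p hp => hg.a_ne_zero _ (h.vertex p hp)
  refine SimpleSystem.exists_goodPositions _ (fun i => 0 < P.a i π) m ?_ ?_ ?_ ?_ m le_rfl
  · intro F G a b p e hFG hside hab hbp hpe he hFa hFp hGb hGe
    rw [Finset.mem_sdiff] at hFa hFp hGb hGe
    obtain ⟨σ, -, hσp, hσ⟩ := h.exists_eq (hab.trans hbp) (by omega)
    refine hg.no_crossing h (hab.trans hbp) (by omega) hσ (h.vertex b (by omega)) (h.vertex e he)
      hFa.2 hGb.2 hFG hFa.1 hFp.1 hGb.1 hGe.1 hside (h.lt_of_between hab hbp (by omega) hσ) ?_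
    rw [hσ]
    exact h.lt_of_le_θ hpe he hσp.le
  · intro F G a b p hside hab hbp hp ha hFa hFp hGa hGp
    have hF0 := hne a (by omega) F hFa
    have hG0 := hne a (by omega) G hGa
    rw [Finset.mem_sdiff] at hFa hFp hGa hGp
    have he : ∃ e, e < a ∨ p < e ∧ e ≤ m := by
      rcases ha with ha | ha
      · exact ⟨0, Or.inl ha⟩
      · exact ⟨m, Or.inr ⟨ha, le_rfl⟩⟩
    obtain ⟨e, he⟩ := he
    rcases lt_or_gt_of_ne hF0 with hF | hF <;> rcases lt_or_gt_of_ne hG0 with hG | hG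
    · exact hside ⟨fun h => absurd h hF.not_gt, fun h => absurd h hG.not_gt⟩
    · exact hg.no_opposite h hab hbp hp he hGa.2 hFa.2 hG hF hGa.1 hGp.1 hFa.1 hFp.1
    · exact hg.no_opposite h hab hbp hp he hFa.2 hGa.2 hF hG hFa.1 hFp.1 hGa.1 hGp.1
    · exact hside ⟨fun _ => hG, fun _ => hF⟩
  · intro p hp
    obtain ⟨τ, -, -, i, hi, j, hj, ht, -⟩ := h.step p hp
    refine ⟨j, ?_, fun hj' => hj (Finset.mem_sdiff.1 hj').1, fun Z hZ hZj => ?_⟩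
    · rw [Finset.mem_sdiff, ht]
      exact ⟨Finset.mem_insert_self _ _, fun hjT => hj ((h.vertex p hp.le).2 hjT)⟩
    · rw [Finset.mem_sdiff, ht, Finset.mem_insert] at hZ
      exact Finset.mem_sdiff.2 ⟨Finset.mem_of_mem_erase (hZ.1.resolve_left hZj), hZ.2⟩
  · intro p hp
    obtain ⟨τ, -, -, i, hi, j, hj, ht, -⟩ := h.step p hp
    have hcard := (h.vertex p hp.le).card_sdiff
    have hg3 := hg.card
    obtain ⟨G, hG⟩ : ((P.tight (w p) \ T).erase i).Nonempty := by
      rw [← Finset.card_pos, Finset.card_erase_of_mem hi]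
      omega
    rw [Finset.mem_erase] at hG
    have hG' := Finset.mem_sdiff.1 hG.2
    refine ⟨G, hG.2, ?_⟩
    rw [Finset.mem_sdiff, ht]
    exact ⟨Finset.mem_insert_of_mem (Finset.mem_erase.2 ⟨hG.1, hG'.1⟩), hG'.2⟩

end GenericPencil

variable (P) in
/-- There is a path from `u` to `v` through vertices satisfying `S` which never revisits a facet. -/
def NonrevisitingPath (S : V → Prop) (u v : V) : Prop :=
  ∃ (m : ℕ) (f : ℕ → V), f 0 = u ∧ f m = v ∧ (∀ i ≤ m, S (f i)) ∧
    (∀ i < m, P.Adj (f i) (f (i + 1))) ∧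
    ∀ i j l, i ≤ j → j ≤ l → l ≤ m → P.tight (f i) ∩ P.tight (f l) ⊆ P.tight (f j)

namespace NonrevisitingPath

lemma refl {S : V → Prop} (hx : S x) : P.NonrevisitingPath S x x :=
  ⟨0, fun _ => x, rfl, rfl, fun _ _ => hx, fun i hi => by omega,
    fun _ _ _ _ _ _ => Finset.inter_subset_left⟩

lemma of_adj {S : V → Prop} (hx : S x) (hy : S y) (h : P.Adj x y) : P.NonrevisitingPath S x y := by
  refine ⟨1, fun i => if i = 0 then x else y, by simp, by simp, fun i _ => ?_, fun i hi => ?_,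
    fun i j l hij hjl hl => ?_⟩
  · dsimp only
    split_ifs
    exacts [hx, hy]
  · obtain rfl : i = 0 := by omega
    simpa using h
  · rcases Nat.eq_zero_or_pos j with rfl | hj
    · obtain rfl : i = 0 := by omega
      exact Finset.inter_subset_left
    · obtain rfl : j = l := by omega
      exact Finset.inter_subset_right

lemma mono {S S' : V → Prop} {u v : V} (h : P.NonrevisitingPath S u v) (hS : ∀ x, S x → S' x) :
    P.NonrevisitingPath S' u v := by
  obtain ⟨m, f, h0, hm, hf, h⟩ := h
  exact ⟨m, f, h0, hm, fun i hi => hS _ (hf i hi), h⟩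

lemma trans {S S' : V → Prop} {u v w : V} (h : P.NonrevisitingPath S u w)
    (h' : P.NonrevisitingPath S' w v)
    (hS : ∀ x y, S x → S' y → P.tight x ∩ P.tight y ⊆ P.tight w) :
    P.NonrevisitingPath (fun x => S x ∨ S' x) u v := by
  obtain ⟨m, f, hf0, hfm, hfS, hfa, hfn⟩ := h
  obtain ⟨n, g, hg0, hgn, hgS, hga, hgr⟩ := h'
  set F : ℕ → V := fun i => if i ≤ m then f i else g (i - m) with hF
  have hF1 : ∀ i ≤ m, F i = f i := fun i hi => by simp [hF, hi]
  have hF2 : ∀ i, m ≤ i → F i = g (i - m) := fun i hi => by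
    rcases hi.eq_or_lt with rfl | hi
    · simp [hF, hfm, hg0]
    · simp [hF, hi.not_ge]
  refine ⟨m + n, F, by rw [hF1 0 (by omega), hf0],
    by rw [hF2 _ (by omega), Nat.add_sub_cancel_left, hgn], fun i hi => ?_, fun i hi => ?_,
    fun i j l hij hjl hl => ?_⟩
  · rcases le_total i m with h1 | h1
    · rw [hF1 i h1]; exact Or.inl (hfS i h1)
    · rw [hF2 i h1]; exact Or.inr (hgS _ (by omega))
  · rcases lt_or_ge i m with h1 | h1
    · rw [hF1 i h1.le, hF1 _ h1]; exact hfa i h1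
    · rw [hF2 i h1, hF2 _ (by omega), show i + 1 - m = i - m + 1 by omega]
      exact hga _ (by omega)
  · rcases le_total l m with h1 | h1
    · rw [hF1 i (by omega), hF1 j (by omega), hF1 l h1]
      exact hfn i j l hij hjl h1
    rcases le_total m i with h2 | h2
    · rw [hF2 i h2, hF2 j (by omega), hF2 l h1]
      exact hgr _ _ _ (by omega) (by omega) (by omega)
    rw [hF1 i h2, hF2 l h1]
    intro Z hZ
    have hw := hS _ _ (hfS i h2) (hgS (l - m) (by omega)) hZ
    rw [Finset.mem_inter] at hZ
    rcases le_total j m with h3 | h3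
    · rw [hF1 j h3]
      exact hfn i j m hij h3 le_rfl (Finset.mem_inter.2 ⟨hZ.1, by rwa [hfm]⟩)
    · rw [hF2 j h3]
      exact hgr 0 _ _ (by omega) (by omega) (by omega) (Finset.mem_inter.2 ⟨by rwa [hg0], hZ.2⟩)

end NonrevisitingPath

lemma ParamPath.adj {c d : Dual ℝ V} {m : ℕ} {w : ℕ → V} {θ : ℕ → ℝ}
    (h : P.ParamPath T c d m w θ) {p : ℕ} (hp : p < m) : P.Adj (w p) (w (p + 1)) := by
  obtain ⟨τ, -, -, i, hi, j, hj, ht, -⟩ := h.step p hp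
  exact (h.vertex p hp.le).1.adj_of_tight_eq (h.vertex _ hp).1 (Finset.mem_sdiff.1 hi).1 hj ht

variable (P) in
/-- A parametric path inside a facet `G` of a three-dimensional face that replaces the part
between `q₁` and `q₂` of a parametric path of the face. -/
structure Pocket (T : Finset ι) (c d : Dual ℝ V) (w : ℕ → V) (θ : ℕ → ℝ) (q₁ q₂ : ℕ) (G : ι)
    (m : ℕ) (y : ℕ → V) (φ : ℕ → ℝ) : Prop where
  path : P.ParamPath (insert G T) c d m y φ
  lt : q₁ < q₂
  zero : y 0 = w q₁
  last : y m = w q₂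
  le_zero : θ q₁ ≤ φ 0
  last_le : φ m ≤ θ q₂
  notMem : G ∉ T
  not_tight : ∀ r, q₁ < r → r < q₂ → G ∉ P.tight (w r)
  unique : ∀ Z ∉ T, Z ∈ P.tight (w q₁) → Z ∈ P.tight (w q₂) → Z = G

variable (P) in
/-- The properties of interior vertices of a pocket. -/
def Excursion (T : Finset ι) (c d : Dual ℝ V) (w : ℕ → V) (θ : ℕ → ℝ) (q₁ q₂ : ℕ) (x : V) : Prop :=
  ∃ G σ, θ q₁ < σ ∧ σ < θ q₂ ∧ pencil c d σ (w q₁) = pencil c d σ (w q₂) ∧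
    pencil c d σ (w q₁) < pencil c d σ x ∧ G ∈ P.tight (w q₁) ∧ G ∈ P.tight (w q₂) ∧
    ∀ Z ∈ P.tight x, Z ∉ T → Z ≠ G → ∀ z, P.FaceVertex T z → Z ∈ P.tight z →
      pencil c d σ (w q₁) ≤ pencil c d σ z

namespace Pocket

variable {c d : Dual ℝ V} {π : V} {m n q₁ q₂ : ℕ} {w y : ℕ → V} {θ φ : ℕ → ℝ} {G : ι}

lemma vertex (hp : P.Pocket T c d w θ q₁ q₂ G n y φ) {j : ℕ} (hj : j ≤ n) :
    P.FaceVertex T (y j) := (hp.path.vertex j hj).mono (Finset.subset_insert _ _)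

lemma tight_mem (hp : P.Pocket T c d w θ q₁ q₂ G n y φ) {j : ℕ} (hj : j ≤ n) :
    G ∈ P.tight (y j) := (hp.path.vertex j hj).2 (Finset.mem_insert_self _ _)

lemma no_revisit (hg : P.GenericPencil T c d π) (hp : P.Pocket T c d w θ q₁ q₂ G n y φ)
    {i j l e : ℕ} (hij : i < j) (hjl : j < l) (hl : l ≤ n) (he : e < i ∨ l < e ∧ e ≤ n) {Z : ι}
    (hZi : Z ∈ P.tight (y i)) (hZl : Z ∈ P.tight (y l)) : Z ∈ P.tight (y j) := by
  by_contra hZj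
  have h := hp.path
  obtain ⟨σ, hσi, hσl, hσ⟩ := h.exists_eq (hij.trans hjl) hl
  have hκj := h.lt_of_between hij hjl hl hσ
  have hκe : pencil c d σ (y e) < pencil c d σ (y i) := by
    rcases he with he | ⟨he, hem⟩
    · exact h.lt_of_θ_le he (by omega) hσi.le
    · rw [hσ]; exact h.lt_of_le_θ he hem hσl.le
  have hen : e ≤ n := by omega
  have hv : ∀ l ≤ n, ∀ k ∈ T, P.a k (y l - y i) = 0 := fun l hl k hk => by
    rw [map_sub, (hp.vertex hl).face.eq hk, (hp.vertex (by omega : i ≤ n)).face.eq hk, sub_self]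
  have hG : ∀ l ≤ n, P.a G (y l) = P.b G := fun l hl => mem_tight.1 (hp.tight_mem hl)
  rw [mem_tight] at hZi hZl hZj
  have key := hg.proportional (f := P.a G π • P.a Z - P.a Z π • P.a G) (σ := σ)
    (δ := y l - y i) (η := y j - y i) (x := y e - y i) (by simp [mul_comm]) (hv l hl)
    (hv j (by omega)) (hv e hen) (by rw [map_sub, hσ, sub_self])
    (by simp [hZi, hZl, hG l hl, hG i (by omega)])
    (by rw [map_sub]; exact (sub_pos.2 (h.d_lt (hij.trans hjl) hl)).ne')
  simp only [LinearMap.sub_apply, LinearMap.smul_apply, smul_eq_mul] at key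
  rw [map_sub (pencil c d σ), map_sub (pencil c d σ)] at key
  simp only [map_sub, hZi, hG i (by omega), hG j (by omega), hG e hen, sub_self, mul_zero,
    sub_zero] at key
  have hG0 : P.a G π ≠ 0 := hg.a_ne_zero _ (hp.vertex hl) G
    (Finset.mem_sdiff.2 ⟨hp.tight_mem hl, hp.notMem⟩)
  have key' : (P.a Z (y e) - P.b Z) * (pencil c d σ (y j) - pencil c d σ (y i)) =
      (pencil c d σ (y e) - pencil c d σ (y i)) * (P.a Z (y j) - P.b Z) := by
    refine mul_left_cancel₀ hG0 ?_
    linear_combination key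
  have h1 := mul_nonpos_of_nonpos_of_nonneg (sub_nonpos.2 ((hp.vertex hen).1.1 Z))
    (sub_pos.2 hκj).le
  have h2 := mul_pos_of_neg_of_neg (sub_neg.2 hκe)
    (sub_neg.2 (lt_of_le_of_ne ((hp.vertex (by omega : j ≤ n)).1.1 Z) hZj))
  linarith

/-- Every further facet through an interior vertex of a pocket contains an edge of the pocket. -/
lemma exists_edge (hp : P.Pocket T c d w θ q₁ q₂ G n y φ) {j : ℕ} (hj0 : 0 < j) (hj : j < n)
    {Z : ι} (hZ : Z ∈ P.tight (y j)) (hZT : Z ∉ insert G T) :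
    ∃ τ, θ q₁ ≤ τ ∧ τ ≤ θ q₂ ∧ ∃ k ∈ P.tight (y j) \ insert G T, k ≠ Z ∧
      pencil c d τ (P.dir (y j) k) = 0 ∧ 0 < pencil c d τ (P.dir (y j) Z) := by
  have h := hp.path
  obtain ⟨τ, hτ1, hτ2, i, hi, -, -, -, hi0, -, hk⟩ := h.step j hj
  have hθ0 := h.θ_le (Nat.zero_le j) hj.le
  have hθn := h.θ_le (show j + 1 ≤ n from hj) le_rfl
  by_cases hiZ : i = Z
  · obtain ⟨τ', hτ1', hτ2', i', hi', N, hN, ht, hi0', hN0, hk'⟩ := h.step (j - 1) (by omega)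
    rw [Nat.sub_add_cancel hj0] at *
    have hNj : N ∈ P.tight (y j) \ insert G T := by
      rw [ht, Finset.mem_sdiff]
      exact ⟨Finset.mem_insert_self _ _, fun hNT => hN ((h.vertex (j - 1) (by omega)).2 hNT)⟩
    have hθ0' := h.θ_le (Nat.zero_le (j - 1)) (by omega)
    have hθn' := h.θ_le hj.le le_rfl
    have hNZ : N ≠ Z := by
      rintro rfl
      have hpos := h.pos j hj.le N hNj
      rw [hiZ] at hi0
      simp only [pencil_apply] at hpos hi0 hN0
      have hd0 : (τ - τ') * d (P.dir (y j) N) = 0 := by linarith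
      rcases mul_eq_zero.1 hd0 with hd0 | hd0
      · linarith
      · rw [hd0] at hi0 hpos
        linarith
    refine ⟨τ', by linarith [hp.le_zero], by linarith [hp.last_le], N, hNj, hNZ, hN0, (hk' Z ?_).2⟩
    rw [ht, Finset.mem_insert, Finset.mem_erase] at hZ
    have hZ' := hZ.resolve_left hNZ.symm
    exact Finset.mem_erase.2 ⟨hZ'.1, Finset.mem_sdiff.2 ⟨hZ'.2, hZT⟩⟩
  · exact ⟨τ, by linarith [hp.le_zero], by linarith [hp.last_le], i, hi, hiZ, hi0,
      (hk Z (Finset.mem_erase.2 ⟨Ne.symm hiZ, Finset.mem_sdiff.2 ⟨hZ, hZT⟩⟩)).1⟩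

lemma excursion (hg : P.GenericPencil T c d π) (h : P.ParamPath T c d m w θ)
    (hp : P.Pocket T c d w θ q₁ q₂ G n y φ) (hq : q₂ ≤ m) {j : ℕ} (hj0 : 0 < j) (hj : j < n) :
    P.Excursion T c d w θ q₁ q₂ (y j) := by
  obtain ⟨σ, hσ1, hσ2, hσ⟩ := h.exists_eq hp.lt hq
  have hκ : pencil c d σ (w q₁) < pencil c d σ (y j) := by
    rw [← hp.zero]
    exact hp.path.lt_of_between hj0 hj le_rfl (by rw [hp.zero, hp.last, hσ])
  have hG1 : G ∈ P.tight (w q₁) := by rw [← hp.zero]; exact hp.tight_mem (Nat.zero_le n)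
  have hG2 : G ∈ P.tight (w q₂) := by rw [← hp.last]; exact hp.tight_mem le_rfl
  refine ⟨G, σ, hσ1, hσ2, hσ, hκ, hG1, hG2, fun Z hZ hZT hZG z hz hZz => ?_⟩
  by_contra! hcon
  have hyj := hp.vertex hj.le
  have hGj := hp.tight_mem hj.le
  obtain ⟨τ, hτ1, hτ2, k, hk, hkZ, hk0, hZ0⟩ := hp.exists_edge hj0 hj hZ (by simp [hZG, hZT])
  rw [Finset.mem_sdiff, Finset.mem_insert, not_or] at hk
  have ht : P.tight (y j) \ T = {G, Z, k} := by
    refine (Finset.eq_of_subset_of_card_le ?_ ?_).symm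
    · intro l hl
      simp only [Finset.mem_insert, Finset.mem_singleton] at hl
      rcases hl with rfl | rfl | rfl
      exacts [Finset.mem_sdiff.2 ⟨hGj, hp.notMem⟩, Finset.mem_sdiff.2 ⟨hZ, hZT⟩,
        Finset.mem_sdiff.2 ⟨hk.1, hk.2.2⟩]
    · rw [Finset.card_insert_of_notMem (by simp [Ne.symm hZG, Ne.symm hk.2.1]),
        Finset.card_pair hkZ.symm]
      have := hyj.card_sdiff
      have := hg.card
      omega
  rcases le_or_gt 0 (pencil c d τ (P.dir (y j) G)) with hα | hα
  · obtain ⟨r, hr1, hr2, hr⟩ := h.eq_of_max hp.lt.le hq hτ1 hτ2 hyj fun z hz =>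
      hyj.le_of_nonneg (fun l hl => by
        simp only [ht, Finset.mem_insert, Finset.mem_singleton] at hl
        rcases hl with rfl | rfl | rfl
        exacts [hα, hZ0.le, hk0.ge]) hz.face
    rcases hr1.eq_or_lt with rfl | hr1
    · exact hp.path.ne hj0 hj.le (hp.zero.trans hr.symm)
    rcases hr2.eq_or_lt with rfl | hr2
    · exact hp.path.ne hj le_rfl (hr.trans hp.last.symm)
    · exact hp.not_tight r hr1 hr2 (hr ▸ hGj)
  · refine hg.no_crossing h hp.lt hq hσ hyj hz hp.notMem hZT hZG.symm hG1 hG2 hZ hZz ?_ hκ hcon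
    have hπ := congrArg (pencil c d τ)
      (hyj.eq_add ht hZG.symm (Ne.symm hk.2.1) hkZ.symm hg.a_eq_zero)
    rw [map_add, map_add, map_smul, map_smul, map_smul, hk0, pencil_apply c d τ π, hg.c_eq_zero,
      hg.d_eq_zero] at hπ
    simp only [smul_eq_mul, mul_zero, add_zero] at hπ
    constructor
    · intro hG
      have := mul_neg_of_pos_of_neg hG hα
      exact pos_of_mul_pos_left (by linarith) hZ0.le
    · intro hZπ
      have := mul_pos hZπ hZ0
      exact pos_of_mul_neg_left (by linarith) hα.le

lemma nonrevisitingPath (hg : P.GenericPencil T c d π) (h : P.ParamPath T c d m w θ)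
    (hp : P.Pocket T c d w θ q₁ q₂ G n y φ) (hq : q₂ ≤ m) :
    P.NonrevisitingPath (fun x => P.FaceVertex T x ∧
      (x = w q₁ ∨ x = w q₂ ∨ P.Excursion T c d w θ q₁ q₂ x)) (w q₁) (w q₂) := by
  refine ⟨n, y, hp.zero, hp.last, fun i hi => ⟨hp.vertex hi, ?_⟩, fun i hi => hp.path.adj hi,
    fun i j l hij hjl hl => ?_⟩
  · rcases Nat.eq_zero_or_pos i with rfl | hi0
    · exact Or.inl hp.zero
    rcases hi.eq_or_lt with rfl | hi
    · exact Or.inr (Or.inl hp.last)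
    · exact Or.inr (Or.inr (hp.excursion hg h hq hi0 hi))
  · intro Z hZ
    rw [Finset.mem_inter] at hZ
    rcases hij.eq_or_lt with rfl | hij
    · exact hZ.1
    rcases hjl.eq_or_lt with rfl | hjl
    · exact hZ.2
    by_cases he : ∃ e, e < i ∨ l < e ∧ e ≤ n
    · obtain ⟨e, he⟩ := he
      exact hp.no_revisit hg hij hjl hl he hZ.1 hZ.2
    · obtain rfl : i = 0 := by
        by_contra hi
        exact he ⟨0, by omega⟩
      obtain rfl : l = n := by
        by_contra hl
        exact he ⟨n, by omega⟩
      by_cases hZT : Z ∈ T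
      · exact (hp.vertex (by omega)).2 hZT
      · rw [hp.zero, hp.last] at hZ
        rw [hp.unique Z hZT hZ.1 hZ.2]
        exact hp.tight_mem (by omega)

end Pocket

section Assembly

variable {c d : Dual ℝ V} {π : V} {m : ℕ} {w : ℕ → V} {θ : ℕ → ℝ} {A : Finset ℕ} {q₁ q₂ : ℕ}

/-- The part of the path between consecutive good positions can be replaced by a single edge or by a
pocket. -/
lemma exists_segment (hg : P.GenericPencil T c d π) (h : P.ParamPath T c d m w θ)
    (hA : GoodPositions (fun p => P.tight (w p) \ T) A) (hc : Consecutive A q₁ q₂) (hq : q₂ ≤ m) :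
    P.NonrevisitingPath (fun x => P.FaceVertex T x ∧
      (x = w q₁ ∨ x = w q₂ ∨ P.Excursion T c d w θ q₁ q₂ x)) (w q₁) (w q₂) := by
  have hlt := hc.2.2.1
  have h1 := h.vertex q₁ (by omega)
  have h2 := h.vertex q₂ hq
  by_cases hFG : ∃ F G, F ≠ G ∧ F ∈ P.tight (w q₁) \ T ∧ F ∈ P.tight (w q₂) \ T ∧
      G ∈ P.tight (w q₁) \ T ∧ G ∈ P.tight (w q₂) \ T
  · obtain ⟨F, G, hne, hF1, hF2, hG1, hG2⟩ := hFG
    rw [Finset.mem_sdiff] at hF1 hF2 hG1 hG2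
    refine .of_adj ⟨h1, Or.inl rfl⟩ ⟨h2, Or.inr (Or.inl rfl)⟩
      (h1.1.adj_of_subset h2.1 (h.ne hlt hq) (T := insert F (insert G T)) ?_ ?_ ?_)
    · rw [Finset.card_insert_of_notMem (by simp [hne, hF1.2]),
        Finset.card_insert_of_notMem hG1.2]
      have := hg.card
      omega
    all_goals simp only [Finset.insert_subset_iff]
    exacts [⟨hF1.1, hG1.1, h1.2⟩, ⟨hF2.1, hG2.1, h2.2⟩]
  · obtain ⟨G, hG1, hG2, hGr⟩ := (hA.jump q₁ q₂ hc).resolve_left hFG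
    have hG1' := Finset.mem_sdiff.1 hG1
    have hG2' := Finset.mem_sdiff.1 hG2
    have hsub : ∀ {x}, P.tight x \ insert G T ⊆ P.tight x \ T := fun {x} =>
      Finset.sdiff_subset_sdiff le_rfl (Finset.subset_insert _ _)
    obtain ⟨n, y, φ, hy, hy0, hφ0, hyn, hφn⟩ := exists_paramPath (P := P) (T := insert G T)
      (hg.gen.mono (Finset.subset_insert _ _)) ⟨h2.1, Finset.insert_subset hG2'.1 h2.2⟩
      (fun i hi => h.pos q₂ hq i (hsub hi)) ⟨h1.1, Finset.insert_subset hG1'.1 h1.2⟩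
      (θ q₁) (h.θ_le hlt.le hq) (fun i hi => h.pos q₁ (by omega) i (hsub hi))
    refine Pocket.nonrevisitingPath (G := G) hg h ⟨hy, hlt, hy0, hyn, hφ0.ge, hφn, hG1'.2,
      fun r hr1 hr2 hr => hGr r hr1 hr2 (Finset.mem_sdiff.2 ⟨hr, hG1'.2⟩),
      fun Z hZT hZ1 hZ2 => ?_⟩ hq
    by_contra hZG
    exact hFG ⟨Z, G, hZG, Finset.mem_sdiff.2 ⟨hZ1, hZT⟩, Finset.mem_sdiff.2 ⟨hZ2, hZT⟩, hG1, hG2⟩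

/-- After the end of an excursion its vertices are below the end of the excursion. -/
lemma Excursion.lt (h : P.ParamPath T c d m w θ) {q₁ q₂ : ℕ} (hq : q₂ ≤ m)
    (hx : P.FaceVertex T x) (he : P.Excursion T c d w θ q₁ q₂ x) {t : ℝ} (ht : θ q₂ < t) :
    pencil c d t x < pencil c d t (w q₂) := by
  obtain ⟨G, σ, -, hσ2, hσ, hκ, -⟩ := he
  have hle := h.apply_le hq hx.face
  rw [hσ] at hκ
  simp only [pencil_apply] at hκ hle ⊢
  have hd : d x < d (w q₂) := by
    by_contra! hd
    nlinarith
  nlinarith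

theorem exists_nonrevisitingPath (hT : T.card + 3 = finrank ℝ V) {u v : V}
    (hu : P.FaceVertex T u) (hv : P.FaceVertex T v) : P.NonrevisitingPath (P.FaceVertex T) u v := by
  obtain ⟨c, d, π, hg, hu0, hv1⟩ := exists_genericPencil hT hu hv
  obtain ⟨m, w, θ, h, rfl, -, rfl, -⟩ := exists_paramPath hg.gen hv hv1 hu 0 zero_le_one hu0
  obtain ⟨A, h0, hm, hAm, hA⟩ := hg.exists_goodPositions h
  suffices key : ∀ q ∈ A, P.NonrevisitingPath (fun x => P.FaceVertex T x ∧
      ((∃ a ∈ A, a ≤ q ∧ x = w a) ∨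
        ∃ q₁ q₂, Consecutive A q₁ q₂ ∧ q₂ ≤ q ∧ P.Excursion T c d w θ q₁ q₂ x)) (w 0) (w q) from
    (key m hm).mono fun x hx => hx.1
  intro q'
  induction q' using Nat.strong_induction_on with
  | _ q' ih =>
  intro hq'
  have hq'm := hAm q' hq'
  rcases Nat.eq_zero_or_pos q' with rfl | hpos
  · exact .refl ⟨hu, Or.inl ⟨0, h0, le_rfl, rfl⟩⟩
  obtain ⟨q, -, hc⟩ := exists_consecutive_left h0 hq' hpos
  have hqA := hc.1
  have hlt := hc.2.2.1
  have hmid : ∀ {a b e : ℕ} {Z : ι}, a ∈ A → b ∈ A → e ∈ A → a < b → b < e → Z ∈ P.tight (w a) →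
      Z ∈ P.tight (w e) → Z ∉ T → Z ∈ P.tight (w b) := by
    intro a b e Z ha hb he hab hbe hZa hZe hZT
    exact (Finset.mem_sdiff.1 (hA.nonrevisiting a ha b hb e he hab hbe Z
      (Finset.mem_sdiff.2 ⟨hZa, hZT⟩) (Finset.mem_sdiff.2 ⟨hZe, hZT⟩))).1
  refine ((ih q hlt hqA).trans (exists_segment hg h hA hc hq'm) ?_).mono ?_
  · rintro x y ⟨hxT, hx⟩ ⟨hyT, hy⟩ Z hZ
    rw [Finset.mem_inter] at hZ
    obtain ⟨hZx, hZy⟩ := hZ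
    by_cases hZT : Z ∈ T
    · exact (h.vertex q (by omega)).2 hZT
    rcases hy with rfl | rfl | ⟨G', σ', hσ1', hσ2', hσ', hκ', hG1', hG2', hreg'⟩
    · exact hZy
    · rcases hx with ⟨a, ha, haq, rfl⟩ | ⟨q₁, q₂, hc', hq₂, G, σ, hσ1, hσ2, hσ, hκ, hG1, hG2, hreg⟩
      · rcases haq.eq_or_lt with rfl | haq
        · exact hZx
        · exact hmid ha hqA hq' haq hlt hZx hZy hZT
      · by_cases hZG : Z = G
        · subst hZG
          rcases hq₂.eq_or_lt with rfl | hq₂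
          · exact hG2
          · exact hmid hc'.2.1 hqA hq' hq₂ hlt hG2 hZy hZT
        · have h1 := hreg Z hZx hZT hZG _ hyT hZy
          have h2 := h.lt_of_le_θ (show q₂ < q' by omega) hq'm hσ2.le
          linarith
    · by_cases hZG : Z = G'
      · rwa [hZG]
      have h1 := hreg' Z hZy hZT hZG _ hxT hZx
      rcases hx with ⟨a, ha, haq, rfl⟩ | ⟨q₁, q₂, hc', hq₂, he⟩
      · rcases haq.eq_or_lt with rfl | haq
        · exact hZx
        · exact absurd (h.lt_of_θ_le haq (by omega) hσ1'.le) h1.not_gt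
      · have h2 := he.lt h (by omega) hxT ((h.θ_le hq₂ (by omega)).trans_lt hσ1')
        rcases hq₂.eq_or_lt with rfl | hq₂
        · exact absurd h2 h1.not_gt
        · exact absurd (h2.trans (h.lt_of_θ_le hq₂ (by omega) hσ1'.le)) h1.not_gt
  · rintro x (⟨hxT, ⟨a, ha, haq, rfl⟩ | ⟨q₁, q₂, hc', hq₂, he⟩⟩ | ⟨hxT, rfl | rfl | he⟩)
    · exact ⟨hxT, Or.inl ⟨a, ha, by omega, rfl⟩⟩
    · exact ⟨hxT, Or.inr ⟨q₁, q₂, hc', by omega, he⟩⟩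
    · exact ⟨hxT, Or.inl ⟨q, hqA, hlt.le, rfl⟩⟩
    · exact ⟨hxT, Or.inl ⟨q', hq', le_rfl, rfl⟩⟩
    · exact ⟨hxT, Or.inr ⟨q, q', hc, le_rfl, he⟩⟩

end Assembly

lemma exists_last_eq {f : ℕ → ℕ} {i₀ m s : ℕ} (hf : ∀ i < m, f (i + 1) ≤ f i + 1) (hi : i₀ ≤ m)
    (h0 : f i₀ ≤ s) (hs : s ≤ f m) :
    ∃ j, i₀ ≤ j ∧ j ≤ m ∧ f j = s ∧ ∀ i, j < i → i ≤ m → s < f i := by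
  set j := Nat.findGreatest (fun j => f j ≤ s) m
  have hj : f j ≤ s := Nat.findGreatest_spec (P := fun j => f j ≤ s) hi h0
  have hlast : ∀ i, j < i → i ≤ m → s < f i := fun i hji him =>
    not_le.1 (Nat.findGreatest_is_greatest (P := fun j => f j ≤ s) hji him)
  have hjm : j ≤ m := Nat.findGreatest_le m
  refine ⟨j, Nat.le_findGreatest hi h0, hjm, le_antisymm hj ?_, hlast⟩
  rcases hjm.eq_or_lt with h | h
  · rwa [h]
  · have h1 := hlast (j + 1) (Nat.lt_succ_self j) h
    have h2 := hf j h
    omega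

section Layers

variable {lam : V → ℕ} {p q s : ℕ} {u v : V}

open Classical in
variable (P) in
/-- The constraints outside `T` that are tight at some vertex of the face whose label is between `p`
and `q`. -/
def active (T : Finset ι) (lam : V → ℕ) (p q : ℕ) : Finset ι :=
  Finset.univ.filter fun i => i ∉ T ∧ ∃ x, P.FaceVertex T x ∧ i ∈ P.tight x ∧ p ≤ lam x ∧ lam x ≤ q

lemma mem_active : i ∈ P.active T lam p q ↔
    i ∉ T ∧ ∃ x, P.FaceVertex T x ∧ i ∈ P.tight x ∧ p ≤ lam x ∧ lam x ≤ q := by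
  simp [active]

lemma active_subset {p' q' : ℕ} (hp : p' ≤ p) (hq : q ≤ q') :
    P.active T lam p q ⊆ P.active T lam p' q' := by
  intro i hi
  rw [mem_active] at hi ⊢
  obtain ⟨hT, x, hx, hix, h1, h2⟩ := hi
  exact ⟨hT, x, hx, hix, hp.trans h1, h2.trans hq⟩

lemma active_insert_subset : P.active (insert i T) lam p q ⊆ P.active T lam p q := by
  intro j hj
  rw [mem_active] at hj ⊢
  obtain ⟨hT, x, hx, hjx, h⟩ := hj
  exact ⟨fun h => hT (Finset.mem_insert_of_mem h), x, hx.mono (Finset.subset_insert _ _), hjx, h⟩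

/-- Every intermediate label occurs in a face. -/
lemma exists_layer (hlam : ∀ x y, P.Adj x y → lam y ≤ lam x + 1) (hu : P.FaceVertex T u)
    (hv : P.FaceVertex T v) (hs : lam u ≤ s) (hs' : s ≤ lam v) :
    ∃ z, P.FaceVertex T z ∧ lam z = s := by
  have hconn := face_connected hu hv
  induction hconn with
  | refl => exact ⟨u, hu, le_antisymm hs hs'⟩
  | @tail b c _ hbc ih =>
    rcases le_or_gt s (lam b) with h | h
    · exact ih hbc.1 h
    · have := hlam b c hbc.2.2
      exact ⟨c, hbc.2.1, by omega⟩

/-- The labels of the vertices on a facet of a face form an interval. -/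
lemma mem_active_of_mem_of_mem {p' q' : ℕ} (hlam : ∀ x y, P.Adj x y → lam y ≤ lam x + 1)
    (hqs : q ≤ s) (hsp : s ≤ p') (h : i ∈ P.active T lam p q) (h' : i ∈ P.active T lam p' q') :
    i ∈ P.active T lam s s := by
  rw [mem_active] at h h' ⊢
  obtain ⟨hT, x, hx, hix, -, h2⟩ := h
  obtain ⟨-, y, hy, hiy, h1, -⟩ := h'
  obtain ⟨z, hz, rfl⟩ := exists_layer (T := insert i T) (s := s) hlam
    ⟨hx.1, Finset.insert_subset hix hx.2⟩ ⟨hy.1, Finset.insert_subset hiy hy.2⟩ (by omega)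
    (by omega)
  exact ⟨hT, z, hz.mono (Finset.subset_insert _ _), hz.2 (Finset.mem_insert_self _ _), le_rfl,
    le_rfl⟩

/-- Along a nonrevisiting path, every step to a new label enters a new facet. -/
lemma NonrevisitingPath.le_card_active (hlam : ∀ x y, P.Adj x y → lam y ≤ lam x + 1)
    (hT : T.card < finrank ℝ V) (h : P.NonrevisitingPath (P.FaceVertex T) u v)
    (huv : lam u ≤ lam v) : lam v - lam u + 1 ≤ (P.active T lam (lam u) (lam v)).card := by
  obtain ⟨m, f, rfl, rfl, hfT, hadj, hf⟩ := h
  have hstep : ∀ i < m, lam (f (i + 1)) ≤ lam (f i) + 1 := fun i hi => hlam _ _ (hadj i hi)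
  have key : ∀ s, lam (f 0) ≤ s → s ≤ lam (f m) → ∃ j ≤ m, lam (f j) = s ∧
      (∀ i, j < i → i ≤ m → s < lam (f i)) ∧ ∃ B : Finset ι, B.card = s - lam (f 0) + 1 ∧
        ∀ Z ∈ B, Z ∉ T ∧ ∃ i ≤ j, Z ∈ P.tight (f i) ∧ lam (f 0) ≤ lam (f i) ∧ lam (f i) ≤ s := by
    intro s hs
    induction s, hs using Nat.le_induction with
    | base =>
      intro hs
      obtain ⟨j, -, hj, hjs, hlast⟩ := exists_last_eq (f := fun i => lam (f i)) hstep
        (Nat.zero_le m) le_rfl hs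
      have hcard := (hfT j hj).card_sdiff
      obtain ⟨Z, hZ⟩ : (P.tight (f j) \ T).Nonempty := by
        rw [← Finset.card_pos]; omega
      rw [Finset.mem_sdiff] at hZ
      refine ⟨j, hj, hjs, hlast, {Z}, by simp, fun Z' hZ' => ?_⟩
      rw [Finset.mem_singleton.1 hZ']
      exact ⟨hZ.2, j, le_rfl, hZ.1, hjs.ge, hjs.le⟩
    | succ s hs ih =>
      intro hsm
      obtain ⟨j, hj, hjs, hlast, B, hBcard, hB⟩ := ih (by omega)
      have hjm : j < m := by
        refine lt_of_le_of_ne hj ?_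
        rintro rfl
        omega
      have h1 := hlast (j + 1) (Nat.lt_succ_self j) hjm
      have h2 := hstep j hjm
      obtain ⟨j', hjj', hj', hjs', hlast'⟩ := exists_last_eq (f := fun i => lam (f i)) (s := s + 1)
        hstep (i₀ := j + 1) hjm (by omega) hsm
      obtain ⟨N, hN1, hN⟩ : ∃ N ∈ P.tight (f (j + 1)), N ∉ P.tight (f j) := by
        by_contra! hcon
        have h3 := (hfT (j + 1) hjm).1.eq_of_tight hcon
        rw [← h3] at h1
        omega
      refine ⟨j', hj', hjs', hlast', insert N B, ?_, fun Z hZ => ?_⟩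
      · rw [Finset.card_insert_of_notMem, hBcard]
        · omega
        · intro hNB
          obtain ⟨-, i, hi, hNi, -⟩ := hB N hNB
          exact hN (hf i j (j + 1) hi (Nat.le_succ j) hjm (Finset.mem_inter.2 ⟨hNi, hN1⟩))
      · rcases Finset.mem_insert.1 hZ with rfl | hZ
        · exact ⟨fun hZT => hN ((hfT j hj).2 hZT), j + 1, hjj', hN1, by omega, by omega⟩
        · obtain ⟨hZT, i, hi, hZi, h3, h4⟩ := hB Z hZ
          exact ⟨hZT, i, by omega, hZi, h3, by omega⟩
  obtain ⟨j, hj, -, -, B, hBcard, hB⟩ := key _ huv le_rfl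
  rw [← hBcard]
  refine Finset.card_le_card fun Z hZ => ?_
  obtain ⟨hZT, i, hi, hZi, h⟩ := hB Z hZ
  exact mem_active.2 ⟨hZT, f i, hfT i (by omega), hZi, h⟩

/-- Larman's recursion: the number of labels in a face in terms of the number of active facets. -/
theorem le_card_active (hlam : ∀ x y, P.Adj x y → lam y ≤ lam x + 1) (k : ℕ) :
    ∀ {T : Finset ι}, T.card + (k + 3) = finrank ℝ V → ∀ {u v : V}, P.FaceVertex T u →
      P.FaceVertex T v → lam u ≤ lam v →
        lam v - lam u + 1 ≤ 2 ^ k * (P.active T lam (lam u) (lam v)).card := by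
  induction k with
  | zero =>
    intro T hT u v hu hv huv
    rw [pow_zero, one_mul]
    exact (exists_nonrevisitingPath hT hu hv).le_card_active hlam (by omega) huv
  | succ k ih =>
    intro T hT
    suffices key : ∀ n u v, P.FaceVertex T u → P.FaceVertex T v → lam u ≤ lam v →
        lam v - lam u = n →
        lam v - lam u + 1 + 2 ^ k * (P.active T lam (lam u) (lam u)).card ≤
          2 ^ k * (2 * (P.active T lam (lam u) (lam v)).card) by
      intro u v hu hv huv
      rw [pow_succ, mul_assoc]
      exact (Nat.le_add_right _ _).trans (key _ u v hu hv huv rfl)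
    intro n
    induction n using Nat.strong_induction_on with
    | _ n ihn =>
    intro u v hu hv huv hn
    -- a facet that meets the first layer and reaches as far as possible
    let R : ℕ → Prop := fun h => lam u ≤ h ∧
      ∃ i ∈ P.active T lam (lam u) (lam u), i ∈ P.active T lam h h
    have hRu : R (lam u) := by
      obtain ⟨i, hi⟩ : (P.tight u \ T).Nonempty := by
        rw [← Finset.card_pos]
        have := hu.card_sdiff
        omega
      rw [Finset.mem_sdiff] at hi
      have : i ∈ P.active T lam (lam u) (lam u) := mem_active.2 ⟨hi.2, u, hu, hi.1, le_rfl, le_rfl⟩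
      exact ⟨le_rfl, i, this, this⟩
    classical
    set h := Nat.findGreatest R (lam v)
    obtain ⟨huh, i, hiu, hih⟩ : R h := Nat.findGreatest_spec huv hRu
    have hhv : h ≤ lam v := Nat.findGreatest_le _
    have hmax : ∀ h', h < h' → h' ≤ lam v → ¬ R h' := fun h' h1 h2 =>
      Nat.findGreatest_is_greatest h1 h2
    clear_value h
    have hblock : h - lam u + 1 ≤ 2 ^ k * (P.active T lam (lam u) h).card := by
      obtain ⟨hiT, x, hx, hix, hx1, hx2⟩ := mem_active.1 hiu
      obtain ⟨-, y, hy, hiy, hy1, hy2⟩ := mem_active.1 hih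
      have h1 := ih (T := insert i T) (by rw [Finset.card_insert_of_notMem hiT]; omega)
        (u := x) (v := y) ⟨hx.1, Finset.insert_subset hix hx.2⟩
        ⟨hy.1, Finset.insert_subset hiy hy.2⟩ (by omega)
      rw [le_antisymm hx2 hx1, le_antisymm hy2 hy1] at h1
      exact h1.trans (Nat.mul_le_mul_left _ (Finset.card_le_card active_insert_subset))
    rcases hhv.eq_or_lt with rfl | hhv
    · have h2 := Nat.mul_le_mul_left (2 ^ k)
        (Finset.card_le_card (active_subset (P := P) (T := T) (lam := lam)
          (p := lam u) le_rfl huv))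
      linarith
    obtain ⟨z, hz, hzh⟩ := exists_layer (s := h + 1) hlam hu hv (by omega) hhv
    have hrest := ihn (lam v - lam z) (by omega) z v hz hv (by omega) rfl
    rw [hzh] at hrest
    set X := P.active T lam (lam u) h
    set Y := P.active T lam (h + 1) (lam v)
    have hXY : X ∩ Y ⊆ P.active T lam (h + 1) (h + 1) := fun j hj =>
      mem_active_of_mem_of_mem hlam (Nat.le_succ h) le_rfl (Finset.mem_inter.1 hj).1
        (Finset.mem_inter.1 hj).2
    have hU : P.active T lam (lam u) (lam u) ⊆ X \ Y := by
      intro j hj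
      refine Finset.mem_sdiff.2 ⟨active_subset le_rfl huh hj, fun hjY => ?_⟩
      obtain ⟨hjT, x, hx, hjx, hx1, hx2⟩ := mem_active.1 hjY
      exact hmax (lam x) hx1 hx2 ⟨by omega, j, hj, mem_active.2 ⟨hjT, x, hx, hjx, le_rfl, le_rfl⟩⟩
    have hunion : X ∪ Y ⊆ P.active T lam (lam u) (lam v) :=
      Finset.union_subset (active_subset le_rfl hhv.le) (active_subset (by omega) le_rfl)
    have e1 := Finset.card_le_card hXY
    have e2 := Finset.card_le_card hU
    have e3 := Finset.card_le_card hunion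
    have e4 := Finset.card_union_add_card_inter X Y
    have e5 := Finset.card_sdiff_add_card_inter X Y
    have e6 : X.card + 2 * Y.card + (P.active T lam (lam u) (lam u)).card ≤
        2 * (P.active T lam (lam u) (lam v)).card + (P.active T lam (h + 1) (h + 1)).card := by
      omega
    have e7 := Nat.mul_le_mul_left (2 ^ k) e6
    have e8 : lam v - lam u + 1 = (h - lam u + 1) + (lam v - (h + 1) + 1) := by omega
    rw [e8]
    linarith

end Layers

lemma Adj.ne (h : P.Adj x y) : x ≠ y := by
  rintro rfl
  have := h.2.2
  rw [Finset.inter_self, h.1.2] at this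
  omega

theorem exists_walk (hd : 3 ≤ finrank ℝ V) {u v : V} (hu : P.IsVertex u) (hv : P.IsVertex v) :
    ∃ L ≤ Fintype.card ι * 2 ^ (finrank ℝ V - 3), ∃ f : ℕ → V, f 0 = u ∧ f L = v ∧
      ∀ i < L, P.Adj (f i) (f (i + 1)) := by
  let G : SimpleGraph V := ⟨P.Adj, ⟨fun _ _ h => h.symm⟩, ⟨fun _ h => h.ne rfl⟩⟩
  have hu' : P.FaceVertex ∅ u := ⟨hu, Finset.empty_subset _⟩
  have hv' : P.FaceVertex ∅ v := ⟨hv, Finset.empty_subset _⟩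
  have hreach : G.Reachable u v := by
    rw [SimpleGraph.reachable_iff_reflTransGen]
    exact Relation.ReflTransGen.mono (fun _ _ h => h.2.2) _ _ (face_connected hu' hv')
  obtain ⟨p, hp⟩ := hreach.exists_walk_length_eq_dist
  have hlam : ∀ x y, P.Adj x y → G.dist u y ≤ G.dist u x + 1 := fun x y hxy => by
    have := SimpleGraph.Adj.diff_dist_adj (G := G) (u := u) (v := x) (w := y) hxy
    omega
  refine ⟨G.dist u v, ?_, p.getVert, p.getVert_zero, ?_, fun i hi => p.adj_getVert_succ (by omega)⟩
  · have h1 := le_card_active hlam (finrank ℝ V - 3) (T := ∅) (by simp; omega) hu' hv' (by simp)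
    have h2 := Nat.mul_le_mul_left (2 ^ (finrank ℝ V - 3)) (Finset.card_le_univ
      (P.active ∅ (G.dist u) (G.dist u u) (G.dist u v)))
    rw [SimpleGraph.dist_self] at h1 h2
    rw [mul_comm]
    omega
  · rw [← hp, p.getVert_length]

lemma exists_vertex_le (hspan : ∀ z, (∀ i, P.a i z = 0) → z = 0) {c : Dual ℝ V} {M : ℝ}
    (hM : ∀ x, P.Feasible x → c x ≤ M) (hx : P.Feasible x) : ∃ y, P.IsVertex y ∧ c x ≤ c y := by
  induction h : finrank ℝ V - (P.tight x).card using Nat.strong_induction_on generalizing x with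
  | _ m ih =>
  obtain hc | hc := (P.card_tight_le hx).eq_or_lt
  · exact ⟨x, ⟨hx, hc⟩, le_rfl⟩
  have key : ∃ z, (∀ i ∈ P.tight x, P.a i z = 0) ∧ 0 ≤ c z ∧ ∃ i, 0 < P.a i z := by
    let Φ : V →ₗ[ℝ] (P.tight x → ℝ) := LinearMap.pi fun i => P.a i
    obtain ⟨z, hz, hz0⟩ := (Submodule.ne_bot_iff _).1
      (LinearMap.ker_ne_bot_of_finrank_lt (f := Φ) (by
        rwa [finrank_fintype_fun_eq_card, Fintype.card_coe]))
    have hz' : ∀ i ∈ P.tight x, P.a i z = 0 := fun i hi => congrFun (LinearMap.mem_ker.1 hz) ⟨i, hi⟩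
    obtain ⟨i, hi⟩ : ∃ i, P.a i z ≠ 0 := by
      by_contra! h; exact hz0 (hspan z h)
    have unb : ∀ w, (∀ i ∈ P.tight x, P.a i w = 0) → 0 < c w → ∃ i, 0 < P.a i w := by
      intro w hw hcw
      by_contra! hn
      have hf := hM (x + ((M - c x + 1) / c w) • w) fun j => by
        have h0 : 0 ≤ (M - c x + 1) / c w := div_nonneg (by linarith [hM x hx]) hcw.le
        have := mul_nonpos_of_nonneg_of_nonpos h0 (hn j)
        simpa using by linarith [hx j]
      simp [hcw.ne'] at hf
      linarith
    obtain hcz | hcz | hcz := lt_trichotomy (c z) 0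
    · exact ⟨-z, by simpa using hz', by simpa using hcz.le,
        unb (-z) (by simpa using hz') (by simpa using hcz)⟩
    · obtain hi | hi := hi.lt_or_gt
      · exact ⟨-z, by simpa using hz', by simp [hcz], i, by simpa using hi⟩
      · exact ⟨z, hz', hcz.ge, i, hi⟩
    · exact ⟨z, hz', hcz.le, unb z hz' hcz⟩
  obtain ⟨z, hz, hcz, i, hi⟩ := key
  obtain ⟨j, hj, hmin⟩ := (Finset.univ.filter fun i => 0 < P.a i z).exists_min_image
    (fun i => (P.b i - P.a i x) / P.a i z) ⟨i, by simpa using hi⟩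
  replace hj : 0 < P.a j z := by simpa using hj
  set t := (P.b j - P.a j x) / P.a j z with ht
  have ht0 : 0 ≤ t := div_nonneg (by linarith [hx j]) hj.le
  have hfeas : P.Feasible (x + t • z) := fun k => by
    rw [map_add, map_smul, smul_eq_mul]
    by_cases hk : 0 < P.a k z
    · have := hmin k (by simpa using hk)
      rw [le_div_iff₀ hk] at this
      linarith
    · nlinarith [hx k]
  have hsub : insert j (P.tight x) ⊆ P.tight (x + t • z) := by
    rw [Finset.insert_subset_iff]
    refine ⟨?_, fun k hk => ?_⟩
    · rw [mem_tight, map_add, map_smul, smul_eq_mul, ht, div_mul_cancel₀ _ hj.ne']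
      ring
    · rw [mem_tight, map_add, map_smul, hz k hk, smul_zero, add_zero, mem_tight.1 hk]
  have hlt := Finset.card_le_card hsub
  rw [Finset.card_insert_of_notMem fun h => hj.ne' (hz j h)] at hlt
  obtain ⟨y, hy, hle⟩ := ih _ (by omega) hfeas rfl
  refine ⟨y, hy, le_trans ?_ hle⟩
  rw [map_add, map_smul, smul_eq_mul]
  linarith [mul_nonneg ht0 hcz]

end SimpleSystem

section Polyhedron

open Module Filter Topology

variable {V ι : Type*} [AddCommGroup V] [Module ℝ V]

lemma eq_of_mem_openSegment_of_le {c : Dual ℝ V} {β : ℝ} {x p q : V} (hp : c p ≤ β) (hq : c q ≤ β)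
    (hx : x ∈ openSegment ℝ p q) (h : c x = β) : c p = β := by
  obtain ⟨s, t, hs, ht, hst, rfl⟩ := hx
  simp only [map_add, map_smul, smul_eq_mul] at h
  obtain rfl : t = 1 - s := by linarith
  nlinarith

variable [Finite ι] {a : ι → Dual ℝ V} {b : ι → ℝ} {x y : V}

lemma mem_extremePoints_polyhedron_iff :
    x ∈ Set.extremePoints ℝ {x | ∀ i, a i x ≤ b i} ↔
      (∀ i, a i x ≤ b i) ∧ ∀ z, (∀ i, a i x = b i → a i z = 0) → z = 0 := by
  refine ⟨fun h => ⟨h.1, fun z hz => ?_⟩, fun h => ⟨h.1, fun p hp q hq hx => ?_⟩⟩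
  · have hev : ∀ w, (∀ i, a i x = b i → a i w = 0) →
        ∀ᶠ t : ℝ in 𝓝[>] 0, ∀ i, a i (x + t • w) ≤ b i := by
      refine fun w hw => eventually_all.2 fun i => ?_
      obtain hi | hi := (h.1 i).eq_or_lt
      · exact Eventually.of_forall fun t => by simp [hw i hi, hi]
      · have hcont : Continuous fun t : ℝ => a i (x + t • w) := by
          simp only [map_add, map_smul, smul_eq_mul]; fun_prop
        have := hcont.tendsto 0
        simp only [zero_smul, add_zero] at this
        exact ((this.eventually_lt_const hi).filter_mono nhdsWithin_le_nhds).mono fun _ => le_of_lt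
    obtain ⟨t, ⟨h1, h2⟩, ht⟩ := (((hev z hz).and (hev (-z) (by simpa using hz))).and
      self_mem_nhdsWithin).exists
    have := h.2 h1 h2 ⟨1 / 2, 1 / 2, by norm_num, by norm_num, by norm_num, by module⟩
    simpa [(show 0 < t from ht).ne'] using this
  · exact sub_eq_zero.1 <| h.2 _ fun i hi => by
      rw [map_sub, eq_of_mem_openSegment_of_le (hp i) (hq i) hx hi, hi, sub_self]

lemma polyAdj_polyhedron {S : Finset ι} (hxy : x ≠ y)
    (hx : x ∈ Set.extremePoints ℝ {x | ∀ i, a i x ≤ b i})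
    (hy : y ∈ Set.extremePoints ℝ {x | ∀ i, a i x ≤ b i})
    (hSx : ∀ i ∈ S, a i x = b i) (hSy : ∀ i ∈ S, a i y = b i)
    (hS : ∀ z, (∀ i ∈ S, a i z = 0) → ∃ t : ℝ, z = t • (y - x)) :
    PolyAdj {x | ∀ i, a i x ≤ b i} x y := by
  refine ⟨hxy, hx, hy, ?_, ?_⟩
  · rintro _ ⟨s, t, hs, ht, hst, rfl⟩ i
    simp only [map_add, map_smul, smul_eq_mul]
    calc s * a i x + t * a i y ≤ s * b i + t * b i := by
          gcongr
          exacts [hx.1 i, hy.1 i]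
      _ = b i := by rw [← add_mul, hst, one_mul]
  · rintro p hp q hq w ⟨s, t, hs, ht, hst, rfl⟩ hw
    obtain ⟨r, hr⟩ := hS (p - x) fun i hi => by
      rw [map_sub, hSx i hi, eq_of_mem_openSegment_of_le (hp i) (hq i) hw, sub_self]
      simp [hSx i hi, hSy i hi, ← add_mul, hst]
    obtain rfl : p = x + r • (y - x) := by rw [← hr]; abel
    have hr0 : 0 ≤ r := by
      by_contra! h
      refine hxy (hx.2 hy.1 hp ⟨-r / (1 - r), 1 / (1 - r), ?_, ?_, ?_, ?_⟩).symm
      · exact div_pos (by linarith) (by linarith)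
      · exact div_pos one_pos (by linarith)
      · rw [← add_div, neg_add_eq_sub, div_self (by linarith)]
      · have : 1 - r ≠ 0 := by linarith
        match_scalars <;> field_simp <;> ring
    have hr1 : r ≤ 1 := by
      by_contra! h
      refine hxy (hy.2 hx.1 hp ⟨(r - 1) / r, 1 / r, ?_, ?_, ?_, ?_⟩)
      · exact div_pos (by linarith) (by linarith)
      · exact div_pos one_pos (by linarith)
      · rw [← add_div, sub_add_cancel, div_self (by linarith)]
      · have : r ≠ 0 := by linarith
        match_scalars <;> field_simp
        ring
    exact ⟨1 - r, r, by linarith, hr0, by ring, by module⟩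

lemma HasPathOfLength.snoc {P : Set V} {u : V} {L : ℕ} (h : HasPathOfLength P u x L)
    (hxy : PolyAdj P x y) : HasPathOfLength P u y (L + 1) := by
  obtain ⟨f, rfl, rfl, hf⟩ := h
  refine ⟨fun i => if i ≤ L then f i else y, by simp, by simp, fun i hi => ?_⟩
  obtain hi | rfl := (Nat.lt_succ_iff.1 hi).lt_or_eq
  · simpa [hi.le, Nat.succ_le_iff, hi] using hf i hi
  · simpa using hxy

lemma exists_hasPathOfLength_le {P : Set V} {X : ℕ → V} {L : ℕ}
    (h : ∀ i < L, X i ≠ X (i + 1) → PolyAdj P (X i) (X (i + 1))) :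
    ∃ K ≤ L, HasPathOfLength P (X 0) (X L) K := by
  induction L with
  | zero => exact ⟨0, le_rfl, X, rfl, rfl, by simp⟩
  | succ L ih =>
    obtain ⟨K, hK, hp⟩ := ih fun i hi => h i (by omega)
    by_cases he : X L = X (L + 1)
    · exact ⟨K, by omega, he ▸ hp⟩
    · exact ⟨K + 1, by omega, hp.snoc (h L (by omega) he)⟩

/-- A polyhedron that is a limit of simple systems with the same normals inherits the bound on the
length of paths. -/
theorem SimpleSystem.exists_hasPathOfLength_of_tendsto [FiniteDimensional ℝ V] [Fintype ι]
    [DecidableEq ι] (hd : 3 ≤ finrank ℝ V) {P : ℕ → SimpleSystem V ι} (ha : ∀ k, (P k).a = a)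
    (hb : ∀ i, Tendsto (fun k => (P k).b i) atTop (𝓝 (b i))) (hle : ∀ k i, b i ≤ (P k).b i)
    (hx : x ∈ Set.extremePoints ℝ {x | ∀ i, a i x ≤ b i})
    (hy : y ∈ Set.extremePoints ℝ {x | ∀ i, a i x ≤ b i}) :
    ∃ L ≤ Fintype.card ι * 2 ^ (finrank ℝ V - 3),
      HasPathOfLength {x | ∀ i, a i x ≤ b i} x y L := by
  classical
  set N := Fintype.card ι * 2 ^ (finrank ℝ V - 3)
  let c : V → Dual ℝ V := fun w => ∑ i with a i w = b i, a i
  have hc : ∀ w ∈ Set.extremePoints ℝ {x | ∀ i, a i x ≤ b i}, ∀ k,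
      ∃ z, (P k).IsVertex z ∧ c w w ≤ c w z := fun w hw k =>
    SimpleSystem.exists_vertex_le
      (fun z hz => (mem_extremePoints_polyhedron_iff.1 hw).2 z fun i _ => ha k ▸ hz i)
      (M := ∑ i with a i w = b i, (P k).b i)
      (fun z hz => by
        simp only [c, LinearMap.coe_sum, Finset.sum_apply]
        exact Finset.sum_le_sum fun i _ => ha k ▸ hz i)
      (fun i => by rw [ha]; exact (hw.1 i).trans (hle k i))
  choose p hp hpx using hc x hx
  choose q hq hqy using hc y hy
  choose L hL f hf0 hfL hf using fun k => (P k).exists_walk hd (hp k) (hq k)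
  obtain ⟨⟨m, S⟩, hfreq⟩ : ∃ s : Fin (N + 1) × (Fin (N + 1) → Finset ι), ∃ᶠ k in atTop,
      ((⟨L k, Nat.lt_succ_of_le (hL k)⟩, fun i => (P k).tight (f k i)) :
        Fin (N + 1) × (Fin (N + 1) → Finset ι)) = s := by
    by_contra! h
    obtain ⟨k, hk⟩ := (eventually_all.2 h).exists
    exact hk _ rfl
  obtain ⟨φ, hφ, hφs⟩ := extraction_of_frequently_atTop hfreq
  simp only [Prod.mk.injEq, Fin.ext_iff, funext_iff, Fin.forall_iff] at hφs
  have hm : (m : ℕ) ≤ N := Nat.lt_succ_iff.1 m.2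
  have hv : ∀ k, ∀ i ≤ (m : ℕ), (P (φ k)).IsVertex (f (φ k) i) := fun k i hi => by
    obtain hi | rfl := hi.lt_or_eq
    · exact (hf (φ k) i (by rw [(hφs k).1]; exact hi)).1
    · rw [← (hφs k).1, hfL]; exact hq _
  have hS : ∀ k, ∀ i (hi : i ≤ (m : ℕ)), (P (φ k)).tight (f (φ k) i) = S ⟨i, by omega⟩ :=
    fun k i hi => (hφs k).2 i _
  let T : ℕ → Finset ι := fun i => (P (φ 0)).tight (f (φ 0) i)
  have hT : ∀ k, ∀ i ≤ (m : ℕ), (P (φ k)).tight (f (φ k) i) = T i := fun k i hi => by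
    rw [hS k i hi, ← hS 0 i hi]
  let e : ℕ → ι → V := fun i => (P (φ 0)).dir (f (φ 0) i)
  have he : ∀ i ≤ (m : ℕ), ∀ z, ∑ j ∈ T i, a j z • e i j = z := fun i hi z => by
    have := (hv 0 i hi).sum_dir z
    rwa [ha] at this
  let X : ℕ → V := fun i => ∑ j ∈ T i, b j • e i j
  have hbφ : ∀ i, Tendsto (fun k => (P (φ k)).b i) atTop (𝓝 (b i)) := fun i =>
    (hb i).comp hφ.tendsto_atTop
  have hlim : ∀ i ≤ (m : ℕ), ∀ c : Dual ℝ V,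
      Tendsto (fun k => c (f (φ k) i)) atTop (𝓝 (c (X i))) := fun i hi c => by
    have h1 : ∀ k, c (f (φ k) i) = ∑ j ∈ T i, (P (φ k)).b j * c (e i j) := fun k => by
      conv_lhs => rw [← he i hi (f (φ k) i)]
      rw [map_sum]
      refine Finset.sum_congr rfl fun j hj => ?_
      rw [← hT k i hi, SimpleSystem.mem_tight, ha] at hj
      rw [map_smul, smul_eq_mul, hj]
    simp only [h1, X, map_sum, map_smul, smul_eq_mul]
    exact tendsto_finsetSum _ fun j _ => (hbφ j).mul_const _
  have hXle : ∀ i ≤ (m : ℕ), ∀ j, a j (X i) ≤ b j := fun i hi j =>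
    le_of_tendsto_of_tendsto' (hlim i hi (a j)) (hbφ j) fun k => by
      rw [← ha (φ k)]; exact (hv k i hi).1 j
  have hXT : ∀ i ≤ (m : ℕ), ∀ j ∈ T i, a j (X i) = b j := fun i hi j hj =>
    tendsto_nhds_unique (hlim i hi (a j)) <| (hbφ j).congr fun k => by
      rw [← hT k i hi, SimpleSystem.mem_tight, ha] at hj
      exact hj.symm
  have hXext : ∀ i ≤ (m : ℕ), X i ∈ Set.extremePoints ℝ {x | ∀ i, a i x ≤ b i} := fun i hi =>
    mem_extremePoints_polyhedron_iff.2 ⟨hXle i hi, fun z hz => by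
      rw [← he i hi z]
      exact Finset.sum_eq_zero fun j hj => by rw [hz j (hXT i hi j hj), zero_smul]⟩
  have hend : ∀ w ∈ Set.extremePoints ℝ {x | ∀ i, a i x ≤ b i}, ∀ i ≤ (m : ℕ),
      (∀ k, c w w ≤ c w (f (φ k) i)) → X i = w := fun w hw i hi hk => by
    have h1 : c w w ≤ c w (X i) := ge_of_tendsto' (hlim i hi (c w)) hk
    have h2 : ∀ j ∈ Finset.univ.filter fun j => a j w = b j, a j (X i) ≤ a j w := fun j hj => by
      rw [(Finset.mem_filter.1 hj).2]; exact hXle i hi j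
    simp only [c, LinearMap.coe_sum, Finset.sum_apply] at h1
    have h3 := (Finset.sum_eq_sum_iff_of_le h2).1 ((Finset.sum_le_sum h2).antisymm h1)
    exact sub_eq_zero.1 <| (mem_extremePoints_polyhedron_iff.1 hw).2 _ fun j hj => by
      rw [map_sub, h3 j (by simpa using hj), sub_self]
  have hX0 : X 0 = x := hend x hx 0 (Nat.zero_le _) fun k => by rw [hf0]; exact hpx _
  have hXm : X m = y := hend y hy m le_rfl fun k => by rw [← (hφs k).1, hfL]; exact hqy _
  have hadj : ∀ i < (m : ℕ), X i ≠ X (i + 1) →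
      PolyAdj {x | ∀ i, a i x ≤ b i} (X i) (X (i + 1)) := fun i hi hne => by
    refine polyAdj_polyhedron (S := T i ∩ T (i + 1)) hne (hXext i hi.le) (hXext (i + 1) hi)
      (fun j hj => hXT i hi.le j (Finset.mem_inter.1 hj).1)
      (fun j hj => hXT (i + 1) hi j (Finset.mem_inter.1 hj).2) fun z hz => ?_
    have h1 : (T i ∩ T (i + 1)).card + 1 = finrank ℝ V :=
      (hf (φ 0) i (by rw [(hφs 0).1]; exact hi)).2.2
    have h2 : (T i).card = finrank ℝ V := (hv 0 i hi.le).2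
    obtain ⟨j, hj, hTj⟩ : ∃ j ∉ T i ∩ T (i + 1), insert j (T i ∩ T (i + 1)) = T i :=
      Finset.exists_eq_insert_iff.2 ⟨Finset.inter_subset_left, h1.trans h2.symm⟩
    have h3 : ∀ z, (∀ l ∈ T i ∩ T (i + 1), a l z = 0) → z = a j z • e i j := fun z hz => by
      conv_lhs => rw [← he i hi.le z, ← hTj, Finset.sum_insert hj]
      rw [Finset.sum_eq_zero fun l hl => by rw [hz l hl, zero_smul], add_zero]
    have h4 := h3 (X (i + 1) - X i) fun l hl => by
      rw [map_sub, hXT i hi.le l (Finset.mem_inter.1 hl).1,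
        hXT (i + 1) hi l (Finset.mem_inter.1 hl).2, sub_self]
    have h5 : a j (X (i + 1) - X i) ≠ 0 := fun h => by
      rw [h, zero_smul, sub_eq_zero] at h4
      exact hne h4.symm
    refine ⟨a j z / a j (X (i + 1) - X i), ?_⟩
    conv_lhs => rw [h3 z hz, ← div_mul_cancel₀ (a j z) h5, mul_smul, ← h4]
  obtain ⟨K, hK, hpath⟩ := exists_hasPathOfLength_le hadj
  exact ⟨K, hK.trans hm, hX0 ▸ hXm ▸ hpath⟩

/-- Arbitrarily small perturbations of the right-hand sides turn any system of inequalities into a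
simple one. -/
lemma SimpleSystem.exists_tendsto [FiniteDimensional ℝ V] {n : ℕ} (a : Fin n → Dual ℝ V)
    (b : Fin n → ℝ) :
    ∃ P : ℕ → SimpleSystem V (Fin n), (∀ k, (P k).a = a) ∧ (∀ k i, b i ≤ (P k).b i) ∧
      ∀ i, Tendsto (fun k => (P k).b i) atTop (𝓝 (b i)) := by
  classical
  let β : ℝ → Fin n → ℝ := fun ε i => b i + ε ^ (i.1 + 1)
  have hβ : ∀ᶠ ε in 𝓝[>] 0, ∀ S : Finset (Fin n),
      ¬ LinearIndependent ℝ (fun i : S => a i) → ∀ x, ¬ ∀ i ∈ S, a i x = β ε i := by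
    refine eventually_all.2 fun S => ?_
    by_cases hS : LinearIndependent ℝ (fun i : S => a i)
    · simp [hS]
    obtain ⟨lam, hlam, i, hi⟩ := Fintype.not_linearIndependent_iff.1 hS
    let F : Polynomial ℝ := ∑ i : S, Polynomial.C (lam i) *
      (Polynomial.C (b i) + Polynomial.X ^ (i.1.1 + 1))
    have hF : F ≠ 0 := fun h => hi <| by
      have := congrArg (fun G => Polynomial.coeff G (i.1.1 + 1)) h
      simpa [F, Polynomial.coeff_X_pow, Polynomial.coeff_C, Fin.val_inj, Subtype.val_inj] using this
    have hfin : ∀ᶠ ε in 𝓝[>] (0 : ℝ), ε ∉ F.roots.toFinset :=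
      (F.roots.toFinset.finite_toSet.eventually_cofinite_notMem).filter_mono
        ((nhdsGT_le_nhdsNE 0).trans (nhdsNE_le_cofinite 0))
    filter_upwards [hfin] with ε hε _ x hx
    refine hε ?_
    rw [Multiset.mem_toFinset, Polynomial.mem_roots hF, Polynomial.IsRoot.def]
    have := congrArg (fun g => g x) hlam
    simp only [LinearMap.coe_sum, Finset.sum_apply, LinearMap.smul_apply, smul_eq_mul,
      LinearMap.zero_apply] at this
    rw [← this, Polynomial.eval_finsetSum]
    refine Finset.sum_congr rfl fun i _ => ?_
    rw [hx i i.2]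
    simp [β]
  obtain ⟨ε, hε, hεβ⟩ :=
    exists_seq_forall_of_frequently (hβ.and self_mem_nhdsWithin).frequently
  refine ⟨fun k => ⟨a, β (ε k), fun x _ => ?_⟩, fun _ => rfl, fun k i => ?_, fun i => ?_⟩
  · by_contra hdep
    refine (hεβ k).1 (Finset.univ.filter fun i => a i x = β (ε k) i) (fun hli => hdep ?_) x
      (by simp)
    exact hli.comp (fun i : {i // a i x = β (ε k) i} => ⟨i.1, by simpa using i.2⟩)
      fun i j h => by
        injection h with h
        exact Subtype.ext h
  · have : 0 < ε k := (hεβ k).2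
    simp only [β]
    linarith [pow_pos this (i.1 + 1)]
  · have h1 : Continuous fun t : ℝ => β t i := by fun_prop
    have h2 := (h1.tendsto 0).comp (hε.mono_right nhdsWithin_le_nhds)
    simpa [β, Function.comp_def] using h2

end Polyhedron

/-- (Larman) Every `d`-dimensional polyhedron (`d ≥ 3`) defined by `n` linear inequalities
has diameter at most `n · 2^(d-3)`. -/
theorem larman_bound
    (d n : ℕ) (hd : 3 ≤ d) (hn : 1 ≤ n)
    (a : Fin n → Fin d → ℝ) (b : Fin n → ℝ) :
    ∀ u ∈ Set.extremePoints ℝ {x : Fin d → ℝ | ∀ i, ∑ j, a i j * x j ≤ b i},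
      ∀ v ∈ Set.extremePoints ℝ {x : Fin d → ℝ | ∀ i, ∑ j, a i j * x j ≤ b i},
        ∃ L ≤ n * 2 ^ (d - 3),
          HasPathOfLength {x : Fin d → ℝ | ∀ i, ∑ j, a i j * x j ≤ b i} u v L := by
  intro u hu v hv
  let A : Fin n → Module.Dual ℝ (Fin d → ℝ) := fun i => ∑ j, a i j • LinearMap.proj j
  have hA : {x : Fin d → ℝ | ∀ i, ∑ j, a i j * x j ≤ b i} = {x | ∀ i, A i x ≤ b i} := by
    simp [A]
  rw [hA] at hu hv ⊢
  obtain ⟨P, ha, hle, hb⟩ := SimpleSystem.exists_tendsto A b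
  simpa using SimpleSystem.exists_hasPathOfLength_of_tendsto (by simpa using hd) ha hb hle hu hv
end
end

section
/- (Naddef) Let P ⊆ (Fin N → ℝ) be the convex hull of a nonempty finite set S with S ⊆ {0,1}^N (every coordinate of every point of S is 0 or 1). Let d be the dimension of P and n the number of facets of P. Then any two extreme points of P are joined by a path in the graph G(P) of length at most n − d (the Hirsch Conjecture holds for 0-1 polytopes). -/
open scoped BigOperators

noncomputable section

/-- A face of a convex set `P`: a convex extreme subset. -/
def IsFace {E : Type*} [AddCommGroup E] [Module ℝ E] (P F : Set E) : Prop :=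
  Convex ℝ F ∧ IsExtreme ℝ P F

/-- The dimension of a set: the rank of the direction of its affine span. -/
noncomputable def setDim {E : Type*} [AddCommGroup E] [Module ℝ E] (S : Set E) : ℕ :=
  Module.finrank ℝ (affineSpan ℝ S).direction

/-- A facet of `P` is a face of dimension `dim P - 1`. -/
def IsFacet {E : Type*} [AddCommGroup E] [Module ℝ E] (P F : Set E) : Prop :=
  IsFace P F ∧ setDim F = setDim P - 1

/-- The number of facets of `P`. -/
noncomputable def numFacets {E : Type*} [AddCommGroup E] [Module ℝ E] (P : Set E) : ℕ :=
  Set.ncard {F : Set E | IsFacet P F}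

section Polytope

/-- Rotate `g` towards `f` until a point of `S` with `0 < f` is reached. -/
theorem exists_rotation {α : Type*} (S : Finset α) (f g : α → ℝ) (hf : ∃ s ∈ S, 0 < f s) :
    ∃ t : ℝ, (∀ s ∈ S, 0 < f s → 0 ≤ g s + t * f s) ∧ ∃ s ∈ S, 0 < f s ∧ g s + t * f s = 0 := by
  classical
  obtain ⟨s₀, hs₀, hfs₀⟩ := hf
  obtain ⟨s, hs, hmin⟩ := (S.filter (0 < f ·)).exists_min_image (fun s => g s / f s)
    ⟨s₀, by simp [hs₀, hfs₀]⟩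
  rw [Finset.mem_filter] at hs
  refine ⟨-(g s / f s), fun r hr hfr => ?_, s, hs.1, hs.2, ?_⟩
  · have := hmin r (by simp [hr, hfr])
    rw [le_div_iff₀ hfr] at this
    linarith
  · have := hs.2.ne'
    field_simp
    ring

variable {E : Type*} [AddCommGroup E] [Module ℝ E]

theorem IsFace.trans {P F G : Set E} (hF : IsFace P F) (hG : IsFace F G) : IsFace P G :=
  ⟨hG.1, hF.2.trans hG.2⟩

/-- A face of the convex hull of `S` is the convex hull of the points of `S` it contains. -/
theorem IsFace.eq_convexHull_inter {S F : Set E} (hF : IsFace (convexHull ℝ S) F) :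
    F = convexHull ℝ (S ∩ F) := by
  refine Set.Subset.antisymm (fun x hx => ?_)
    (convexHull_min Set.inter_subset_right hF.1)
  have hconv : Convex ℝ {x ∈ convexHull ℝ S | x ∈ F → x ∈ convexHull ℝ (S ∩ F)} := by
    rw [convex_iff_openSegment_subset]
    rintro x ⟨hx, hxF⟩ y ⟨hy, hyF⟩ z hz
    refine ⟨(convex_convexHull ℝ S).openSegment_subset hx hy hz, fun hzF => ?_⟩
    exact (convex_convexHull ℝ (S ∩ F)).openSegment_subset
      (hxF (hF.2.left_mem_of_mem_openSegment hx hy hzF hz))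
      (hyF (hF.2.right_mem_of_mem_openSegment hx hy hzF hz)) hz
  have hS : S ⊆ {x ∈ convexHull ℝ S | x ∈ F → x ∈ convexHull ℝ (S ∩ F)} := fun s hs =>
    ⟨subset_convexHull ℝ S hs, fun h => subset_convexHull ℝ _ ⟨hs, h⟩⟩
  exact (convexHull_min hS hconv (hF.2.subset hx)).2 hx

theorem IsFace.convexHull_filter {S : Finset E} {F : Set E} [DecidablePred (· ∈ F)]
    (hF : IsFace (convexHull ℝ (S : Set E)) F) :
    convexHull ℝ (S.filter (· ∈ F) : Set E) = F := by
  rw [Finset.coe_filter]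
  exact hF.eq_convexHull_inter.symm

/-- A face of `P` contains every point of `P` in its affine span. -/
theorem IsFace.mem_of_mem_affineSpan {P F : Set E} (hF : IsFace P F) {p : E} (hp : p ∈ P)
    (hpF : p ∈ affineSpan ℝ F) : p ∈ F := by
  have hspan : p ∈ affineSpan ℝ (Set.range (Subtype.val : F → E)) := by
    rwa [Subtype.range_coe]
  obtain ⟨t, w, hw, hpw⟩ := eq_affineCombination_of_mem_affineSpan hspan
  rw [affineCombination_eq_centerMass hw, Finset.centerMass_eq_of_sum_1 _ _ hw] at hpw
  have ht : t.Nonempty := by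
    rw [Finset.nonempty_iff_ne_empty]
    rintro rfl
    simp at hw
  have hcard : (0 : ℝ) < t.card := by exact_mod_cast ht.card_pos
  have hcard' : (t.card : ℝ) ≠ 0 := hcard.ne'
  set M : ℝ := 1 + ∑ i ∈ t, |w i|
  have hMpos : 0 < M := by positivity
  have hwM : ∀ i ∈ t, 0 ≤ w i + M := fun i hi => by
    have h₁ := Finset.single_le_sum (f := fun i => |w i|) (fun i _ => abs_nonneg _) hi
    have h₂ := neg_abs_le (w i)
    linarith
  have hden : (0 : ℝ) < 1 + t.card * M := by positivity
  have hq : ∑ i ∈ t, (t.card : ℝ)⁻¹ • (i : E) ∈ F :=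
    hF.1.sum_mem (fun _ _ => by positivity) (by simp [hcard']) (fun i _ => i.2)
  have hr : ∑ i ∈ t, ((1 + t.card * M)⁻¹ * (w i + M)) • (i : E) ∈ F := by
    refine hF.1.sum_mem (fun i hi => mul_nonneg (by positivity) (hwM i hi)) ?_ (fun i _ => i.2)
    rw [← Finset.mul_sum, Finset.sum_add_distrib, hw, Finset.sum_const, nsmul_eq_mul,
      inv_mul_cancel₀ hden.ne']
  refine hF.2.left_mem_of_mem_openSegment hp (hF.2.subset hq) hr
    ⟨(1 + t.card * M)⁻¹, (1 + t.card * M)⁻¹ * (t.card * M), by positivity, by positivity,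
      by field_simp, ?_⟩
  rw [hpw, Finset.smul_sum, Finset.smul_sum, ← Finset.sum_add_distrib]
  refine Finset.sum_congr rfl fun i _ => ?_
  rw [smul_smul, smul_smul, ← add_smul]
  congr 1
  field_simp

theorem setDim_eq_vectorSpan (F : Set E) : setDim F = Module.finrank ℝ (vectorSpan ℝ F) := by
  rw [setDim, direction_affineSpan]

/-- A nonnegative affine functional cuts out a face. -/
theorem isFace_of_nonneg {P : Set E} (hP : Convex ℝ P) (f : E →ᵃ[ℝ] ℝ) (hf : ∀ x ∈ P, 0 ≤ f x) :
    IsFace P {x ∈ P | f x = 0} := by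
  refine ⟨hP.inter ((convex_singleton (0 : ℝ)).affine_preimage f), Set.sep_subset _ _, ?_⟩
  rintro x hx y hy z ⟨-, hz⟩ ⟨a, b, ha, hb, hab, rfl⟩
  refine ⟨hx, ?_⟩
  rw [Convex.combo_affine_apply hab, smul_eq_mul, smul_eq_mul] at hz
  have h₁ := mul_nonneg ha.le (hf x hx)
  have h₂ := mul_nonneg hb.le (hf y hy)
  have h₃ : a * f x = 0 := by linarith
  exact (mul_eq_zero.1 h₃).resolve_left ha.ne'

theorem nonneg_on_convexHull {S : Set E} (f : E →ᵃ[ℝ] ℝ) (hf : ∀ s ∈ S, 0 ≤ f s) :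
    ∀ x ∈ convexHull ℝ S, 0 ≤ f x :=
  convexHull_min (t := {x | 0 ≤ f x}) hf ((convex_Ici (0 : ℝ)).affine_preimage f)

theorem exists_affineMap_pos_of_notMem (A : AffineSubspace ℝ E) {a q : E} (ha : a ∈ A)
    (hq : q ∉ A) : ∃ f : E →ᵃ[ℝ] ℝ, 0 < f q ∧ ∀ x ∈ A, f x = 0 := by
  have hq' : q - a ∉ A.direction := by
    rw [← vsub_eq_sub, AffineSubspace.vsub_right_mem_direction_iff_mem ha]
    exact hq
  obtain ⟨φ, hφ, hker⟩ := Submodule.exists_le_ker_of_notMem hq'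
  have hzero : ∀ x ∈ A, φ (x - a) = 0 := fun x hx =>
    hker (AffineSubspace.vsub_mem_direction hx ha)
  refine ⟨φ (q - a) • (φ.toAffineMap - AffineMap.const ℝ E (φ a)), ?_, fun x hx => ?_⟩
  · simpa [← map_sub] using mul_self_pos.2 hφ
  · simpa [← map_sub] using Or.inr (hzero x hx)

/-- The nonempty faces of codimension one. -/
def properFacets (P : Set E) : Set (Set E) :=
  {F | F.Nonempty ∧ IsFace P F ∧ setDim F + 1 = setDim P}

theorem finite_faces (S : Finset E) : {F | IsFace (convexHull ℝ (S : Set E)) F}.Finite :=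
  (S.finite_toSet.finite_subsets.image (convexHull ℝ)).subset fun F hF =>
    ⟨S ∩ F, Set.inter_subset_left, IsFace.eq_convexHull_inter hF |>.symm⟩

theorem finite_properFacets (S : Finset E) :
    (properFacets (convexHull ℝ (S : Set E))).Finite :=
  (finite_faces S).subset fun _ hF => hF.2.1

variable [FiniteDimensional ℝ E]

theorem setDim_mono {F G : Set E} (h : F ⊆ G) : setDim F ≤ setDim G := by
  rw [setDim_eq_vectorSpan, setDim_eq_vectorSpan]
  exact Submodule.finrank_mono (vectorSpan_mono ℝ h)

theorem affineSpan_eq_of_setDim_le {F G : Set E} (hF : F.Nonempty) (h : F ⊆ G)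
    (hd : setDim G ≤ setDim F) : affineSpan ℝ F = affineSpan ℝ G := by
  refine AffineSubspace.eq_of_direction_eq_of_nonempty_of_le ?_
    ((affineSpan_nonempty (k := ℝ)).2 hF) (affineSpan_mono ℝ h)
  exact Submodule.eq_of_le_of_finrank_le
    (AffineSubspace.direction_le (affineSpan_mono ℝ h)) hd

theorem IsFace.eq_of_setDim_le {P F G : Set E} (hF : IsFace P F) (hne : F.Nonempty)
    (hFG : F ⊆ G) (hGP : G ⊆ P) (hd : setDim G ≤ setDim F) : F = G :=
  hFG.antisymm fun x hx => hF.mem_of_mem_affineSpan (hGP hx) <| by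
    rw [affineSpan_eq_of_setDim_le hne hFG hd]
    exact subset_affineSpan ℝ G hx

theorem IsFace.setDim_lt {P F G : Set E} (hF : IsFace P F) (hne : F.Nonempty)
    (hFG : F ⊆ G) (hGP : G ⊆ P) (hFG' : F ≠ G) : setDim F < setDim G :=
  not_le.1 fun h => hFG' (hF.eq_of_setDim_le hne hFG hGP h)

/-- Facets are exposed. -/
theorem exists_supporting_of_mem_properFacets {P F : Set E} (hP : Convex ℝ P)
    (hF : F ∈ properFacets P) :
    ∃ f : E →ᵃ[ℝ] ℝ, (∀ x ∈ P, 0 ≤ f x) ∧ ∀ x ∈ P, f x = 0 ↔ x ∈ F := by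
  obtain ⟨⟨a, ha⟩, hface, hdim⟩ := hF
  have haA := subset_affineSpan ℝ F ha
  obtain ⟨p, hpP, hpF⟩ : ∃ p ∈ P, p ∉ F := by
    by_contra! h
    have := hface.2.subset.antisymm h
    subst this
    omega
  obtain ⟨f, hfp, hf⟩ := exists_affineMap_pos_of_notMem (affineSpan ℝ F) haA
    (fun h => hpF (hface.mem_of_mem_affineSpan hpP h))
  have hzero : ∀ x ∈ P, f x = 0 ↔ x ∈ F := by
    refine fun x hx => ⟨fun h => ?_, fun h => hf x (subset_affineSpan ℝ F h)⟩
    by_contra hxF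
    have hsub : insert x F ⊆ P := Set.insert_subset hx hface.2.subset
    have hlt := hface.setDim_lt ⟨a, ha⟩ (Set.subset_insert x F) hsub
      (fun h => hxF (h ▸ Set.mem_insert x F))
    have hspan := affineSpan_eq_of_setDim_le (Set.insert_nonempty x F) hsub (by omega)
    have hle : affineSpan ℝ (insert x F) ≤
        (AffineSubspace.mk' (0 : ℝ) (⊥ : Submodule ℝ ℝ)).comap f := by
      rw [affineSpan_le]
      rintro y (rfl | hy)
      · simp [h]
      · simp [hf y (subset_affineSpan ℝ F hy)]
    have := hle (hspan ▸ subset_affineSpan ℝ P hpP)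
    simp [hfp.ne'] at this
  refine ⟨f, fun x hx => ?_, hzero⟩
  by_contra! hneg
  have hden : 0 < f p - f x := by linarith
  have hseg : (f p / (f p - f x)) • x + (-f x / (f p - f x)) • p ∈ openSegment ℝ x p :=
    ⟨_, _, div_pos hfp hden, div_pos (by linarith) hden, by field_simp; ring, rfl⟩
  have hmem : (f p / (f p - f x)) • x + (-f x / (f p - f x)) • p ∈ F := by
    rw [← hzero _ (hP.openSegment_subset hx hpP hseg),
      Convex.combo_affine_apply (by field_simp; ring)]
    simp only [smul_eq_mul]
    field_simp
    ring
  exact hneg.ne ((hzero x hx).2 (hface.2.left_mem_of_mem_openSegment hx hpP hmem hseg))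

/-- A facet of a facet is cut out by another facet. -/
theorem exists_properFacet_inter_eq (S : Finset E) {F R : Set E}
    (hF : F ∈ properFacets (convexHull ℝ (S : Set E))) (hR : R ∈ properFacets F) :
    ∃ G ∈ properFacets (convexHull ℝ (S : Set E)), G ≠ F ∧ G ∩ F = R := by
  have hP := convex_convexHull ℝ (S : Set E)
  obtain ⟨f, hf, hfF⟩ := exists_supporting_of_mem_properFacets hP hF
  obtain ⟨g, hg, hgR⟩ := exists_supporting_of_mem_properFacets hF.2.1.1 hR
  have hFP := hF.2.1.2.subset
  have hRF := hR.2.1.2.subset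
  have hSP := subset_convexHull ℝ (S : Set E)
  have hpos : ∃ s ∈ S, 0 < f s := by
    by_contra! h
    have hsub : convexHull ℝ (S : Set E) ⊆ F := fun x hx => (hfF x hx).1 <|
      le_antisymm (by simpa using nonneg_on_convexHull (-f) (by simpa using h) x hx) (hf x hx)
    have := setDim_mono hsub
    have := hF.2.2
    omega
  obtain ⟨t, ht, s, hs, hfs, hts⟩ := exists_rotation S f g hpos
  have hF0 : ∀ x ∈ F, f x = 0 := fun x hx => (hfF x (hFP hx)).2 hx
  have hval : ∀ x, (g + t • f) x = g x + t * f x := fun x => by simp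
  have hnn : ∀ x ∈ convexHull ℝ (S : Set E), 0 ≤ (g + t • f) x := by
    refine nonneg_on_convexHull _ fun r hr => ?_
    rw [hval]
    rcases (hf r (hSP hr)).eq_or_lt with h | h
    · rw [← h, mul_zero, add_zero]
      exact hg r ((hfF r (hSP hr)).1 h.symm)
    · exact ht r hr h
  have hG := isFace_of_nonneg hP _ hnn
  set G := {x ∈ convexHull ℝ (S : Set E) | (g + t • f) x = 0}
  have hGF : G ∩ F = R := by
    ext x
    constructor
    · rintro ⟨⟨-, hx⟩, hxF⟩
      rw [hval, hF0 x hxF, mul_zero, add_zero] at hx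
      exact (hgR x hxF).1 hx
    · intro hx
      refine ⟨⟨hFP (hRF hx), ?_⟩, hRF hx⟩
      rw [hval, hF0 x (hRF hx), (hgR x (hRF hx)).2 hx, mul_zero, add_zero]
  have hsG : s ∈ G := ⟨hSP hs, by rw [hval, hts]⟩
  have hsF : s ∉ F := fun h => hfs.ne' (hF0 s h)
  have hRG : R ⊆ G := hGF ▸ Set.inter_subset_left
  have hlt₁ : setDim R < setDim G :=
    (hF.2.1.trans hR.2.1).setDim_lt hR.1 hRG hG.2.subset fun h => hsF (hRF (h ▸ hsG))
  have hlt₂ : setDim G < setDim (convexHull ℝ (S : Set E)) := by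
    refine hG.setDim_lt ⟨s, hsG⟩ hG.2.subset subset_rfl fun h => ?_
    rw [h, Set.inter_eq_right.2 hFP] at hGF
    have := hR.2.2
    rw [hGF] at this
    omega
  have h₁ := hF.2.2
  have h₂ := hR.2.2
  exact ⟨G, ⟨⟨s, hsG⟩, hG, by omega⟩, fun h => hsF (h ▸ hsG), hGF⟩

/-- An exposed vertex of a polytope of positive dimension lies in a facet. -/
theorem exists_properFacet_mem (S : Finset E) {u : E} (hu : u ∈ S) (g : E →ᵃ[ℝ] ℝ)
    (hg : ∀ s ∈ S, 0 ≤ g s) (hgu : ∀ x ∈ convexHull ℝ (S : Set E), g x = 0 ↔ x = u)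
    (hd : 0 < setDim (convexHull ℝ (S : Set E))) :
    ∃ F ∈ properFacets (convexHull ℝ (S : Set E)), u ∈ F := by
  have hP := convex_convexHull ℝ (S : Set E)
  have hSP := subset_convexHull ℝ (S : Set E)
  set P := convexHull ℝ (S : Set E)
  have step : ∀ k (g : E →ᵃ[ℝ] ℝ), (∀ s ∈ S, 0 ≤ g s) → g u = 0 → (∃ p ∈ P, g p ≠ 0) →
      setDim {x ∈ P | g x = 0} + k = setDim P → ∃ F ∈ properFacets P, u ∈ F := by
    intro k
    induction k using Nat.strong_induction_on with
    | _ k ih =>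
      intro g hg hgu ⟨p, hpP, hgp⟩ hk
      have hgP := nonneg_on_convexHull g hg
      have hG := isFace_of_nonneg hP g hgP
      set G := {x ∈ P | g x = 0}
      have huG : u ∈ G := ⟨hSP hu, hgu⟩
      have hlt : setDim G < setDim P :=
        hG.setDim_lt ⟨u, huG⟩ hG.2.subset subset_rfl fun h => hgp (h ▸ hpP : p ∈ G).2
      by_cases hk1 : setDim G + 1 = setDim P
      · exact ⟨G, ⟨⟨u, huG⟩, hG, hk1⟩, huG⟩
      have hins : setDim (insert p G) < setDim P := by
        have := finrank_vectorSpan_insert_le_set ℝ G p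
        rw [← setDim_eq_vectorSpan, ← setDim_eq_vectorSpan] at this
        omega
      obtain ⟨q, hqP, hq⟩ : ∃ q ∈ P, q ∉ affineSpan ℝ (insert p G) := by
        by_contra! h
        have h₁ := AffineSubspace.direction_le ((affineSpan_le (k := ℝ) (s := P)).2 h)
        have h₂ := Submodule.finrank_mono h₁
        simp only [setDim] at hins
        omega
      obtain ⟨f, hfq, hf⟩ := exists_affineMap_pos_of_notMem _
        (subset_affineSpan ℝ _ (Set.mem_insert p G)) hq
      have hpos : ∃ s ∈ S, 0 < f s := by
        by_contra! h
        have := nonneg_on_convexHull (-f) (by simpa using h) q hqP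
        simp at this
        linarith
      obtain ⟨t, ht, s, hs, hfs, hts⟩ := exists_rotation S f g hpos
      have ht0 : t ≤ 0 := by
        by_contra! h
        have := mul_pos h hfs
        have := hg s hs
        linarith
      have hval : ∀ x, (g + t • f) x = g x + t * f x := fun x => by simp
      have hf0 : ∀ x ∈ insert p G, f x = 0 := fun x hx => hf x (subset_affineSpan ℝ _ hx)
      have hnn : ∀ r ∈ S, 0 ≤ (g + t • f) r := by
        intro r hr
        rw [hval]
        rcases le_or_gt (f r) 0 with h | h
        · exact add_nonneg (hg r hr) (mul_nonneg_of_nonpos_of_nonpos ht0 h)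
        · exact ht r hr h
      have hGsub : G ⊆ {x ∈ P | (g + t • f) x = 0} := fun x hx =>
        ⟨hx.1, by rw [hval, hf0 x (Set.mem_insert_of_mem p hx), hx.2, mul_zero, add_zero]⟩
      have hH := isFace_of_nonneg hP _ (nonneg_on_convexHull _ hnn)
      have hsG : s ∉ G := fun h => hfs.ne' (hf0 s (Set.mem_insert_of_mem p h))
      have hlt' := hG.setDim_lt ⟨u, huG⟩ hGsub hH.2.subset
        fun h => hsG (h ▸ ⟨hSP hs, by rw [hval, hts]⟩)
      have hle := setDim_mono hH.2.subset
      refine ih (setDim P - setDim {x ∈ P | (g + t • f) x = 0}) (by omega) _ hnn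
        (hGsub huG).2 ⟨p, hpP, ?_⟩ (by omega)
      rwa [hval, hf0 p (Set.mem_insert p G), mul_zero, add_zero]
  obtain ⟨p, hpP, hpu⟩ : ∃ p ∈ P, p ≠ u := by
    by_contra! h
    have := setDim_mono (show P ⊆ {u} from h)
    rw [setDim_eq_vectorSpan {u}, vectorSpan_singleton, finrank_bot] at this
    omega
  have hsub : setDim {x ∈ P | g x = 0} ≤ setDim P := setDim_mono (Set.sep_subset _ _)
  exact step (setDim P - setDim {x ∈ P | g x = 0}) g hg ((hgu u (hSP hu)).2 rfl)
    ⟨p, hpP, fun h => hpu ((hgu p hpP).1 h)⟩ (by omega)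

theorem ncard_properFacets_add_one_le (S : Finset E) {F : Set E} (p : Set E → Prop)
    (hp : ∀ {A B}, A ⊆ B → p A → p B)
    (hF : F ∈ properFacets (convexHull ℝ (S : Set E))) (hpF : p F) :
    {R ∈ properFacets F | p R}.ncard + 1 ≤
      {G ∈ properFacets (convexHull ℝ (S : Set E)) | p G}.ncard := by
  have hfin : {G ∈ properFacets (convexHull ℝ (S : Set E)) | p G}.Finite :=
    (finite_properFacets S).subset (Set.sep_subset _ _)
  have hmem : F ∈ {G ∈ properFacets (convexHull ℝ (S : Set E)) | p G} := ⟨hF, hpF⟩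
  rw [← Set.ncard_sdiff_singleton_add_one hmem hfin]
  refine Nat.add_le_add_right ?_ 1
  refine (Set.ncard_le_ncard (t := (· ∩ F) ''
    ({G ∈ properFacets (convexHull ℝ (S : Set E)) | p G} \ {F})) ?_
    (hfin.sdiff.image _)).trans (Set.ncard_image_le hfin.sdiff)
  rintro R ⟨hR, hpR⟩
  obtain ⟨G, hG, hne, hGF⟩ := exists_properFacet_inter_eq S hF hR
  exact ⟨G, ⟨⟨hG, hp (hGF ▸ Set.inter_subset_left) hpR⟩, hne⟩, hGF⟩

/-- An exposed vertex of a `d`-polytope lies in at least `d` facets. -/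
theorem setDim_le_ncard_properFacets_mem (S : Finset E) {u : E} (hu : u ∈ S) (g : E →ᵃ[ℝ] ℝ)
    (hg : ∀ s ∈ S, 0 ≤ g s) (hgu : ∀ x ∈ convexHull ℝ (S : Set E), g x = 0 ↔ x = u) :
    setDim (convexHull ℝ (S : Set E)) ≤
      {F ∈ properFacets (convexHull ℝ (S : Set E)) | u ∈ F}.ncard := by
  classical
  induction hd : setDim (convexHull ℝ (S : Set E)) generalizing S with
  | zero => exact Nat.zero_le _
  | succ d ih =>
    obtain ⟨F, hF, huF⟩ := exists_properFacet_mem S hu g hg hgu (by omega)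
    have hcard := ncard_properFacets_add_one_le S (u ∈ ·) (fun h h' => h h') hF huF
    have hhull := hF.2.1.convexHull_filter
    have hdF := hF.2.2
    have := ih (S.filter (· ∈ F)) (by simp [hu, huF])
      (fun s hs => hg s (Finset.mem_filter.1 hs).1)
      (fun x hx => hgu x (hF.2.1.2.subset (hhull ▸ hx))) (by rw [hhull]; omega)
    rw [hhull] at this
    omega

end Polytope

section Paths

variable {E : Type*} [AddCommGroup E] [Module ℝ E]

theorem PolyAdj.of_isFace {P F : Set E} (hF : IsFace P F) {a b : E} (h : PolyAdj F a b) :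
    PolyAdj P a b :=
  ⟨h.1, hF.2.extremePoints_subset_extremePoints h.2.1,
    hF.2.extremePoints_subset_extremePoints h.2.2.1, hF.2.trans h.2.2.2⟩

theorem HasPathOfLength.of_isFace {P F : Set E} (hF : IsFace P F) {a b : E} {L : ℕ}
    (h : HasPathOfLength F a b L) : HasPathOfLength P a b L := by
  obtain ⟨f, h0, hL, hf⟩ := h
  exact ⟨f, h0, hL, fun i hi => (hf i hi).of_isFace hF⟩

theorem HasPathOfLength.refl (P : Set E) (a : E) : HasPathOfLength P a a 0 :=
  ⟨fun _ => a, rfl, rfl, fun i hi => absurd hi (Nat.not_lt_zero i)⟩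

theorem HasPathOfLength.cons {P : Set E} {a b c : E} {L : ℕ} (hab : PolyAdj P a b)
    (h : HasPathOfLength P b c L) : HasPathOfLength P a c (L + 1) := by
  obtain ⟨f, h0, hL, hf⟩ := h
  refine ⟨fun n => Nat.casesOn n a f, rfl, hL, fun i hi => ?_⟩
  cases i with
  | zero => simpa [h0] using hab
  | succ i => exact hf i (by omega)

end Paths

section ZeroOne

variable {N : ℕ}

theorem exists_exposing_of_zero_one {S : Finset (Fin N → ℝ)}
    (h01 : ∀ x ∈ S, ∀ i, x i = 0 ∨ x i = 1) {u : Fin N → ℝ} (hu : u ∈ S) :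
    ∃ g : (Fin N → ℝ) →ᵃ[ℝ] ℝ, (∀ s ∈ S, 0 ≤ g s) ∧
      ∀ x ∈ convexHull ℝ (S : Set (Fin N → ℝ)), g x = 0 ↔ x = u := by
  let φ : (Fin N → ℝ) →ₗ[ℝ] ℝ := ∑ i, (1 - 2 * u i) • LinearMap.proj i
  let g : (Fin N → ℝ) →ᵃ[ℝ] ℝ := φ.toAffineMap - AffineMap.const ℝ _ (φ u)
  have hval : ∀ x, g x = ∑ i, (1 - 2 * u i) * (x i - u i) := fun x => by
    simp [g, φ, mul_sub, Finset.sum_sub_distrib]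
  have hcoord : ∀ x ∈ convexHull ℝ (S : Set (Fin N → ℝ)), ∀ i, x i ∈ Set.Icc (0 : ℝ) 1 := by
    intro x hx i
    refine convexHull_min (t := (LinearMap.proj i : (Fin N → ℝ) →ₗ[ℝ] ℝ) ⁻¹' Set.Icc (0 : ℝ) 1)
      (fun s hs => ?_) ((convex_Icc (0 : ℝ) 1).linear_preimage _) hx
    rcases h01 s hs i with h | h <;> simp [h]
  have hterm : ∀ x ∈ convexHull ℝ (S : Set (Fin N → ℝ)), ∀ i ∈ Finset.univ,
      0 ≤ (1 - 2 * u i) * (x i - u i) := by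
    intro x hx i _
    obtain ⟨h₀, h₁⟩ := hcoord x hx i
    rcases h01 u hu i with h | h <;> rw [h] <;> linarith
  refine ⟨g, fun s hs => ?_, fun x hx => ⟨fun h => ?_, fun h => by simp [h, hval]⟩⟩
  · rw [hval]
    exact Finset.sum_nonneg (hterm s (subset_convexHull ℝ _ hs))
  · rw [hval, Finset.sum_eq_zero_iff_of_nonneg (hterm x hx)] at h
    ext i
    have := h i (Finset.mem_univ i)
    rcases h01 u hu i with hi | hi <;> rw [hi] at this ⊢ <;> linarith

theorem mem_extremePoints_of_zero_one {S : Finset (Fin N → ℝ)}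
    (h01 : ∀ x ∈ S, ∀ i, x i = 0 ∨ x i = 1) {u : Fin N → ℝ} (hu : u ∈ S) :
    u ∈ Set.extremePoints ℝ (convexHull ℝ (S : Set (Fin N → ℝ))) := by
  obtain ⟨g, hg, hgu⟩ := exists_exposing_of_zero_one h01 hu
  rw [← isExtreme_singleton]
  have hface := (isFace_of_nonneg (convex_convexHull ℝ _) g (nonneg_on_convexHull g hg)).2
  suffices h : {u} = {x ∈ convexHull ℝ (S : Set (Fin N → ℝ)) | g x = 0} by rwa [h]
  refine Set.ext fun x => ?_
  exact ⟨fun h => (h : x = u) ▸ ⟨subset_convexHull ℝ _ hu, (hgu u (subset_convexHull ℝ _ hu)).2 rfl⟩,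
    fun h => (hgu x h.1).1 h.2⟩

/-- The 0-1 functional measuring the distance to `u` in coordinate `i`. -/
theorem exists_coord_dist {u : Fin N → ℝ} {i : Fin N} (hu : u i = 0 ∨ u i = 1) :
    ∃ f : (Fin N → ℝ) →ᵃ[ℝ] ℝ, ∀ x : Fin N → ℝ, x i = 0 ∨ x i = 1 →
      (x i = u i ∧ f x = 0) ∨ (x i ≠ u i ∧ f x = 1) := by
  let g : (Fin N → ℝ) →ᵃ[ℝ] ℝ := (LinearMap.proj i : (Fin N → ℝ) →ₗ[ℝ] ℝ).toAffineMap
  have hg : ∀ x, g x = x i := fun x => rfl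
  rcases hu with h | h
  · refine ⟨g, fun x hx => ?_⟩
    rcases hx with hx | hx <;> simp [hg, hx, h]
  · refine ⟨AffineMap.const ℝ _ 1 - g, fun x hx => ?_⟩
    rcases hx with hx | hx <;> simp [hg, hx, h]

/-- From a vertex on which a 0-1 functional vanishes there is an edge along which the functional
increases, unless it vanishes identically. -/
theorem exists_polyAdj_of_pos (S : Finset (Fin N → ℝ))
    (h01 : ∀ x ∈ S, ∀ i, x i = 0 ∨ x i = 1) (f : (Fin N → ℝ) →ᵃ[ℝ] ℝ)
    (hf : ∀ s ∈ S, f s = 0 ∨ f s = 1) {u v : Fin N → ℝ} (hu : u ∈ S) (hv : v ∈ S)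
    (hfu : f u = 0) (hfv : f v = 1) :
    ∃ w ∈ S, f w = 1 ∧ PolyAdj (convexHull ℝ (S : Set (Fin N → ℝ))) u w := by
  classical
  induction hd : setDim (convexHull ℝ (S : Set (Fin N → ℝ))) generalizing S v with
  | zero =>
    have huv : ({u} : Set (Fin N → ℝ)) = convexHull ℝ (S : Set (Fin N → ℝ)) :=
      IsFace.eq_of_setDim_le (P := convexHull ℝ (S : Set (Fin N → ℝ)))
        ⟨convex_singleton u, isExtreme_singleton.2 (mem_extremePoints_of_zero_one h01 hu)⟩
        (Set.singleton_nonempty u)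
        (Set.singleton_subset_iff.2 (subset_convexHull ℝ _ hu)) subset_rfl (by omega)
    have hvu : v = u := by
      have := subset_convexHull ℝ (S : Set (Fin N → ℝ)) hv
      rwa [← huv] at this
    rw [hvu, hfu] at hfv
    exact absurd hfv zero_ne_one
  | succ d ih =>
    have hP := convex_convexHull ℝ (S : Set (Fin N → ℝ))
    have hSP := subset_convexHull ℝ (S : Set (Fin N → ℝ))
    have huv : u ≠ v := fun h => zero_ne_one (hfu.symm.trans ((congrArg f h).trans hfv))
    obtain ⟨g, hg, hgu⟩ := exists_exposing_of_zero_one h01 hu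
    have hcard := setDim_le_ncard_properFacets_mem S hu g hg hgu
    set P := convexHull ℝ (S : Set (Fin N → ℝ))
    have hfP : ∀ x ∈ P, 0 ≤ f x :=
      nonneg_on_convexHull f fun s hs => by rcases hf s hs with h | h <;> simp [h]
    have hH := isFace_of_nonneg hP f hfP
    by_cases hex : ∃ F ∈ properFacets P, u ∈ F ∧ ¬ F ⊆ {x ∈ P | f x = 0}
    · obtain ⟨F, hF, huF, hFH⟩ := hex
      have hhull := hF.2.1.convexHull_filter
      obtain ⟨v', hv', hfv'⟩ : ∃ v' ∈ S.filter (· ∈ F), f v' ≠ 0 := by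
        by_contra! h
        refine hFH ?_
        nth_rewrite 1 [← hhull]
        refine convexHull_min (fun s hs => ⟨hSP (Finset.mem_filter.1 hs).1, h s hs⟩) hH.1
      have hS' : ∀ x ∈ S.filter (· ∈ F), x ∈ S := fun x hx => (Finset.mem_filter.1 hx).1
      obtain ⟨w, hw, hfw, hadj⟩ := ih (S.filter (· ∈ F)) (fun x hx => h01 x (hS' x hx))
        (fun x hx => hf x (hS' x hx)) (by simp [hu, huF]) hv'
        ((hf v' (hS' v' hv')).resolve_left hfv') (by rw [hhull]; have := hF.2.2; omega)
      rw [hhull] at hadj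
      exact ⟨w, hS' w hw, hfw, hadj.of_isFace hF.2.1⟩
    · push Not at hex
      have hHlt : setDim {x ∈ P | f x = 0} < setDim P :=
        hH.setDim_lt ⟨u, hSP hu, hfu⟩ hH.2.subset subset_rfl fun h => by
          have hvH : v ∈ {x ∈ P | f x = 0} := by
            rw [h]
            exact hSP hv
          exact zero_ne_one (hvH.2.symm.trans hfv)
      have hle : {F ∈ properFacets P | u ∈ F}.ncard ≤ 1 := by
        refine (Set.ncard_le_ncard (t := {{x ∈ P | f x = 0}}) ?_).trans
          (Set.ncard_singleton _).le
        rintro F ⟨hF, huF⟩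
        have hdF : setDim F + 1 = setDim P := hF.2.2
        have hHF : setDim {x ∈ P | f x = 0} ≤ setDim F := by omega
        exact hF.2.1.eq_of_setDim_le hF.1 (hex F hF huF) hH.2.subset hHF
      have hd0 : setDim P = 1 := by omega
      have hpair : ({u, v} : Set (Fin N → ℝ)) ⊆ P :=
        Set.insert_subset (hSP hu) (Set.singleton_subset_iff.2 (hSP hv))
      have hlt : setDim {u} < setDim {u, v} := by
        refine IsFace.setDim_lt (P := P) ⟨convex_singleton u,
          isExtreme_singleton.2 (mem_extremePoints_of_zero_one h01 hu)⟩
          (Set.singleton_nonempty u) (by simp) hpair fun h => huv ?_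
        have hvu : v ∈ ({u} : Set (Fin N → ℝ)) := by simp [h]
        exact hvu.symm
      have hspan := affineSpan_eq_of_setDim_le (Set.insert_nonempty u {v}) hpair (by omega)
      have hseg : segment ℝ u v = P := by
        refine (hP.segment_subset (hSP hu) (hSP hv)).antisymm
          (convexHull_min (fun s hs => ?_) (convex_segment u v))
        have hsA : s ∈ affineSpan ℝ {u, v} := by
          rw [hspan]
          exact subset_affineSpan ℝ P (hSP hs)
        obtain ⟨r, rfl⟩ := mem_affineSpan_pair_iff_exists_lineMap_eq.1 hsA
        have hr := hf _ hs
        rw [AffineMap.apply_lineMap, hfu, hfv] at hr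
        rcases hr with hr | hr
        · obtain rfl : r = 0 := by simpa [AffineMap.lineMap_apply] using hr
          simpa using left_mem_segment ℝ u v
        · obtain rfl : r = 1 := by simpa [AffineMap.lineMap_apply] using hr
          simpa using right_mem_segment ℝ u v
      refine ⟨v, hv, hfv, huv, mem_extremePoints_of_zero_one h01 hu,
        mem_extremePoints_of_zero_one h01 hv, ?_⟩
      rw [hseg]
      exact IsExtreme.refl ℝ P

/-- The diameter of a 0-1 polytope is at most its dimension. -/
theorem exists_path_le_setDim (S : Finset (Fin N → ℝ))
    (h01 : ∀ x ∈ S, ∀ i, x i = 0 ∨ x i = 1) {a b : Fin N → ℝ} (ha : a ∈ S) (hb : b ∈ S) :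
    ∃ L ≤ setDim (convexHull ℝ (S : Set (Fin N → ℝ))),
      HasPathOfLength (convexHull ℝ (S : Set (Fin N → ℝ))) a b L := by
  classical
  induction hd : setDim (convexHull ℝ (S : Set (Fin N → ℝ))) using Nat.strong_induction_on
    generalizing S a with
  | _ d ih =>
    by_cases hab : a = b
    · exact ⟨0, Nat.zero_le _, hab ▸ HasPathOfLength.refl _ a⟩
    obtain ⟨i, hi⟩ := Function.ne_iff.1 hab
    have hP := convex_convexHull ℝ (S : Set (Fin N → ℝ))
    have hSP := subset_convexHull ℝ (S : Set (Fin N → ℝ))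
    obtain ⟨f, hf⟩ := exists_coord_dist (h01 b hb i)
    have hf' : ∀ s ∈ S, (s i = b i ∧ f s = 0) ∨ (s i ≠ b i ∧ f s = 1) :=
      fun s hs => hf s (h01 s hs i)
    have hfb : f b = 0 := by simpa using hf' b hb
    have hfa : f a = 1 := by simpa [hi] using hf' a ha
    obtain ⟨w, hw, hfw, hadj⟩ := exists_polyAdj_of_pos S h01 (AffineMap.const ℝ _ 1 - f)
      (fun s hs => by rcases hf' s hs with h | h <;> simp [h.2]) ha hb
      (by simp [hfa]) (by simp [hfb])
    have hfw' : f w = 0 := by simpa using hfw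
    have hF := isFace_of_nonneg hP f
      (nonneg_on_convexHull f fun s hs => by rcases hf' s hs with h | h <;> simp [h.2])
    have haF : a ∉ {x ∈ convexHull ℝ (S : Set (Fin N → ℝ)) | f x = 0} := fun h =>
      zero_ne_one (h.2.symm.trans hfa)
    have hlt := hF.setDim_lt ⟨b, hSP hb, hfb⟩ hF.2.subset subset_rfl
      fun h => haF (by rw [h]; exact hSP ha)
    have hbF : b ∈ {x ∈ convexHull ℝ (S : Set (Fin N → ℝ)) | f x = 0} := ⟨hSP hb, hfb⟩
    have hwF : w ∈ {x ∈ convexHull ℝ (S : Set (Fin N → ℝ)) | f x = 0} := ⟨hSP hw, hfw'⟩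
    generalize {x ∈ convexHull ℝ (S : Set (Fin N → ℝ)) | f x = 0} = F at *
    obtain ⟨L, hL, hpath⟩ := ih (setDim F) (by omega) (S.filter (· ∈ F))
      (fun x hx => h01 x (Finset.mem_filter.1 hx).1) (a := w) (by simp [hw, hwF])
      (by simp [hb, hbF]) (by rw [hF.convexHull_filter])
    rw [hF.convexHull_filter] at hpath
    exact ⟨L + 1, by omega, .cons hadj (hpath.of_isFace hF)⟩

theorem exists_path_add_setDim_le_ncard (S : Finset (Fin N → ℝ))
    (h01 : ∀ x ∈ S, ∀ i, x i = 0 ∨ x i = 1) {a b : Fin N → ℝ} (ha : a ∈ S) (hb : b ∈ S) :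
    ∃ L, L + setDim (convexHull ℝ (S : Set (Fin N → ℝ))) ≤
        (properFacets (convexHull ℝ (S : Set (Fin N → ℝ)))).ncard ∧
      HasPathOfLength (convexHull ℝ (S : Set (Fin N → ℝ))) a b L := by
  classical
  induction hd : setDim (convexHull ℝ (S : Set (Fin N → ℝ))) generalizing S with
  | zero =>
    obtain ⟨L, hL, hpath⟩ := exists_path_le_setDim S h01 ha hb
    exact ⟨L, by omega, hpath⟩
  | succ d ih =>
    have hfin := finite_properFacets S
    by_cases hcommon : ∃ F ∈ properFacets (convexHull ℝ (S : Set (Fin N → ℝ))), a ∈ F ∧ b ∈ F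
    · obtain ⟨F, hF, haF, hbF⟩ := hcommon
      have hhull := hF.2.1.convexHull_filter
      have hdF := hF.2.2
      obtain ⟨L, hL, hpath⟩ := ih (S.filter (· ∈ F))
        (fun x hx => h01 x (Finset.mem_filter.1 hx).1) (by simp [ha, haF]) (by simp [hb, hbF])
        (by rw [hhull]; omega)
      rw [hhull] at hL hpath
      have hcard := ncard_properFacets_add_one_le S (fun _ => True) (fun _ h => h) hF trivial
      simp only [and_true, Set.ofPred_mem_eq] at hcard
      exact ⟨L, by omega, hpath.of_isFace hF.2.1⟩
    · have hcard : ∀ u ∈ S, d + 1 ≤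
          {F ∈ properFacets (convexHull ℝ (S : Set (Fin N → ℝ))) | u ∈ F}.ncard := by
        intro u hu
        obtain ⟨g, hg, hgu⟩ := exists_exposing_of_zero_one h01 hu
        exact hd ▸ setDim_le_ncard_properFacets_mem S hu g hg hgu
      have hdisj : Disjoint {F ∈ properFacets (convexHull ℝ (S : Set (Fin N → ℝ))) | a ∈ F}
          {F ∈ properFacets (convexHull ℝ (S : Set (Fin N → ℝ))) | b ∈ F} :=
        Set.disjoint_left.2 fun F h h' => hcommon ⟨F, h.1, h.2, h'.2⟩
      have hunion := Set.ncard_union_eq hdisj (hfin.subset (Set.sep_subset _ _))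
        (hfin.subset (Set.sep_subset _ _))
      have hle := Set.ncard_le_ncard
        (Set.union_subset (Set.sep_subset (properFacets (convexHull ℝ (S : Set (Fin N → ℝ))))
          (a ∈ ·)) (Set.sep_subset _ (b ∈ ·))) hfin
      have := hcard a ha
      have := hcard b hb
      obtain ⟨L, hL, hpath⟩ := exists_path_le_setDim S h01 ha hb
      exact ⟨L, by omega, hpath⟩

end ZeroOne

/-- (Naddef) The Hirsch Conjecture holds for 0-1 polytopes: if `P` is the convex hull of a
nonempty finite set of 0-1 vectors, `d` its dimension, `n` its number of facets, then any two
vertices of `P` are joined by a path of length at most `n - d`. -/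
theorem naddef_hirsch_01
    (N : ℕ) (S : Finset (Fin N → ℝ)) (hS : S.Nonempty)
    (h01 : ∀ x ∈ S, ∀ i, x i = 0 ∨ x i = 1) :
    ∀ a ∈ Set.extremePoints ℝ (convexHull ℝ (S : Set (Fin N → ℝ))),
      ∀ b ∈ Set.extremePoints ℝ (convexHull ℝ (S : Set (Fin N → ℝ))),
        ∃ L ≤ numFacets (convexHull ℝ (S : Set (Fin N → ℝ)))
              - setDim (convexHull ℝ (S : Set (Fin N → ℝ))),
          HasPathOfLength (convexHull ℝ (S : Set (Fin N → ℝ))) a b L := by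
  intro a ha b hb
  have haS : a ∈ S := by simpa using extremePoints_convexHull_subset ha
  have hbS : b ∈ S := by simpa using extremePoints_convexHull_subset hb
  obtain ⟨L, hL, hpath⟩ := exists_path_add_setDim_le_ncard S h01 haS hbS
  refine ⟨L, ?_, hpath⟩
  have hsub : properFacets (convexHull ℝ (S : Set (Fin N → ℝ))) ⊆
      {F | IsFacet (convexHull ℝ (S : Set (Fin N → ℝ))) F} := fun F hF =>
    ⟨hF.2.1, by have := hF.2.2; omega⟩
  have := Set.ncard_le_ncard hsub ((finite_faces S).subset fun F hF => hF.1)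
  unfold numFacets
  omega
end
end
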